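/- Let r>0, d≥2, and 1≤k≤d. If A⊆ℝ^d is a nonempty compact set with 0 < cr(A) ≤ r, then V_k(A^r)^{1/k} + V_k(conv_r(A))^{1/k} ≤ V_k(B[0,r])^{1/k}, where V_k denotes the k-th intrinsic volume. -/

import Mathlib

open MeasureTheory Metric Pointwise

/-- Volume of the unit ball in `ℝ^m`. -/
noncomputable def ballVolume (m : ℕ) : ℝ :=
  (volume (closedBall (0 : EuclideanSpace ℝ (Fin m)) 1)).toReal

/-- The `k`-th intrinsic volume of a set in `ℝ^d`, defined via the Steiner formula:
`vol(A + εB) = Σ_i ω_{d-i} V_i(A) ε^{d-i}`; the Steiner polynomial is recovered by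
Lagrange interpolation of `ε ↦ vol(A + εB)` at `ε = 0, 1, …, d`. -/
noncomputable def intrinsicVolume (d k : ℕ) (A : Set (EuclideanSpace ℝ (Fin d))) : ℝ :=
  ((Lagrange.interpolate (Finset.range (d + 1)) (fun j => (j : ℝ)))
      (fun j =>
        (volume (A + closedBall (0 : EuclideanSpace ℝ (Fin d)) (j : ℝ))).toReal)).coeff
      (d - k) / ballVolume (d - k)

/-- The circumradius of a set. -/
noncomputable def circumradius {d : ℕ} (A : Set (EuclideanSpace ℝ (Fin d))) : ℝ :=
  sInf {r : ℝ | 0 < r ∧ ∃ p, A ⊆ closedBall p r}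

/-- The `r`-dual (`r`-ball body generated by `A`): `A^r = ⋂_{p ∈ A} B[p,r]`. -/
def rDual {d : ℕ} (r : ℝ) (A : Set (EuclideanSpace ℝ (Fin d))) : Set (EuclideanSpace ℝ (Fin d)) :=
  ⋂ p ∈ A, closedBall p r

/-- The `r`-ball convex hull: intersection of all closed balls of radius `r` containing `A`. -/
def rHull {d : ℕ} (r : ℝ) (A : Set (EuclideanSpace ℝ (Fin d))) : Set (EuclideanSpace ℝ (Fin d)) :=
  ⋂ p ∈ {p : EuclideanSpace ℝ (Fin d) | A ⊆ closedBall p r}, closedBall p r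

open scoped ENNReal

namespace AFW

lemma bm1_compact (K L : Set ℝ) (hK : IsCompact K) (hL : IsCompact L) (hKn : K.Nonempty)
    (hLn : L.Nonempty) (S : Set ℝ) (hS : ∀ a ∈ K, ∀ b ∈ L, a + b ∈ S) :
    volume K + volume L ≤ volume S := by
  obtain ⟨m, hm, hmm⟩ := hL.exists_isLeast hLn
  obtain ⟨M, hM, hMM⟩ := hK.exists_isGreatest hKn
  have h1 : volume K = volume ((fun x => x + m) '' K) := by
    rw [Set.image_add_right]; simp
  have h2 : volume L = volume ((fun x => M + x) '' L) := by
    rw [Set.image_add_left]; simp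
  rw [h1, h2]
  have hd : AEDisjoint volume ((fun x => x + m) '' K) ((fun x => M + x) '' L) := by
    refine measure_mono_null (t := {M + m}) ?_ (by simp)
    rintro x ⟨⟨a, ha, rfl⟩, ⟨b, hb, hab⟩⟩
    have := hMM ha
    have := hmm hb
    simp only at hab ⊢
    simp only [Set.mem_singleton_iff]
    linarith
  rw [← measure_union₀ _ hd]
  · apply measure_mono
    rintro x (⟨a, ha, rfl⟩ | ⟨b, hb, rfl⟩)
    · exact hS _ ha _ hm
    · exact hS _ hM _ hb
  · exact ((hL.image (by fun_prop)).measurableSet).nullMeasurableSet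

lemma bm1 (A B S : Set ℝ) (hA : MeasurableSet A) (hB : MeasurableSet B) (hAn : A.Nonempty)
    (hBn : B.Nonempty) (hS : ∀ a ∈ A, ∀ b ∈ B, a + b ∈ S) :
    volume A + volume B ≤ volume S := by
  obtain ⟨a, ha⟩ := hAn
  obtain ⟨b, hb⟩ := hBn
  rw [hA.measure_eq_iSup_isCompact, hB.measure_eq_iSup_isCompact]
  simp only [iSup_and']
  refine ENNReal.biSup_add_biSup_le' ⟨∅, Set.empty_subset _, isCompact_empty⟩ ⟨∅, Set.empty_subset _, isCompact_empty⟩ fun K hK L hL => ?_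
  calc volume K + volume L ≤ volume (insert a K) + volume (insert b L) := by
        gcongr <;> exact Set.subset_insert _ _
    _ ≤ _ := by
        apply bm1_compact _ _ (hK.2.insert a) (hL.2.insert b) (Set.insert_nonempty _ _)
          (Set.insert_nonempty _ _)
        rintro x hx y hy
        apply hS
        · rcases hx with rfl | hx
          · exact ha
          · exact hK.1 hx
        · rcases hy with rfl | hy
          · exact hb
          · exact hL.1 hy

lemma pl_norm (f g h : ℝ → ℝ) (hf : Measurable f) (hg : Measurable g) (hh : Measurable h)
    (f0 : ∀ x, 0 ≤ f x) (g0 : ∀ x, 0 ≤ g x) (h0 : ∀ x, 0 ≤ h x)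
    (f1 : ∀ x, f x ≤ 1) (g1 : ∀ x, g x ≤ 1) (fs : ∀ s < 1, ∃ x, s < f x)
    (gs : ∀ s < 1, ∃ x, s < g x) (H : ∀ x y, f x * g y ≤ h ((x + y) / 2) ^ 2) :
    (∫⁻ x, ENNReal.ofReal (f x)) + ∫⁻ x, ENNReal.ofReal (g x) ≤
      2 * ∫⁻ x, ENNReal.ofReal (h x) := by
  rw [lintegral_eq_lintegral_meas_lt _ (Filter.Eventually.of_forall f0) hf.aemeasurable,
    lintegral_eq_lintegral_meas_lt _ (Filter.Eventually.of_forall g0) hg.aemeasurable,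
    lintegral_eq_lintegral_meas_lt _ (Filter.Eventually.of_forall h0) hh.aemeasurable]
  have anti : ∀ k : ℝ → ℝ, Measurable (fun t : ℝ => volume {a | t < k a}) := fun k =>
    Antitone.measurable (fun s t hst => measure_mono fun x hx => lt_of_le_of_lt hst hx)
  rw [← lintegral_add_left (anti f), ← lintegral_const_mul _ (anti h)]
  apply setLIntegral_mono' measurableSet_Ioi
  intro s hs
  rcases le_or_gt 1 s with h1 | h1
  · have e1 : {a | s < f a} = ∅ := by
      ext x; simp; exact (f1 x).trans h1
    have e2 : {a | s < g a} = ∅ := by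
      ext x; simp; exact (g1 x).trans h1
    simp [e1, e2]
  · have : 2 * volume {a | s < h a} = volume ((fun x : ℝ => (1/2 : ℝ) * x) ⁻¹' {a | s < h a}) := by
      rw [Real.volume_preimage_mul_left (by norm_num)]
      norm_num
    rw [this]
    apply bm1 _ _ _ (hf measurableSet_Ioi) (hg measurableSet_Ioi) (fs s h1) (gs s h1)
    intro a ha b hb
    simp only [Set.mem_Ioi, Set.mem_preimage, Set.mem_setOf_eq] at *
    have := H a b
    have e : (1/2 : ℝ) * (a + b) = (a + b) / 2 := by ring
    rw [e]
    by_contra hc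
    push Not at hc
    have h2 : h ((a + b)/2) ^ 2 ≤ s ^ 2 := pow_le_pow_left₀ (h0 _) hc 2
    nlinarith

lemma pl_bdd (f g h : ℝ → ℝ) (hf : Measurable f) (hg : Measurable g) (hh : Measurable h)
    (f0 : ∀ x, 0 ≤ f x) (g0 : ∀ x, 0 ≤ g x) (h0 : ∀ x, 0 ≤ h x)
    (N : ℝ) (f1 : ∀ x, f x ≤ N) (g1 : ∀ x, g x ≤ N)
    (H : ∀ x y, f x * g y ≤ h ((x + y) / 2) ^ 2) :
    (∫⁻ x, ENNReal.ofReal (f x)) * ∫⁻ x, ENNReal.ofReal (g x) ≤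
      (∫⁻ x, ENNReal.ofReal (h x)) ^ 2 := by
  have bf : BddAbove (Set.range f) := ⟨N, by rintro _ ⟨x, rfl⟩; exact f1 x⟩
  have bg : BddAbove (Set.range g) := ⟨N, by rintro _ ⟨x, rfl⟩; exact g1 x⟩
  set F := ⨆ x, f x
  set G := ⨆ x, g x
  have hF : ∀ x, f x ≤ F := le_ciSup bf
  have hG : ∀ x, g x ≤ G := le_ciSup bg
  rcases (le_trans (f0 0) (hF 0)).eq_or_lt with hF0 | hF0
  · have : ∀ x, f x = 0 := fun x => le_antisymm (hF0 ▸ hF x) (f0 x)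
    simp [this]
  rcases (le_trans (g0 0) (hG 0)).eq_or_lt with hG0 | hG0
  · have : ∀ x, g x = 0 := fun x => le_antisymm (hG0 ▸ hG x) (g0 x)
    simp [this]
  set R := Real.sqrt (F * G)
  have hR : 0 < R := Real.sqrt_pos.2 (by positivity)
  have hR2 : R ^ 2 = F * G := Real.sq_sqrt (by positivity)
  have key := pl_norm (fun x => F⁻¹ * f x) (fun x => G⁻¹ * g x) (fun x => R⁻¹ * h x)
    (hf.const_mul _) (hg.const_mul _) (hh.const_mul _)
    (fun x => mul_nonneg (by positivity) (f0 x)) (fun x => mul_nonneg (by positivity) (g0 x))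
    (fun x => mul_nonneg (by positivity) (h0 x))
    (fun x => by rw [inv_mul_le_iff₀ hF0]; simpa using hF x)
    (fun x => by rw [inv_mul_le_iff₀ hG0]; simpa using hG x)
    (fun s hs => by
      obtain ⟨x, hx⟩ := exists_lt_of_lt_ciSup (f := f) (b := s * F) (by change s * F < F; nlinarith)
      refine ⟨x, ?_⟩
      rw [lt_inv_mul_iff₀ hF0]; linarith)
    (fun s hs => by
      obtain ⟨x, hx⟩ := exists_lt_of_lt_ciSup (f := g) (b := s * G) (by change s * G < G; nlinarith)
      refine ⟨x, ?_⟩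
      rw [lt_inv_mul_iff₀ hG0]; linarith)
    (fun x y => by
      have := H x y
      have e : F⁻¹ * f x * (G⁻¹ * g y) = (F * G)⁻¹ * (f x * g y) := by
        rw [mul_inv]; ring
      rw [e, mul_pow, inv_pow, hR2]
      gcongr)
  have conv : ∀ (c : ℝ) (k : ℝ → ℝ), 0 < c → Measurable k → ∫⁻ x, ENNReal.ofReal (c⁻¹ * k x) =
      ENNReal.ofReal c⁻¹ * ∫⁻ x, ENNReal.ofReal (k x) := by
    intro c k hc hk
    rw [← lintegral_const_mul _ hk.ennreal_ofReal]
    congr 1; ext x; rw [ENNReal.ofReal_mul (by positivity)]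
  rw [conv F f hF0 hf, conv G g hG0 hg, conv R h hR hh] at key
  set a := ∫⁻ x, ENNReal.ofReal (f x)
  set b := ∫⁻ x, ENNReal.ofReal (g x)
  set c := ∫⁻ x, ENNReal.ofReal (h x)
  by_cases hc : c = ∞
  · simp [hc]
  have hfin : 2 * (ENNReal.ofReal R⁻¹ * c) < ∞ := by
    exact ENNReal.mul_lt_top (by simp) (ENNReal.mul_lt_top (by simp) (lt_top_iff_ne_top.2 hc))
  have ha : a ≠ ∞ := by
    intro h
    rw [h, ENNReal.mul_top (by simpa using hF0)] at key
    simp at key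
    exact hfin.ne key
  have hb : b ≠ ∞ := by
    intro h
    rw [h, ENNReal.mul_top (by simpa using hG0)] at key
    simp at key
    exact hfin.ne key
  clear_value a b c
  lift a to NNReal using ha
  lift b to NNReal using hb
  lift c to NNReal using hc
  have key2 : F⁻¹ * (a : ℝ) + G⁻¹ * b ≤ 2 * (R⁻¹ * c) := by
    have := ENNReal.toReal_mono hfin.ne key
    rw [ENNReal.toReal_add (ENNReal.mul_ne_top (by simp) (by simp)) (ENNReal.mul_ne_top (by simp) (by simp))] at this
    simpa [ENNReal.toReal_mul, hF0.le, hG0.le, hR.le, ENNReal.toReal_ofReal] using this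
  norm_cast
  have : (a : ℝ) * b ≤ (c : ℝ) ^ 2 := by
    set x := F⁻¹ * (a : ℝ)
    set y := G⁻¹ * (b : ℝ)
    have e1 : (a : ℝ) * b = R ^ 2 * (x * y) := by
      rw [hR2]; simp only [x, y]; field_simp
    have e2 : (c : ℝ) ^ 2 = R ^ 2 * (R⁻¹ * c) ^ 2 := by
      field_simp
    rw [e1, e2]
    have hx : 0 ≤ x := by positivity
    have hy : 0 ≤ y := by positivity
    have hz : 0 ≤ R⁻¹ * (c : ℝ) := by positivity
    apply mul_le_mul_of_nonneg_left _ (by positivity)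
    nlinarith [sq_nonneg (x - y)]
  exact_mod_cast this

lemma lintegral_trunc {α : Type*} [MeasurableSpace α] (μ : Measure α) (f : α → ℝ≥0∞)
    (hf : Measurable f) : ∫⁻ x, f x ∂μ = ⨆ n : ℕ, ∫⁻ x, min (f x) n ∂μ := by
  rw [← lintegral_iSup (fun n => hf.min measurable_const)]
  · congr 1; ext x
    apply le_antisymm
    · by_cases h : f x = ∞
      · rw [h]; simp [ENNReal.iSup_natCast]
      · obtain ⟨n, hn⟩ := ENNReal.exists_nat_gt h
        exact le_iSup_of_le n (le_min le_rfl hn.le)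
    · exact iSup_le fun n => min_le_left _ _
  · intro m n hmn x
    exact min_le_min le_rfl (by exact_mod_cast hmn)

lemma pl1 (f g h : ℝ → ℝ≥0∞) (hf : Measurable f) (hg : Measurable g) (hh : Measurable h)
    (H : ∀ x y, f x * g y ≤ h ((x + y) / 2) ^ 2) :
    (∫⁻ x, f x) * ∫⁻ x, g x ≤ (∫⁻ x, h x) ^ 2 := by
  have key : ∀ n : ℕ, (∫⁻ x, min (f x) n) * ∫⁻ x, min (g x) n ≤ (∫⁻ x, min (h x) n) ^ 2 := by
    intro n
    have nt : ∀ (k : ℝ → ℝ≥0∞) x, min (k x) (n : ℝ≥0∞) ≠ ∞ := fun k x =>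
      ne_top_of_le_ne_top (by simp) (min_le_right _ _)
    have le_n : ∀ (k : ℝ → ℝ≥0∞) x, (min (k x) (n : ℝ≥0∞)).toReal ≤ n := fun k x => by
      have := ENNReal.toReal_mono (by simp) (min_le_right (k x) (n : ℝ≥0∞))
      simpa using this
    have := pl_bdd (fun x => (min (f x) n).toReal) (fun x => (min (g x) n).toReal)
      (fun x => (min (h x) n).toReal) (hf.min measurable_const).ennreal_toReal
      (hg.min measurable_const).ennreal_toReal (hh.min measurable_const).ennreal_toReal
      (fun _ => ENNReal.toReal_nonneg) (fun _ => ENNReal.toReal_nonneg)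
      (fun _ => ENNReal.toReal_nonneg) n (le_n f) (le_n g) (fun x y => by
        rw [← ENNReal.toReal_mul, ← ENNReal.toReal_pow]
        apply ENNReal.toReal_mono (ENNReal.pow_ne_top (nt h _))
        rcases le_total (h ((x+y)/2)) n with h1 | h1
        · rw [min_eq_left h1]
          exact (mul_le_mul' (min_le_left _ _) (min_le_left _ _)).trans (H x y)
        · rw [min_eq_right h1, sq]
          exact (mul_le_mul' (min_le_right _ _) (min_le_right _ _)))
    simpa only [ENNReal.ofReal_toReal (nt _ _)] using this
  have key2 : ∀ n : ℕ, (∫⁻ x, min (f x) n) * ∫⁻ x, min (g x) n ≤ (∫⁻ x, h x) ^ 2 := fun n =>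
    (key n).trans (by gcongr; exact min_le_left _ _)
  rw [lintegral_trunc _ f hf, lintegral_trunc _ g hg]
  rw [ENNReal.iSup_mul]
  refine iSup_le fun i => ?_
  rw [ENNReal.mul_iSup]
  refine iSup_le fun j => ?_
  refine le_trans ?_ (key2 (max i j))
  gcongr <;> simp

/-- Midpoint Prékopa–Leindler. -/
lemma pl (d : ℕ) : ∀ (f g h : (Fin d → ℝ) → ℝ≥0∞), Measurable f → Measurable g → Measurable h →
    (∀ x y, f x * g y ≤ h ((1/2 : ℝ) • (x + y)) ^ 2) →
    (∫⁻ x, f x) * ∫⁻ x, g x ≤ (∫⁻ x, h x) ^ 2 := by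
  induction d with
  | zero =>
    intro f g h _ _ _ H
    have tr : ∀ k : (Fin 0 → ℝ) → ℝ≥0∞, ∫⁻ x, k x = k 0 := by
      intro k
      rw [volume_pi, Measure.pi_of_empty _ 0, lintegral_dirac]
    rw [tr, tr, tr]
    have := H 0 0
    simpa using this
  | succ d ih =>
    intro f g h hf hg hh H
    have mp := (volume_preserving_piFinSuccAbove (fun _ : Fin (d+1) => ℝ) 0).symm
    have tr : ∀ k : (Fin (d+1) → ℝ) → ℝ≥0∞, Measurable k → ∫⁻ x, k x =
        ∫⁻ t : ℝ, ∫⁻ y : Fin d → ℝ, k ((MeasurableEquiv.piFinSuccAbove (fun _ => ℝ) 0).symm (t, y)) := by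
      intro k hk
      rw [← mp.lintegral_comp hk]
      exact lintegral_prod _ (hk.comp (MeasurableEquiv.measurable _)).aemeasurable
    have ms : ∀ k : (Fin (d+1) → ℝ) → ℝ≥0∞, Measurable k → Measurable (fun t : ℝ =>
        ∫⁻ y : Fin d → ℝ, k ((MeasurableEquiv.piFinSuccAbove (fun _ => ℝ) 0).symm (t, y))) := by
      intro k hk
      exact Measurable.lintegral_prod_right' (f := fun p => k ((MeasurableEquiv.piFinSuccAbove (fun _ => ℝ) 0).symm p))
        (hk.comp (MeasurableEquiv.measurable _))
    have ms2 : ∀ k : (Fin (d+1) → ℝ) → ℝ≥0∞, Measurable k → ∀ t : ℝ, Measurable (fun y : Fin d → ℝ =>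
        k ((MeasurableEquiv.piFinSuccAbove (fun _ => ℝ) 0).symm (t, y))) := by
      intro k hk t
      exact (hk.comp (MeasurableEquiv.measurable _)).comp measurable_prodMk_left
    rw [tr f hf, tr g hg, tr h hh]
    refine pl1 _ _ _ (ms f hf) (ms g hg) (ms h hh) fun s t => ?_
    refine ih _ _ _ (ms2 f hf s) (ms2 g hg t) (ms2 h hh _) fun x y => ?_
    refine (H _ _).trans (le_of_eq ?_)
    congr 2
    ext j
    refine Fin.cases ?_ (fun j => ?_) j
    · simp [MeasurableEquiv.piFinSuccAbove, Fin.insertNthEquiv]; ring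
    · simp [MeasurableEquiv.piFinSuccAbove, Fin.insertNthEquiv]; ring

lemma bm_mid {d : ℕ} (A B S : Set (Fin d → ℝ)) (hA : MeasurableSet A) (hB : MeasurableSet B)
    (hS : MeasurableSet S) (H : ∀ x ∈ A, ∀ y ∈ B, (1/2 : ℝ) • (x + y) ∈ S) :
    volume A * volume B ≤ volume S ^ 2 := by
  have := pl d (A.indicator 1) (B.indicator 1) (S.indicator 1) (measurable_one.indicator hA)
    (measurable_one.indicator hB) (measurable_one.indicator hS) (fun x y => by
      by_cases hx : x ∈ A
      · by_cases hy : y ∈ B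
        · rw [Set.indicator_of_mem (H x hx y hy)]
          simp [hx, hy]
        · simp [hy]
      · simp [hx])
  simpa [lintegral_indicator_one, hA, hB, hS] using this

end AFW

namespace AFW
set_option linter.unusedSectionVars false
set_option linter.unusedSimpArgs false
set_option linter.unusedVariables false
open MvPolynomial

section poly
variable {ι κ : Type} [Fintype ι] [Fintype κ]

/-- Directional derivative. -/
noncomputable def Dv (v : ι → ℝ) : Derivation ℝ (MvPolynomial ι ℝ) (MvPolynomial ι ℝ) :=
  mkDerivation ℝ (fun i => C (v i))

lemma Dv_X (v : ι → ℝ) (i : ι) : Dv v (X i) = C (v i) := mkDerivation_X _ _ _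

lemma Dv_C (v : ι → ℝ) (a : ℝ) : Dv v (C a) = 0 := by
  rw [← algebraMap_eq, Derivation.map_algebraMap]

lemma Dv_add (v w : ι → ℝ) (p : MvPolynomial ι ℝ) : Dv (v + w) p = Dv v p + Dv w p := by
  have : Dv (v + w) = Dv v + Dv w := by
    apply MvPolynomial.derivation_ext
    intro i
    simp [Dv_X]
  rw [this]; rfl

lemma Dv_smul (a : ℝ) (v : ι → ℝ) (p : MvPolynomial ι ℝ) : Dv (a • v) p = a • Dv v p := by
  have : Dv (a • v) = a • Dv v := by
    apply MvPolynomial.derivation_ext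
    intro i
    simp [Dv_X, smul_eq_C_mul]
  rw [this]; rfl

lemma Dv_zero (p : MvPolynomial ι ℝ) : Dv (0 : ι → ℝ) p = 0 := by
  have := Dv_smul 0 (0 : ι → ℝ) p
  simpa using this

lemma Dv_sub (v w : ι → ℝ) (p : MvPolynomial ι ℝ) : Dv (v - w) p = Dv v p - Dv w p := by
  rw [eq_sub_iff_add_eq, ← Dv_add, sub_add_cancel]

open Classical in
lemma Dv_eq_sum (v : ι → ℝ) (p : MvPolynomial ι ℝ) : Dv v p = ∑ i, v i • pderiv i p := by
  have : Dv v = ∑ i, v i • pderiv i := by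
    apply MvPolynomial.derivation_ext
    intro i
    have : (∑ j, v j • pderiv (R := ℝ) j) (X i : MvPolynomial ι ℝ) = ∑ j, v j • pderiv j (X i) := by
      simp only [← Derivation.coeFnAddMonoidHom_apply, map_sum, Finset.sum_apply]
      rfl
    rw [this, Dv_X]
    simp [pderiv_X, Pi.single_apply, smul_eq_C_mul]
  rw [this]
  simp only [← Derivation.coeFnAddMonoidHom_apply, map_sum, Finset.sum_apply]
  rfl

lemma pderiv_eq_Dv [DecidableEq ι] (i : ι) (p : MvPolynomial ι ℝ) :
    pderiv i p = Dv (Pi.single i 1) p := by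
  rw [Dv_eq_sum]
  simp [Pi.single_apply]

lemma Dv_comm (v w : ι → ℝ) (p : MvPolynomial ι ℝ) : Dv v (Dv w p) = Dv w (Dv v p) := by
  have : ⁅Dv v, Dv w⁆ = 0 := by
    apply MvPolynomial.derivation_ext
    intro i
    simp [Derivation.commutator_apply, Dv_X, Dv_C]
  have h := congrArg (fun D => D p) this
  simp only [Derivation.commutator_apply, Derivation.zero_apply] at h
  exact sub_eq_zero.1 h

lemma Dv_hom {n : ℕ} (v : ι → ℝ) {p : MvPolynomial ι ℝ} (hp : p.IsHomogeneous (n + 1)) :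
    (Dv v p).IsHomogeneous n := by
  rw [Dv_eq_sum]
  refine IsHomogeneous.sum _ _ _ fun i _ => ?_
  rw [smul_eq_C_mul]
  simpa using (isHomogeneous_C ι (v i)).mul (hp.pderiv (i := i))

/-- iterated directional derivative -/
noncomputable def DL : List (ι → ℝ) → MvPolynomial ι ℝ → MvPolynomial ι ℝ
  | [], p => p
  | v :: l, p => Dv v (DL l p)

@[simp] lemma DL_nil (p : MvPolynomial ι ℝ) : DL [] p = p := rfl
@[simp] lemma DL_cons (v : ι → ℝ) (l) (p : MvPolynomial ι ℝ) : DL (v :: l) p = Dv v (DL l p) := rfl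

lemma DL_Dv (v : ι → ℝ) (l) (p : MvPolynomial ι ℝ) : DL l (Dv v p) = Dv v (DL l p) := by
  induction l with
  | nil => rfl
  | cons w l ih => rw [DL_cons, ih, DL_cons, Dv_comm]

lemma DL_append (l l' : List (ι → ℝ)) (p : MvPolynomial ι ℝ) : DL (l ++ l') p = DL l (DL l' p) := by
  induction l with
  | nil => rfl
  | cons w l ih => simp [ih]

lemma DL_perm {l l' : List (ι → ℝ)} (h : l.Perm l') (p : MvPolynomial ι ℝ) : DL l p = DL l' p := by
  induction h with
  | nil => rfl
  | cons x _ ih => simp [ih]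
  | swap x y l => simp [Dv_comm]
  | trans _ _ ih1 ih2 => rw [ih1, ih2]

lemma DL_smul (l : List (ι → ℝ)) (a : ℝ) (p : MvPolynomial ι ℝ) : DL l (a • p) = a • DL l p := by
  induction l with
  | nil => rfl
  | cons w l ih => simp [ih]

lemma DL_sum (l : List (ι → ℝ)) {α : Type} (s : Finset α) (p : α → MvPolynomial ι ℝ) :
    DL l (∑ a ∈ s, p a) = ∑ a ∈ s, DL l (p a) := by
  induction l with
  | nil => rfl
  | cons w l ih => simp [ih]

lemma DL_zero (l : List (ι → ℝ)) : DL l (0 : MvPolynomial ι ℝ) = 0 := by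
  induction l with
  | nil => rfl
  | cons w l ih => simp [ih]

lemma DL_hom (l : List (ι → ℝ)) : ∀ {n : ℕ} {p : MvPolynomial ι ℝ}, p.IsHomogeneous (n + l.length) →
    (DL l p).IsHomogeneous n := by
  induction l with
  | nil => intro n p hp; exact hp
  | cons w l ih =>
    intro n p hp
    rw [DL_cons]
    apply Dv_hom
    apply ih
    rw [List.length_cons] at hp
    convert hp using 1
    ring

/-- The value of the full derivative -/
noncomputable def M (l : List (ι → ℝ)) (p : MvPolynomial ι ℝ) : ℝ := eval 0 (DL l p)

lemma M_perm {l l' : List (ι → ℝ)} (h : l.Perm l') (p : MvPolynomial ι ℝ) : M l p = M l' p := by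
  rw [M, M, DL_perm h]

lemma M_zero (l : List (ι → ℝ)) : M l (0 : MvPolynomial ι ℝ) = 0 := by
  rw [M, DL_zero]; simp

lemma M_cons (v : ι → ℝ) (l) (p : MvPolynomial ι ℝ) : M (v :: l) p = M l (Dv v p) := by
  rw [M, M, DL_cons, DL_Dv]

lemma M_add (v w : ι → ℝ) (l) (p : MvPolynomial ι ℝ) :
    M ((v + w) :: l) p = M (v :: l) p + M (w :: l) p := by
  simp [M, Dv_add]

lemma M_sub (v w : ι → ℝ) (l) (p : MvPolynomial ι ℝ) :
    M ((v - w) :: l) p = M (v :: l) p - M (w :: l) p := by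
  simp [M, Dv_sub]

lemma M_smul (a : ℝ) (v : ι → ℝ) (l) (p : MvPolynomial ι ℝ) :
    M ((a • v) :: l) p = a * M (v :: l) p := by
  simp [M, Dv_smul]

lemma M_swap (v w : ι → ℝ) (l) (p : MvPolynomial ι ℝ) : M (v :: w :: l) p = M (w :: v :: l) p :=
  M_perm (List.Perm.swap _ _ _) p

lemma M_smul_right (a : ℝ) (l : List (ι → ℝ)) (p : MvPolynomial ι ℝ) : M l (a • p) = a * M l p := by
  simp [M, DL_smul]

lemma M_cons_sum (v : ι → ℝ) (l) (p : MvPolynomial ι ℝ) :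
    M (v :: l) p = ∑ i, v i * M l (pderiv i p) := by
  rw [M_cons, Dv_eq_sum, M, DL_sum]
  simp [M, DL_smul, eval_sum]

lemma hom_zero_eval {p : MvPolynomial ι ℝ} (hp : p.IsHomogeneous 0) (h : ι → ℝ) :
    eval h p = eval 0 p := by
  have h1 : p.totalDegree = 0 := hp.totalDegree_le.antisymm (Nat.zero_le _) 
  rw [totalDegree_eq_zero_iff_eq_C] at h1
  rw [h1]; simp

lemma euler {n : ℕ} {p : MvPolynomial ι ℝ} (hp : p.IsHomogeneous n) (y : ι → ℝ) :
    eval y (Dv y p) = n * eval y p := by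
  have := congrArg (eval y) hp.sum_X_mul_pderiv
  simp only [map_sum, map_mul, eval_X, nsmul_eq_mul, map_natCast] at this
  rw [← this, Dv_eq_sum]
  simp [eval_sum]

lemma eval_DL_replicate (y : ι → ℝ) (k : ℕ) : ∀ {n : ℕ} {p : MvPolynomial ι ℝ},
    p.IsHomogeneous (n + k) →
    eval y (DL (List.replicate k y) p) * n.factorial = (n + k).factorial * eval y p := by
  induction k with
  | zero => intro n p hp; simp [mul_comm]
  | succ k ih =>
    intro n p hp
    rw [List.replicate_succ, DL_cons]
    have h1 : (DL (List.replicate k y) p).IsHomogeneous (n + 1) := by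
      apply DL_hom; convert hp using 1; simp; ring
    rw [euler h1]
    have := ih (n := n + 1) (p := p) (by convert hp using 1; ring)
    rw [Nat.factorial_succ] at this
    rw [show n + (k + 1) = n + 1 + k by ring, ← this]
    push_cast; ring

/-- substitution along a linear map -/
noncomputable def Rl (l : (ι → ℝ) →ₗ[ℝ] (κ → ℝ)) : MvPolynomial κ ℝ →ₐ[ℝ] MvPolynomial ι ℝ :=
  aeval (fun j => ∑ i, by classical exact C (l (Pi.single i 1) j) * X i)

lemma lin_expand (l : (ι → ℝ) →ₗ[ℝ] (κ → ℝ)) (h : ι → ℝ) (j : κ) :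
    l h j = ∑ i, by classical exact l (Pi.single i 1) j * h i := by
  classical
  conv_lhs => rw [pi_eq_sum_univ' h]
  simp [mul_comm]

lemma eval_Rl (l : (ι → ℝ) →ₗ[ℝ] (κ → ℝ)) (h : ι → ℝ) (q : MvPolynomial κ ℝ) :
    eval h (Rl l q) = eval (l h) q := by
  induction q using MvPolynomial.induction_on with
  | C a => simp [Rl]
  | add p q hp hq => simp [hp, hq]
  | mul_X p j hp =>
    rw [map_mul, map_mul, hp, map_mul]
    simp [Rl, eval_sum, lin_expand l h j]

lemma Dv_Rl (l : (ι → ℝ) →ₗ[ℝ] (κ → ℝ)) (v : ι → ℝ) (q : MvPolynomial κ ℝ) :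
    Dv v (Rl l q) = Rl l (Dv (l v) q) := by
  induction q using MvPolynomial.induction_on with
  | C a => simp [Rl, Dv_C]
  | add p q hp hq => simp [hp, hq]
  | mul_X p j hp =>
    rw [map_mul, Derivation.leibniz, hp, Derivation.leibniz, Dv_X]
    have : Dv v (Rl l (X j)) = C (l v j) := by
      simp [Rl, Dv_C, Dv_X, lin_expand l v j]
    rw [this]
    simp [Rl]

lemma DL_Rl (l : (ι → ℝ) →ₗ[ℝ] (κ → ℝ)) (c : List (ι → ℝ)) (q : MvPolynomial κ ℝ) :
    DL c (Rl l q) = Rl l (DL (c.map l) q) := by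
  induction c with
  | nil => rfl
  | cons w c ih => simp [ih, Dv_Rl]

lemma M_Rl (l : (ι → ℝ) →ₗ[ℝ] (κ → ℝ)) (c : List (ι → ℝ)) (q : MvPolynomial κ ℝ) :
    M c (Rl l q) = M (c.map l) q := by
  rw [M, M, DL_Rl, eval_Rl, map_zero]

lemma Rl_hom {n : ℕ} (l : (ι → ℝ) →ₗ[ℝ] (κ → ℝ)) {q : MvPolynomial κ ℝ} (hq : q.IsHomogeneous n) :
    (Rl l q).IsHomogeneous n := by
  classical
  have h1 : ∀ j, (∑ i, C (l (Pi.single i 1) j) * X i : MvPolynomial ι ℝ).IsHomogeneous 1 := by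
    intro j
    refine IsHomogeneous.sum _ _ _ fun i _ => ?_
    simpa using (isHomogeneous_C ι (l (Pi.single i 1) j)).mul (isHomogeneous_X ℝ i)
  have := hq.aeval _ h1
  rw [one_mul] at this
  convert this using 2
  rfl

lemma hasDerivAt_eval (h v : ι → ℝ) (p : MvPolynomial ι ℝ) (s : ℝ) :
    HasDerivAt (fun s : ℝ => eval (h + s • v) p) (eval (h + s • v) (Dv v p)) s := by
  induction p using MvPolynomial.induction_on with
  | C a => simpa [Dv_C] using hasDerivAt_const s a
  | add p q hp hq => simpa using hp.fun_add hq
  | mul_X p j hp =>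
    have h1 : HasDerivAt (fun s : ℝ => h j + s * v j) (v j) s := by
      simpa using ((hasDerivAt_id s).mul_const (v j)).const_add (h j)
    have := hp.fun_mul h1
    simp only [Derivation.leibniz, Dv_X]
    simpa [add_comm, mul_comm] using this

lemma poly_eq_of_open {S : Set (ι → ℝ)} (hS : IsOpen S) (hn : S.Nonempty) {p q : MvPolynomial ι ℝ}
    (h : ∀ x ∈ S, eval x p = eval x q) : p = q := by
  obtain ⟨x, hx⟩ := hn
  obtain ⟨ε, he, hb⟩ := Metric.isOpen_iff.1 hS x hx
  refine MvPolynomial.funext_set (fun i => ball (x i) ε) (fun i => ?_) ?_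
  · rw [Real.ball_eq_Ioo]; exact Set.Ioo_infinite (by linarith)
  · intro y hy
    apply h; apply hb
    rw [ball_pi _ he]
    exact hy

lemma continuous_evalp (p : MvPolynomial ι ℝ) : Continuous (fun h => eval h p) :=
  MvPolynomial.continuous_eval p

/-- binomial expansion -/
lemma eval_binom {n : ℕ} {p : MvPolynomial ι ℝ} (hp : p.IsHomogeneous n) (x y : ι → ℝ) (s t : ℝ) :
    n.factorial * eval (s • x + t • y) p = ∑ i ∈ Finset.range (n + 1),
      n.choose i * s ^ i * t ^ (n - i) * M (List.replicate i x ++ List.replicate (n - i) y) p := by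
  have pw : ∀ (w : ι → ℝ) k (q : MvPolynomial ι ℝ),
      ((Dv w : Module.End ℝ (MvPolynomial ι ℝ)) ^ k) q = DL (List.replicate k w) q := by
    intro w k
    induction k with
    | zero => intro q; simp
    | succ k ih => intro q; rw [pow_succ', Module.End.mul_apply, ih]; rfl
  have h1 := eval_DL_replicate (s • x + t • y) n (n := 0) (p := p) (by simpa using hp)
  simp only [Nat.factorial_zero, Nat.cast_one, mul_one, zero_add] at h1
  rw [← h1]
  have hz : (DL (List.replicate n (s • x + t • y)) p).IsHomogeneous 0 := by
    apply DL_hom; simpa using hp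
  rw [hom_zero_eval hz, ← pw]
  have e : (Dv (s • x + t • y) : Module.End ℝ (MvPolynomial ι ℝ)) =
      s • (Dv x : Module.End ℝ (MvPolynomial ι ℝ)) + t • (Dv y : Module.End ℝ (MvPolynomial ι ℝ)) := by
    apply LinearMap.ext; intro q
    simp [Dv_add, Dv_smul]
  have cm : Commute (s • (Dv x : Module.End ℝ (MvPolynomial ι ℝ)))
      (t • (Dv y : Module.End ℝ (MvPolynomial ι ℝ))) := by
    apply Commute.smul_left; apply Commute.smul_right
    apply LinearMap.ext; intro q
    simp [Dv_comm x y]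
  rw [e, cm.add_pow]
  simp only [LinearMap.sum_apply, eval_sum]
  refine Finset.sum_congr rfl fun i _ => ?_
  rw [M, DL_append, ← pw, ← pw, smul_pow, smul_pow]
  have : ((n.choose i : ℕ) : Module.End ℝ (MvPolynomial ι ℝ)) =
     ((n.choose i : ℕ) : ℝ) • (1 : Module.End ℝ (MvPolynomial ι ℝ)) := by
    rw [Nat.cast_smul_eq_nsmul, nsmul_eq_mul, mul_one]
  rw [this]
  simp [mul_assoc, mul_left_comm]

/-- second order consequence of midpoint log-concavity -/
lemma second_order (p : MvPolynomial ι ℝ) (y v : ι → ℝ)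
    (H : ∀ᶠ s in nhds (0 : ℝ), eval (y + s • v) p * eval (y + (-s) • v) p ≤ eval y p ^ 2)  :
    eval y p * eval y (Dv v (Dv v p)) ≤ eval y (Dv v p) ^ 2 := by
  by_contra hc
  push Not at hc
  set g := fun s : ℝ => eval (y + s • v) p
  set g1 := fun s : ℝ => eval (y + s • v) (Dv v p)
  set g2 := fun s : ℝ => eval (y + s • v) (Dv v (Dv v p))
  have hg : ∀ s, HasDerivAt g (g1 s) s := hasDerivAt_eval y v p
  have hg1 : ∀ s, HasDerivAt g1 (g2 s) s := hasDerivAt_eval y v _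
  have neg : ∀ (f f' : ℝ → ℝ), (∀ s, HasDerivAt f (f' s) s) → ∀ s, HasDerivAt (fun s => f (-s)) (-f' (-s)) s := by
    intro f f' hf s
    have := (hf (-s)).comp s (hasDerivAt_neg s)
    rw [mul_neg_one] at this
    exact this
  set φ := fun s => g s * g (-s)
  have d1 : deriv φ = fun s => g1 s * g (-s) + g s * (-g1 (-s)) := by
    ext s
    exact ((hg s).mul (neg g g1 hg s)).deriv
  have d2 : deriv (deriv φ) 0 = 2 * (g 0 * g2 0 - g1 0 ^ 2) := by
    rw [d1]
    have := ((hg1 0).mul (neg g g1 hg 0)).add ((hg 0).mul ((neg g1 g2 hg1 0).neg))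
    refine (this.deriv).trans ?_
    simp; ring
  have e0 : g 0 = eval y p ∧ g1 0 = eval y (Dv v p) ∧ g2 0 = eval y (Dv v (Dv v p)) := by
    simp [g, g1, g2]
  have pos : 0 < deriv (deriv φ) 0 := by
    rw [d2, e0.1, e0.2.1, e0.2.2]; linarith
  have lmin : IsLocalMin φ 0 := isLocalMin_of_deriv_deriv_pos pos (by rw [d1]; simp; ring)
    (((hg 0).mul (neg g g1 hg 0)).continuousAt)
  have hconst : φ =ᶠ[nhds 0] fun _ => φ 0 := by
    filter_upwards [H, lmin] with s hs1 hs2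
    apply le_antisymm _ hs2
    have : φ 0 = eval y p ^ 2 := by simp [φ, g, sq]
    rw [this]; exact hs1
  have := (hconst.deriv).deriv.eq_of_nhds
  rw [this] at pos
  simp at pos

end poly
end AFW

namespace AFW
set_option linter.unusedSectionVars false
set_option linter.unusedSimpArgs false
set_option linter.unusedVariables false

lemma sum_ext_zero {ι E : Type} [Fintype ι] [AddCommMonoid E] (p : ι → Prop) [DecidablePred p]
    (f : {j // p j} → E) : ∑ j, (if h : p j then f ⟨j, h⟩ else 0) = ∑ j, f j := by
  rw [← Fintype.sum_subtype_add_sum_subtype p]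
  have h2 : ∑ i : {x // ¬ p x}, (if h : p i then f ⟨i, h⟩ else 0) = 0 :=
    Finset.sum_eq_zero fun i _ => by simp [i.2]
  rw [h2, add_zero]
  exact Finset.sum_congr rfl fun i _ => by simp [i.2]

section sys
variable {ι : Type} [Fintype ι] {d : ℕ}

/-- The polyhedron of a system of inequalities. -/
def Pol (u : ι → ((Fin d → ℝ) →ₗ[ℝ] ℝ)) (h : ι → ℝ) : Set (Fin d → ℝ) := {x | ∀ i, u i x ≤ h i}

/-- The system has bounded solution sets. -/
def Bs (u : ι → ((Fin d → ℝ) →ₗ[ℝ] ℝ)) : Prop := ∀ x, (∀ i, u i x ≤ 0) → x = 0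

/-- Simplicity (nondegeneracy). -/
def Nd (u : ι → ((Fin d → ℝ) →ₗ[ℝ] ℝ)) (h : ι → ℝ) : Prop :=
  ∀ x ∈ Pol u h, ∀ g : ι → ℝ, (∀ j, g j ≠ 0 → u j x = h j) → ∑ j, g j • u j = 0 → g = 0

/-- strict feasibility -/
def SF (u : ι → ((Fin d → ℝ) →ₗ[ℝ] ℝ)) (h : ι → ℝ) : Prop := ∃ x, ∀ i, u i x < h i

lemma lin_cont (f : (Fin d → ℝ) →ₗ[ℝ] ℝ) : Continuous f := f.continuous_of_finiteDimensional

lemma isClosed_Pol (u : ι → ((Fin d → ℝ) →ₗ[ℝ] ℝ)) (h : ι → ℝ) : IsClosed (Pol u h) := by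
  have : Pol u h = ⋂ i, {x | u i x ≤ h i} := by ext x; simp [Pol]
  rw [this]
  exact isClosed_iInter fun i => isClosed_le (lin_cont _) continuous_const

lemma Bs.bound {u : ι → ((Fin d → ℝ) →ₗ[ℝ] ℝ)} (hu : Bs u) :
    ∃ B : ℝ, 0 ≤ B ∧ ∀ (R : ℝ), 0 ≤ R → ∀ h : ι → ℝ, (∀ i, h i ≤ R) → ∀ x ∈ Pol u h, ‖x‖ ≤ B * R := by
  have hc : Continuous (fun x : Fin d → ℝ => ∑ i, max (u i x) 0) :=
    continuous_finsetSum _ fun i _ => (lin_cont (u i)).max continuous_const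
  obtain ⟨m, hm, hmin⟩ : ∃ m : ℝ, 0 < m ∧ ∀ x : Fin d → ℝ, ‖x‖ = 1 → m ≤ ∑ i, max (u i x) 0 := by
    rcases (sphere (0 : Fin d → ℝ) 1).eq_empty_or_nonempty with he | hne
    · refine ⟨1, one_pos, fun x hx => ?_⟩
      have : x ∈ sphere (0 : Fin d → ℝ) 1 := by simpa using hx
      rw [he] at this; exact this.elim
    · obtain ⟨x0, hx0, hmin⟩ := (isCompact_sphere (0 : Fin d → ℝ) 1).exists_isMinOn hne hc.continuousOn
      refine ⟨_, ?_, fun x hx => hmin (by simpa using hx)⟩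
      by_contra hcon
      push Not at hcon
      have hz : ∑ i, max (u i x0) 0 = 0 :=
        le_antisymm hcon (Finset.sum_nonneg fun i _ => le_max_right _ _)
      rw [Finset.sum_eq_zero_iff_of_nonneg (fun i _ => le_max_right _ _)] at hz
      have := hu x0 fun i => max_eq_right_iff.1 (hz i (Finset.mem_univ _))
      rw [this] at hx0; simp at hx0
  refine ⟨Fintype.card ι / m, by positivity, fun R hR h hh x hx => ?_⟩
  by_cases hx0 : x = 0
  · rw [hx0, norm_zero]; positivity
  have hn : 0 < ‖x‖ := norm_pos_iff.2 hx0
  have h1 := hmin (‖x‖⁻¹ • x) (by rw [norm_smul]; simp [hn.ne'])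
  have h2 : ∑ i, max (u i (‖x‖⁻¹ • x)) 0 ≤ ∑ i : ι, ‖x‖⁻¹ * R := by
    apply Finset.sum_le_sum
    intro i _
    rw [map_smul, smul_eq_mul]
    apply max_le _ (by positivity)
    gcongr
    exact (hx i).trans (hh i)
  rw [Finset.sum_const, Finset.card_univ, nsmul_eq_mul] at h2
  have h3 := h1.trans h2
  rw [div_mul_eq_mul_div, le_div_iff₀ hm]
  have h4 : ‖x‖ * m ≤ ‖x‖ * (Fintype.card ι * (‖x‖⁻¹ * R)) := by gcongr
  calc ‖x‖ * m ≤ ‖x‖ * (Fintype.card ι * (‖x‖⁻¹ * R)) := h4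
    _ = _ := by field_simp

lemma Bs.isCompact {u : ι → ((Fin d → ℝ) →ₗ[ℝ] ℝ)} (hu : Bs u) (h : ι → ℝ) : IsCompact (Pol u h) := by
  obtain ⟨B, hB, H⟩ := hu.bound
  refine (isCompact_closedBall (0 : Fin d → ℝ) (B * ‖h‖)).of_isClosed_subset (isClosed_Pol u h) ?_
  intro x hx
  rw [mem_closedBall_zero_iff]
  exact H ‖h‖ (norm_nonneg _) h (fun i => (le_abs_self _).trans (norm_le_pi_norm h i)) x hx

lemma Bs.fin {u : ι → ((Fin d → ℝ) →ₗ[ℝ] ℝ)} (hu : Bs u) (h : ι → ℝ) : volume (Pol u h) ≠ ⊤ :=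
  (hu.isCompact h).measure_lt_top.ne

/-- right-hand sides such that the face with index set `J` is nonempty -/
def Fa (u : ι → ((Fin d → ℝ) →ₗ[ℝ] ℝ)) (J : Set ι) : Set (ι → ℝ) :=
  {h | ∃ x ∈ Pol u h, ∀ j ∈ J, u j x = h j}

lemma isClosed_Fa {u : ι → ((Fin d → ℝ) →ₗ[ℝ] ℝ)} (hu : Bs u) (J : Set ι) : IsClosed (Fa u J) := by
  rw [← isSeqClosed_iff_isClosed]
  intro hs h hmem hlim
  choose x hx hxJ using hmem
  obtain ⟨B, hB, H⟩ := hu.bound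
  obtain ⟨R, hR⟩ := hlim.norm.bddAbove_range
  have hR0 : 0 ≤ R := (norm_nonneg _).trans (hR ⟨0, rfl⟩)
  have hb : ∀ n, x n ∈ closedBall (0 : Fin d → ℝ) (B * R) := by
    intro n
    rw [mem_closedBall_zero_iff]
    exact H R hR0 (hs n) (fun i => ((le_abs_self _).trans (norm_le_pi_norm (hs n) i)).trans (hR ⟨n, rfl⟩)) _ (hx n)
  obtain ⟨a, -, φ, hφ, ha⟩ := (isCompact_closedBall (0 : Fin d → ℝ) (B * R)).tendsto_subseq hb
  have hl : ∀ i, Filter.Tendsto (fun n => hs (φ n) i) Filter.atTop (nhds (h i)) := fun i =>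
    (tendsto_pi_nhds.1 hlim i).comp hφ.tendsto_atTop
  have hxl : ∀ i, Filter.Tendsto (fun n => u i (x (φ n))) Filter.atTop (nhds (u i a)) := fun i =>
    ((lin_cont (u i)).tendsto a).comp ha
  refine ⟨a, fun i => le_of_tendsto_of_tendsto' (hxl i) (hl i) fun n => hx (φ n) i, fun j hj => ?_⟩
  refine tendsto_nhds_unique (hxl j) ?_
  simpa only [hxJ _ j hj] using hl j

/-- dependence -/
def Dep (u : ι → ((Fin d → ℝ) →ₗ[ℝ] ℝ)) (J : Set ι) : Prop :=
  ∃ g : ι → ℝ, g ≠ 0 ∧ (∀ j, g j ≠ 0 → j ∈ J) ∧ ∑ j, g j • u j = 0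

lemma Nd_iff (u : ι → ((Fin d → ℝ) →ₗ[ℝ] ℝ)) (h : ι → ℝ) :
    Nd u h ↔ ∀ J : Set ι, Dep u J → h ∉ Fa u J := by
  constructor
  · rintro hN J ⟨g, g0, gJ, gs⟩ ⟨x, hx, hxJ⟩
    exact g0 (hN x hx g (fun j hj => hxJ j (gJ j hj)) gs)
  · intro H x hx g hg hs
    by_contra g0
    exact H {j | g j ≠ 0} ⟨g, g0, fun j hj => hj, hs⟩ ⟨x, hx, fun j hj => hg j hj⟩

lemma isOpen_Nd {u : ι → ((Fin d → ℝ) →ₗ[ℝ] ℝ)} (hu : Bs u) : IsOpen {h | Nd u h} := by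
  have : {h | Nd u h} = ⋂ J : Set ι, {h | Dep u J → h ∉ Fa u J} := by
    ext h
    rw [Set.mem_iInter]
    exact Nd_iff u h
  rw [this]
  refine isOpen_iInter_of_finite fun J => ?_
  by_cases hJ : Dep u J
  · simp only [hJ, true_imp_iff]
    exact (isClosed_Fa hu J).isOpen_compl
  · simp [hJ]

lemma Nd.sf {u : ι → ((Fin d → ℝ) →ₗ[ℝ] ℝ)} {h : ι → ℝ} (hN : Nd u h) (hne : (Pol u h).Nonempty) :
    SF u h := by
  classical
  obtain ⟨x, hx⟩ := hne
  have hli : LinearIndependent ℝ (fun j : {j // u j x = h j} => u j) := by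
    rw [Fintype.linearIndependent_iff]
    intro g hg
    have := hN x hx (fun j => if hj : u j x = h j then g ⟨j, hj⟩ else 0)
      (fun j hj => by by_contra hc; simp [hc] at hj) (by
        rw [← hg, ← sum_ext_zero (fun j => u j x = h j) (fun j => g j • u j)]
        apply Finset.sum_congr rfl
        intro j _
        by_cases hj : u j x = h j <;> simp [hj])
    intro j
    have h2 := congrFun this j.1
    simpa [j.2] using h2
  obtain ⟨φ, hφ⟩ := LinearMap.exists_extend
    ((Finsupp.linearCombination ℝ (fun _ : {j // u j x = h j} => (-1 : ℝ))) ∘ₗ hli.repr)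
  have hφ1 : ∀ j : {j // u j x = h j}, φ (u j) = -1 := by
    intro j
    have := LinearMap.congr_fun hφ ⟨u j, Submodule.subset_span ⟨j, rfl⟩⟩
    simp only [LinearMap.comp_apply, Submodule.subtype_apply, LinearEquiv.coe_coe] at this
    rw [this, hli.repr_eq_single j _ rfl]
    simp
  obtain ⟨v, hv⟩ : ∃ v : Fin d → ℝ, ∀ f : Module.Dual ℝ (Fin d → ℝ), φ f = f v := by
    refine ⟨(Module.evalEquiv ℝ (Fin d → ℝ)).symm φ, fun f => ?_⟩
    simp
  have key : ∀ i, ∀ᶠ t in nhdsWithin (0 : ℝ) (Set.Ioi 0), u i (x + t • v) < h i := by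
    intro i
    by_cases hi : u i x = h i
    · filter_upwards [self_mem_nhdsWithin] with t ht
      have : u i v = -1 := by rw [← hv]; exact hφ1 ⟨i, hi⟩
      rw [map_add, map_smul, this, hi]
      simp only [Set.mem_Ioi] at ht
      simp [ht]
    · have hlt : u i x < h i := lt_of_le_of_ne (hx i) hi
      have hc : Continuous fun t : ℝ => u i (x + t • v) := (lin_cont _).comp (by fun_prop)
      have : ∀ᶠ t in nhds (0 : ℝ), u i (x + t • v) < h i :=
        hc.continuousAt.eventually_lt continuousAt_const (by simpa using hlt)
      exact this.filter_mono nhdsWithin_le_nhds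
  obtain ⟨t, ht⟩ := (Filter.eventually_all.2 key).exists
  exact ⟨_, ht⟩

lemma SF.ne {u : ι → ((Fin d → ℝ) →ₗ[ℝ] ℝ)} {h : ι → ℝ} (hs : SF u h) : (Pol u h).Nonempty := by
  obtain ⟨x, hx⟩ := hs
  exact ⟨x, fun i => (hx i).le⟩

lemma isOpen_SF (u : ι → ((Fin d → ℝ) →ₗ[ℝ] ℝ)) : IsOpen {h | SF u h} := by
  have : {h | SF u h} = ⋃ x, ⋂ i, {h : ι → ℝ | u i x < h i} := by
    ext h; simp [SF]
  rw [this]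
  refine isOpen_iUnion fun x => isOpen_iInter_of_finite fun i => ?_
  exact isOpen_lt continuous_const (continuous_apply i)

lemma SF.vol_pos {u : ι → ((Fin d → ℝ) →ₗ[ℝ] ℝ)} (hu : Bs u) {h : ι → ℝ} (hs : SF u h) :
    0 < (volume (Pol u h)).toReal := by
  apply ENNReal.toReal_pos _ (hu.fin h)
  obtain ⟨x, hx⟩ := hs
  have ho : IsOpen {x : Fin d → ℝ | ∀ i, u i x < h i} := by
    have : {x : Fin d → ℝ | ∀ i, u i x < h i} = ⋂ i, {x | u i x < h i} := by ext; simp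
    rw [this]
    exact isOpen_iInter_of_finite fun i => isOpen_lt (lin_cont _) continuous_const
  have := ho.measure_pos volume ⟨x, hx⟩
  exact (this.trans_le (measure_mono fun y hy i => (hy i).le)).ne'

structure Ch (u : ι → ((Fin d → ℝ) →ₗ[ℝ] ℝ)) (C : Set (ι → ℝ)) : Prop where
  bs : Bs u
  op : IsOpen C
  cv : Convex ℝ C
  ne : C.Nonempty
  nd : ∀ h ∈ C, Nd u h

lemma Ch.dich {u : ι → ((Fin d → ℝ) →ₗ[ℝ] ℝ)} {C : Set (ι → ℝ)} (hC : Ch u C) :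
    (∀ h ∈ C, Pol u h = ∅) ∨ (∀ h ∈ C, SF u h) := by
  have hU := isOpen_SF u
  have hV : IsOpen {h | Pol u h = ∅} := by
    have : {h | Pol u h = ∅} = (Fa u ∅)ᶜ := by
      ext h
      simp [Fa, Set.eq_empty_iff_forall_notMem]
    rw [this]; exact (isClosed_Fa hC.bs _).isOpen_compl
  have hdis : Disjoint {h | Pol u h = ∅} {h | SF u h} := by
    rw [Set.disjoint_left]
    intro h h1 h2
    have := h2.ne
    rw [show Pol u h = ∅ from h1] at this
    exact Set.not_nonempty_empty this
  have hcov : C ⊆ {h | Pol u h = ∅} ∪ {h | SF u h} := by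
    intro h hh
    rcases (Pol u h).eq_empty_or_nonempty with h1 | h1
    · exact Or.inl h1
    · exact Or.inr ((hC.nd h hh).sf h1)
  have := hC.cv.isPreconnected.subset_or_subset hV hU hdis hcov
  exact this

end sys
end AFW

namespace AFW
set_option linter.unusedSectionVars false
set_option linter.unusedSimpArgs false
set_option linter.unusedVariables false

section contr
open scoped Classical
variable {ι : Type} [Fintype ι] {d : ℕ}

lemma exists_Phi (u : (Fin (d+1) → ℝ) →ₗ[ℝ] ℝ) (hu : u ≠ 0) :
    ∃ Φ : (ℝ × (Fin d → ℝ)) ≃ₗ[ℝ] (Fin (d+1) → ℝ), ∀ t y, u (Φ (t, y)) = t := by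
  obtain ⟨e0, he0⟩ : ∃ e0, u e0 ≠ 0 := by
    by_contra hc
    push Not at hc
    exact hu (LinearMap.ext hc)
  have he : u ((u e0)⁻¹ • e0) = 1 := by simp [he0]
  set e := (u e0)⁻¹ • e0
  have hfr : Module.finrank ℝ (Fin d → ℝ) = Module.finrank ℝ (LinearMap.ker u) := by
    have := Module.Dual.finrank_ker_add_one_of_ne_zero (f := u) hu
    simp at this ⊢
    omega
  let k : (Fin d → ℝ) ≃ₗ[ℝ] LinearMap.ker u := LinearEquiv.ofFinrankEq _ _ hfr
  let f : (ℝ × (Fin d → ℝ)) →ₗ[ℝ] (Fin (d+1) → ℝ) :=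
    LinearMap.coprod (LinearMap.toSpanSingleton ℝ _ e) ((LinearMap.ker u).subtype ∘ₗ k.toLinearMap)
  have hf : ∀ t y, f (t, y) = t • e + (k y : Fin (d+1) → ℝ) := by
    intro t y; simp [f]
  have hfu : ∀ t y, u (f (t, y)) = t := by
    intro t y
    rw [hf, map_add, map_smul, he, (k y).2]; simp
  have inj : Function.Injective f := by
    rw [← LinearMap.ker_eq_bot, LinearMap.ker_eq_bot']
    rintro ⟨t, y⟩ hty
    have h1 := hfu t y
    rw [hty, map_zero] at h1
    subst h1
    have h2 := hf 0 y
    rw [hty, zero_smul, zero_add] at h2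
    have : k y = 0 := Subtype.ext h2.symm
    rw [LinearEquiv.map_eq_zero_iff] at this
    rw [this]; rfl
  refine ⟨LinearEquiv.ofInjectiveOfFinrankEq f inj (by simp [add_comm]), fun t y => ?_⟩
  exact hfu t y

/-- A chart adapted to the functional `u`. -/
noncomputable def Phi (u : (Fin (d+1) → ℝ) →ₗ[ℝ] ℝ) (hu : u ≠ 0) :
    (ℝ × (Fin d → ℝ)) ≃ₗ[ℝ] (Fin (d+1) → ℝ) := (exists_Phi u hu).choose

lemma Phi_spec (u : (Fin (d+1) → ℝ) →ₗ[ℝ] ℝ) (hu : u ≠ 0) (t y) : u (Phi u hu (t, y)) = t :=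
  (exists_Phi u hu).choose_spec t y

lemma exists_kap (Φ : (ℝ × (Fin d → ℝ)) ≃ₗ[ℝ] (Fin (d+1) → ℝ)) :
    ∃ κ : NNReal, 0 < κ ∧ ∀ S : Set (Fin (d+1) → ℝ), MeasurableSet S → volume S = κ * volume (Φ ⁻¹' S) := by
  let Ψ := Φ.toContinuousLinearEquiv
  have i1 : (volume : Measure (ℝ × (Fin d → ℝ))).IsAddHaarMeasure :=
    Measure.prod.instIsAddHaarMeasure (volume : Measure ℝ) (volume : Measure (Fin d → ℝ))
  have i2 : (Measure.map Ψ (volume : Measure (ℝ × (Fin d → ℝ)))).IsAddHaarMeasure :=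
    ContinuousLinearEquiv.isAddHaarMeasure_map Ψ volume
  have h := Measure.isAddLeftInvariant_eq_smul (volume : Measure (Fin (d+1) → ℝ))
    (Measure.map Ψ (volume : Measure (ℝ × (Fin d → ℝ))))
  refine ⟨_, Measure.addHaarScalarFactor_pos_of_isAddHaarMeasure (volume : Measure (Fin (d+1) → ℝ))
    (Measure.map Ψ (volume : Measure (ℝ × (Fin d → ℝ)))), fun S hS => ?_⟩
  conv_lhs => rw [h]
  rw [Measure.smul_apply, Measure.map_apply (Ψ.continuous.measurable) hS]
  rfl

noncomputable def kap (u : (Fin (d+1) → ℝ) →ₗ[ℝ] ℝ) (hu : u ≠ 0) : NNReal :=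
  (exists_kap (Phi u hu)).choose

lemma kap_pos (u : (Fin (d+1) → ℝ) →ₗ[ℝ] ℝ) (hu : u ≠ 0) : 0 < kap u hu :=
  (exists_kap (Phi u hu)).choose_spec.1

lemma kap_spec (u : (Fin (d+1) → ℝ) →ₗ[ℝ] ℝ) (hu : u ≠ 0) (S : Set (Fin (d+1) → ℝ)) (hS : MeasurableSet S) :
    volume S = kap u hu * volume (Phi u hu ⁻¹' S) :=
  (exists_kap (Phi u hu)).choose_spec.2 S hS

/-- contracted system -/
noncomputable def cu (u : ι → ((Fin (d+1) → ℝ) →ₗ[ℝ] ℝ)) (i : ι) (hi : u i ≠ 0) :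
    {j // j ≠ i} → ((Fin d → ℝ) →ₗ[ℝ] ℝ) :=
  fun j => u j ∘ₗ (Phi (u i) hi).toLinearMap ∘ₗ LinearMap.inr ℝ ℝ (Fin d → ℝ)

/-- contracted right-hand side -/
noncomputable def cl (u : ι → ((Fin (d+1) → ℝ) →ₗ[ℝ] ℝ)) (i : ι) (hi : u i ≠ 0) :
    (ι → ℝ) →ₗ[ℝ] ({j // j ≠ i} → ℝ) :=
  LinearMap.pi fun j => LinearMap.proj j.1 - (u j (Phi (u i) hi (1, 0))) • LinearMap.proj i

variable (u : ι → ((Fin (d+1) → ℝ) →ₗ[ℝ] ℝ)) (i : ι) (hi : u i ≠ 0)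

lemma cl_apply (h : ι → ℝ) (j) : cl u i hi h j = h j - u j (Phi (u i) hi (1, 0)) * h i := by
  simp [cl]

lemma u_Phi (t : ℝ) (y : Fin d → ℝ) (j : ι) : u j (Phi (u i) hi (t, y)) =
    u j (Phi (u i) hi (1, 0)) * t + u j (Phi (u i) hi (0, y)) := by
  have : (t, y) = t • ((1 : ℝ), (0 : Fin d → ℝ)) + (0, y) := by simp
  rw [this, map_add, map_add, map_smul, map_smul, smul_eq_mul, mul_comm]

lemma cu_apply (y : Fin d → ℝ) (j) : cu u i hi j y = u j (Phi (u i) hi (0, y)) := rfl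

lemma mem_contr (h : ι → ℝ) (y : Fin d → ℝ) :
    y ∈ Pol (cu u i hi) (cl u i hi h) ↔ Phi (u i) hi (h i, y) ∈ Pol u h := by
  constructor
  · intro H j
    by_cases hj : j = i
    · subst hj; rw [Phi_spec]
    · have := H ⟨j, hj⟩
      rw [cu_apply, cl_apply] at this
      rw [u_Phi]; simp only at this; linarith
  · intro H j
    have := H j
    rw [u_Phi] at this
    rw [cu_apply, cl_apply]; linarith

lemma Bs.contr {u : ι → ((Fin (d+1) → ℝ) →ₗ[ℝ] ℝ)} (hu : Bs u) (i : ι) (hi : u i ≠ 0) :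
    Bs (cu u i hi) := by
  intro y hy
  have := hu (Phi (u i) hi (0, y)) (fun j => by
    by_cases hj : j = i
    · subst hj; rw [Phi_spec]
    · exact hy ⟨j, hj⟩)
  rw [LinearEquiv.map_eq_zero_iff] at this
  simpa using this

lemma Nd.contr {u : ι → ((Fin (d+1) → ℝ) →ₗ[ℝ] ℝ)} {h : ι → ℝ} (hN : Nd u h) (i : ι) (hi : u i ≠ 0) :
    Nd (cu u i hi) (cl u i hi h) := by
  intro y hy g hg hs
  have hx := (mem_contr u i hi h y).1 hy
  set c := ∑ j : {j // j ≠ i}, g j * u j (Phi (u i) hi (1, 0))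
  set G : ι → ℝ := fun j => if hj : j ≠ i then g ⟨j, hj⟩ else -c
  have hsum : ∀ x, (∑ j, G j • u j) x = (∑ j : {j // j ≠ i}, g j * u j x) - c * u i x := by
    intro x
    rw [← Fintype.sum_subtype_add_sum_subtype (fun j => j ≠ i)]
    rw [LinearMap.add_apply, sub_eq_add_neg]
    congr 1
    · rw [LinearMap.sum_apply]
      refine Finset.sum_congr rfl fun j _ => ?_
      simp [G, j.2]
    · have hun : ∀ j : {x // ¬ (x ≠ i)}, j = ⟨i, by simp⟩ := by
        rintro ⟨j, hj⟩; simp at hj; simp [hj]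
      let i3 : Unique {x // ¬ (x ≠ i)} := ⟨⟨⟨i, by simp⟩⟩, hun⟩
      rw [Fintype.sum_unique]
      have e : ((default : {x // ¬ (x ≠ i)}) : ι) = i := by rw [hun default]
      rw [e]
      simp [G]
  have hG : G = 0 := by
    apply hN _ hx
    · intro j hj
      by_cases hji : j = i
      · subst hji; rw [Phi_spec]
      · have h1 : g ⟨j, hji⟩ ≠ 0 := by simpa [G, hji] using hj
        have h2 := hg _ h1
        rw [cu_apply, cl_apply] at h2
        simp only at h2
        rw [u_Phi]; linarith
    · apply LinearMap.ext
      intro x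
      obtain ⟨⟨t, z⟩, rfl⟩ := (Phi (u i) hi).surjective x
      rw [hsum, Phi_spec]
      have h1 : ∑ j : {j // j ≠ i}, g j * u j (Phi (u i) hi (0, z)) = 0 := by
        have := LinearMap.congr_fun hs z
        simpa [cu_apply] using this
      have h2 : ∑ j : {j // j ≠ i}, g j * u j (Phi (u i) hi (t, z)) = c * t := by
        have : ∀ j : {j // j ≠ i}, g j * u j (Phi (u i) hi (t, z)) =
            g j * u j (Phi (u i) hi (1, 0)) * t + g j * u j (Phi (u i) hi (0, z)) := by
          intro j; rw [u_Phi]; ring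
        simp only [this]
        rw [Finset.sum_add_distrib, h1, ← Finset.sum_mul, add_zero]
      rw [h2]; simp
  ext j
  have := congrFun hG j.1
  simpa [G, j.2] using this

lemma cl_surj : Function.Surjective (cl u i hi) := by
  intro k
  refine ⟨fun j => if hj : j ≠ i then k ⟨j, hj⟩ else 0, ?_⟩
  ext j
  rw [cl_apply]
  simp [j.2]

lemma Ch.contr {u : ι → ((Fin (d+1) → ℝ) →ₗ[ℝ] ℝ)} {C : Set (ι → ℝ)} (hC : Ch u C) (i : ι) (hi : u i ≠ 0) :
    Ch (cu u i hi) (cl u i hi '' C) where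
  bs := hC.bs.contr i hi
  op := (LinearMap.isOpenMap_of_finiteDimensional _ (cl_surj u i hi)) _ hC.op
  cv := hC.cv.linear_image _
  ne := hC.ne.image _
  nd := by
    rintro _ ⟨h, hh, rfl⟩
    exact (hC.nd h hh).contr i hi

lemma slice (h : ι → ℝ) : volume (Pol u h) = kap (u i) hi *
    ∫⁻ t in Set.Iic (h i), volume (Pol (cu u i hi) (cl u i hi (Function.update h i t))) := by
  rw [kap_spec (u i) hi _ (isClosed_Pol u h).measurableSet]
  congr 1
  have hm : MeasurableSet (Phi (u i) hi ⁻¹' Pol u h) :=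
    ((isClosed_Pol u h).preimage (Phi (u i) hi).toLinearMap.continuous_of_finiteDimensional).measurableSet
  change (Measure.prod volume volume) _ = _
  rw [Measure.prod_apply hm, ← lintegral_indicator measurableSet_Iic]
  congr 1; ext t
  by_cases ht : t ≤ h i
  · rw [Set.indicator_of_mem (by exact ht)]
    congr 1
    ext y
    rw [mem_contr, Function.update_self]
    simp only [Set.mem_preimage]
    constructor
    · intro H j
      by_cases hj : j = i
      · subst hj; rw [Phi_spec]; simp
      · rw [Function.update_of_ne hj]; exact H j
    · intro H j
      by_cases hj : j = i
      · subst hj; rw [Phi_spec]; exact ht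
      · have := H j; rw [Function.update_of_ne hj] at this; exact this
  · rw [Set.indicator_of_notMem (by exact ht)]
    rw [← measure_empty (μ := (volume : Measure (Fin d → ℝ)))]
    congr 1
    ext y
    simp only [Set.mem_preimage, Set.mem_empty_iff_false, iff_false]
    intro H
    have := H i
    rw [Phi_spec] at this
    exact ht this

end contr
end AFW

namespace AFW
set_option linter.unusedSectionVars false
set_option linter.unusedSimpArgs false
set_option linter.unusedVariables false

section vp
open scoped Classical
open MvPolynomial
variable {ι : Type} [Fintype ι] {d : ℕ}

/-- real volume -/
noncomputable def vol (u : ι → ((Fin d → ℝ) →ₗ[ℝ] ℝ)) (h : ι → ℝ) : ℝ := (volume (Pol u h)).toReal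

lemma update_mem_near {C : Set (ι → ℝ)} (hC : IsOpen C) {h : ι → ℝ} (hh : h ∈ C) (i : ι) :
    ∃ ε > 0, ∀ T, |T - h i| < ε → Function.update h i T ∈ C := by
  have hc : Continuous fun T : ℝ => Function.update h i T := continuous_const.update i continuous_id
  have := (hC.preimage hc)
  obtain ⟨ε, he, hb⟩ := Metric.isOpen_iff.1 this (h i) (by simpa using hh)
  exact ⟨ε, he, fun T hT => hb (by simpa [Real.dist_eq] using hT)⟩

lemma vol_partial {u : ι → ((Fin (d+1) → ℝ) →ₗ[ℝ] ℝ)} {C : Set (ι → ℝ)} (hC : Ch u C) (i : ι)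
    (hi : u i ≠ 0) {p : MvPolynomial {j // j ≠ i} ℝ}
    (hp : ∀ k ∈ cl u i hi '' C, vol (cu u i hi) k = eval k p) {h : ι → ℝ} (hh : h ∈ C) :
    HasDerivAt (fun T => vol u (Function.update h i T)) (kap (u i) hi * eval (cl u i hi h) p) (h i) := by
  obtain ⟨ε, he, hb⟩ := update_mem_near hC.op hh i
  set G : ℝ → ENNReal := fun t => volume (Pol (cu u i hi) (cl u i hi (Function.update h i t)))
  set q : ℝ → ℝ := fun t => eval (cl u i hi (Function.update h i t)) p
  have hq : Continuous q := (continuous_evalp p).comp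
    ((cl u i hi).continuous_of_finiteDimensional.comp (continuous_const.update i continuous_id))
  set T0 := h i - ε / 2 with hT0
  have hs : ∀ T, volume (Pol u (Function.update h i T)) = kap (u i) hi * ∫⁻ t in Set.Iic T, G t := by
    intro T
    rw [slice u i hi]
    simp only [Function.update_self, Function.update_idem]
    rfl
  have key : ∀ T, T0 ≤ T → T < h i + ε → vol u (Function.update h i T) =
      vol u (Function.update h i T0) + kap (u i) hi * ∫ t in T0..T, q t := by
    intro T h1 h2
    have hGq : ∀ t ∈ Set.Ioc T0 T, G t = ENNReal.ofReal (q t) := by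
      intro t ht
      have := hp _ ⟨_, hb t (by rw [abs_lt]; constructor <;> [linarith [ht.1, hT0]; linarith [ht.2, hT0]]), rfl⟩
      simp only [q]
      rw [← this, vol, ENNReal.ofReal_toReal ((hC.bs.contr i hi).fin _)]
    have hq0 : ∀ t ∈ Set.Ioc T0 T, 0 ≤ q t := by
      intro t ht
      have := hp _ ⟨_, hb t (by rw [abs_lt]; constructor <;> [linarith [ht.1, hT0]; linarith [ht.2, hT0]]), rfl⟩
      simp only [q]
      rw [← this]; exact ENNReal.toReal_nonneg
    have e1 : ∫⁻ t in Set.Iic T, G t = (∫⁻ t in Set.Iic T0, G t) + ∫⁻ t in Set.Ioc T0 T, G t := by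
      rw [← Set.Iic_union_Ioc_eq_Iic h1, lintegral_union measurableSet_Ioc]
      exact Set.Iic_disjoint_Ioc le_rfl
    have e2 : ∫⁻ t in Set.Ioc T0 T, G t = ENNReal.ofReal (∫ t in T0..T, q t) := by
      rw [setLIntegral_congr_fun measurableSet_Ioc hGq, intervalIntegral.integral_of_le h1,
        ofReal_integral_eq_lintegral_ofReal]
      · exact (hq.integrableOn_Icc).mono_set Set.Ioc_subset_Icc_self
      · exact (ae_restrict_iff' measurableSet_Ioc).2 (Filter.Eventually.of_forall hq0)
    have e3 : 0 ≤ ∫ t in T0..T, q t := by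
      rw [intervalIntegral.integral_of_le h1]
      exact setIntegral_nonneg measurableSet_Ioc hq0
    have f0 : volume (Pol u (Function.update h i T0)) ≠ ⊤ := hC.bs.fin _
    rw [vol, vol, hs T, e1, mul_add, ← hs T0, e2, ENNReal.toReal_add f0]
    · rw [ENNReal.toReal_mul, ENNReal.toReal_ofReal e3]; rfl
    · exact ENNReal.mul_ne_top (by simp) (by simp)
  have hd : HasDerivAt (fun T => vol u (Function.update h i T0) + kap (u i) hi * ∫ t in T0..T, q t)
      (kap (u i) hi * q (h i)) (h i) := by
    refine HasDerivAt.const_add _ (HasDerivAt.const_mul _ ?_)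
    exact intervalIntegral.integral_hasDerivAt_right (hq.intervalIntegrable _ _)
      (hq.stronglyMeasurableAtFilter _ _) hq.continuousAt
  have hqi : q (h i) = eval (cl u i hi h) p := by simp [q]
  rw [hqi] at hd
  refine hd.congr_of_eventuallyEq ?_
  filter_upwards [Ioo_mem_nhds (show T0 < h i by simp only [T0]; linarith) (show h i < h i + ε by linarith)] with T hT
  exact key T hT.1.le hT.2

lemma vol_partial0 {u : ι → ((Fin d → ℝ) →ₗ[ℝ] ℝ)} (i : ι)
    (hi : u i = 0) {h : ι → ℝ} (hs : SF u h) :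
    HasDerivAt (fun T => vol u (Function.update h i T)) 0 (h i) := by
  obtain ⟨x, hx⟩ := hs
  have h0 : 0 < h i := by simpa [hi] using hx i
  refine (hasDerivAt_const (h i) (vol u h)).congr_of_eventuallyEq ?_
  filter_upwards [lt_mem_nhds h0] with T hT
  simp only [vol]
  congr 2
  ext y
  constructor
  · intro H j
    by_cases hj : j = i
    · subst hj; rw [hi]; simpa using h0.le
    · have := H j; rwa [Function.update_of_ne hj] at this
  · intro H j
    by_cases hj : j = i
    · subst hj; rw [hi]; simpa using hT.le
    · rw [Function.update_of_ne hj]; exact H j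

lemma fderiv_of_partials (f : (ι → ℝ) → ℝ) {C : Set (ι → ℝ)} (hC : IsOpen C) (g : ι → (ι → ℝ) → ℝ)
    (hg : ∀ i, ContinuousOn (g i) C)
    (hp : ∀ h ∈ C, ∀ i, HasDerivAt (fun T => f (Function.update h i T)) (g i h) (h i)) {h : ι → ℝ}
    (hh : h ∈ C) (v : ι → ℝ) : HasDerivAt (fun s : ℝ => f (h + s • v)) (∑ i, g i h * v i) 0 := by
  have claim : ∀ ε > 0, ∃ δ > 0, ∀ w : ι → ℝ, ‖w‖ < δ → ∀ S : Finset ι,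
      |f (fun j => h j + if j ∈ S then w j else 0) - f h - ∑ i ∈ S, g i h * w i| ≤ ε * ∑ i ∈ S, |w i| := by
    intro ε he
    have h1 : ∀ᶠ k in nhds h, k ∈ C ∧ ∀ i, |g i k - g i h| ≤ ε := by
      refine (hC.eventually_mem hh).and (Filter.eventually_all.2 fun i => ?_)
      have := ((hg i).continuousAt (hC.mem_nhds hh))
      filter_upwards [Metric.tendsto_nhds.1 this ε he] with k hk
      exact (Real.dist_eq _ _ ▸ hk).le
    obtain ⟨δ, hd, hδ⟩ := Metric.eventually_nhds_iff.1 h1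
    refine ⟨δ, hd, fun w hw S => ?_⟩
    induction S using Finset.induction_on with
    | empty => simp
    | insert i S hiS ih =>
      set k : ι → ℝ := fun j => h j + if j ∈ S then w j else 0
      have hk : ∀ T ∈ Set.uIcc (h i) (h i + w i), dist (Function.update k i T) h < δ := by
        intro T hT
        rw [dist_pi_lt_iff hd]
        intro j
        have hwj : |w j| < δ := (norm_le_pi_norm w j).trans_lt hw
        by_cases hj : j = i
        · subst hj
          rw [Function.update_self, Real.dist_eq]
          have := Set.abs_sub_left_of_mem_uIcc hT
          refine this.trans_lt ?_
          simpa using hwj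
        · rw [Function.update_of_ne hj, Real.dist_eq]
          by_cases hjS : j ∈ S <;> simp [k, hjS, hwj, hd]
      have hki : k i = h i := by simp [k, hiS]
      have e1 : (fun j => h j + if j ∈ insert i S then w j else 0) = Function.update k i (h i + w i) := by
        ext j
        by_cases hj : j = i
        · subst hj; simp
        · simp [hj, k]
      have e2 : k = Function.update k i (h i) := by rw [← hki]; simp
      have mv := Convex.norm_image_sub_le_of_norm_hasDerivWithin_le (𝕜 := ℝ)
        (f := fun T => f (Function.update k i T) - g i h * T)
        (f' := fun T => g i (Function.update k i T) - g i h)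
        (s := Set.uIcc (h i) (h i + w i)) (C := ε) (x := h i) (y := h i + w i)
        (fun T hT => by
          have := hp _ (hδ (hk T hT)).1 i
          simp only [Function.update_idem, Function.update_self] at this
          have h3 : HasDerivAt (fun T => g i h * T) (g i h) T := by
            simpa using (hasDerivAt_id T).const_mul (g i h)
          exact (this.sub h3).hasDerivWithinAt)
        (fun T hT => (hδ (hk T hT)).2 i) (convex_uIcc _ _) Set.left_mem_uIcc Set.right_mem_uIcc
      rw [e1, Finset.sum_insert hiS, Finset.sum_insert hiS]
      rw [← e2] at mv
      simp only [Real.norm_eq_abs, add_sub_cancel_left] at mv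
      have : f (Function.update k i (h i + w i)) - f h - (g i h * w i + ∑ j ∈ S, g j h * w j) =
        (f (Function.update k i (h i + w i)) - g i h * (h i + w i) - (f k - g i h * h i)) +
        (f k - f h - ∑ j ∈ S, g j h * w j) := by ring
      rw [this, mul_add ε]
      exact (abs_add_le _ _).trans (add_le_add mv ih)
  rw [hasDerivAt_iff_isLittleO_nhds_zero, Asymptotics.isLittleO_iff]
  intro c hc
  set B := ∑ i, |v i|
  have hB : 0 ≤ B := Finset.sum_nonneg fun i _ => abs_nonneg _
  obtain ⟨δ, hd, hδ⟩ := claim (c / (B + 1)) (by positivity)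
  have hlim : Filter.Tendsto (fun s : ℝ => ‖s • v‖) (nhds 0) (nhds 0) := by
    have : Continuous fun s : ℝ => ‖s • v‖ := by fun_prop
    simpa using this.tendsto 0
  filter_upwards [hlim.eventually_lt_const hd] with s hs
  have := hδ (s • v) hs Finset.univ
  simp only [Finset.mem_univ, if_true, Pi.smul_apply, smul_eq_mul, abs_mul] at this
  rw [← Finset.mul_sum] at this
  have e : (fun j => h j + s * v j) = h + (0 + s) • v := by ext j; simp
  rw [e] at this
  simp only [zero_smul, add_zero, smul_eq_mul, Real.norm_eq_abs]
  have e3 : s * ∑ i, g i h * v i = ∑ i, g i h * (s * v i) := by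
    rw [Finset.mul_sum]; exact Finset.sum_congr rfl fun i _ => by ring
  rw [e3]
  refine this.trans ?_
  have : c / (B + 1) * (|s| * B) = c * |s| * (B / (B + 1)) := by ring
  rw [this]
  have h5 : B / (B + 1) ≤ 1 := by rw [div_le_one (by positivity)]; linarith
  nlinarith [mul_nonneg hc.le (abs_nonneg s)]

lemma Pol_smul (u : ι → ((Fin d → ℝ) →ₗ[ℝ] ℝ)) (h : ι → ℝ) {s : ℝ} (hs : 0 < s) :
    Pol u (s • h) = s • Pol u h := by
  ext x
  rw [Set.mem_smul_set_iff_inv_smul_mem₀ hs.ne']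
  simp only [Pol, Set.mem_setOf_eq, map_smul, smul_eq_mul, Pi.smul_apply]
  refine forall_congr' fun i => ?_
  rw [inv_mul_le_iff₀ hs]

lemma vol_smul (u : ι → ((Fin d → ℝ) →ₗ[ℝ] ℝ)) (h : ι → ℝ) {s : ℝ} (hs : 0 < s) :
    vol u (s • h) = s ^ d * vol u h := by
  rw [vol, Pol_smul u h hs, Measure.addHaar_smul, ENNReal.toReal_mul, vol]
  rw [Module.finrank_fin_fun, abs_of_pos (pow_pos hs d), ENNReal.toReal_ofReal (by positivity)]

theorem exists_vp (d : ℕ) : ∀ {ι : Type} [Fintype ι] (u : ι → ((Fin d → ℝ) →ₗ[ℝ] ℝ)) (C : Set (ι → ℝ)),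
    Ch u C → ∃ p : MvPolynomial ι ℝ, p.IsHomogeneous d ∧ ∀ h ∈ C, vol u h = eval h p := by
  induction d with
  | zero =>
    intro ι _ u C hC
    rcases hC.dich with hE | hS
    · exact ⟨0, isHomogeneous_zero _ _ _, fun h hh => by simp [vol, hE h hh]⟩
    · refine ⟨1, isHomogeneous_one _ _, fun h hh => ?_⟩
      obtain ⟨x, hx⟩ := (hS h hh).ne
      have : Pol u h = Set.univ := by
        ext y; simp [Subsingleton.elim y x, hx]
      rw [vol, this, volume_pi, Measure.pi_of_empty _ 0]; simp
  | succ d ih =>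
    intro ι _ u C hC
    rcases hC.dich with hE | hS
    · exact ⟨0, isHomogeneous_zero _ _ _, fun h hh => by simp [vol, hE h hh]⟩
    have hG : ∀ i, ∃ G : MvPolynomial ι ℝ, G.IsHomogeneous d ∧ ∀ h ∈ C,
        HasDerivAt (fun T => vol u (Function.update h i T)) (eval h G) (h i) := by
      intro i
      by_cases hi : u i = 0
      · exact ⟨0, isHomogeneous_zero _ _ _, fun h hh => by simpa using vol_partial0 i hi (hS h hh)⟩
      · obtain ⟨p, hp, hpe⟩ := ih _ _ (hC.contr i hi)
        refine ⟨(kap (u i) hi : ℝ) • Rl (cl u i hi) p, ?_, fun h hh => ?_⟩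
        · rw [smul_eq_C_mul]
          simpa using (isHomogeneous_C ι _).mul (Rl_hom (cl u i hi) hp)
        · have := vol_partial hC i hi hpe hh
          rw [smul_eval, eval_Rl]; exact this
    choose G hGh hGd using hG
    refine ⟨MvPolynomial.C (1 / ((d : ℝ) + 1)) * ∑ i, X i * G i, ?_, fun h hh => ?_⟩
    · have h1 : (∑ i, X i * G i).IsHomogeneous (d + 1) :=
        IsHomogeneous.sum _ _ _ fun i _ => by
          rw [add_comm]; exact (isHomogeneous_X ℝ i).mul (hGh i)
      simpa using (isHomogeneous_C ι (1 / ((d : ℝ) + 1))).mul h1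
    · have h1 := fderiv_of_partials (vol u) hC.op (fun i h => eval h (G i))
        (fun i => (continuous_evalp _).continuousOn) (fun h hh i => hGd i h hh) hh h
      have h2 : HasDerivAt (fun s : ℝ => (1 + s) ^ (d + 1) * vol u h) (((d : ℝ) + 1) * vol u h) 0 := by
        have h3 : HasDerivAt (fun s : ℝ => (1 + s)) 1 0 := by
          simpa using (hasDerivAt_id (0 : ℝ)).const_add 1
        have := (h3.pow (d + 1)).mul_const (vol u h)
        simpa using this
      have h4 : (fun s : ℝ => vol u (h + s • h)) =ᶠ[nhds 0] fun s : ℝ => (1 + s) ^ (d + 1) * vol u h := by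
        filter_upwards [lt_mem_nhds (show (-1 : ℝ) < 0 by norm_num)] with s hs
        rw [← vol_smul u h (by linarith), add_smul, one_smul]
      have h5 := (h2.congr_of_eventuallyEq h4).unique h1
      have hd : (d : ℝ) + 1 ≠ 0 := by positivity
      simp only [map_mul, eval_C, map_sum, eval_X]
      have h6 : ∑ i, h i * eval h (G i) = ∑ i, eval h (G i) * h i :=
        Finset.sum_congr rfl fun i _ => mul_comm _ _
      rw [h6, ← h5]
      field_simp

lemma hasDerivAt_update (p : MvPolynomial ι ℝ) (h : ι → ℝ) (i : ι) :
    HasDerivAt (fun T => eval (Function.update h i T) p) (eval h (pderiv i p)) (h i) := by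
  have h1 := hasDerivAt_eval h (Pi.single i 1) p 0
  rw [zero_smul, add_zero, ← pderiv_eq_Dv] at h1
  have h3 : HasDerivAt (fun T : ℝ => T - h i) 1 (h i) := (hasDerivAt_id (h i)).sub_const _
  have h2 := HasDerivAt.comp (h i) (h := fun T : ℝ => T - h i) (by simpa using h1) h3
  rw [mul_one] at h2
  refine h2.congr_of_eventuallyEq (Filter.Eventually.of_forall fun T => ?_)
  have : Function.update h i T = h + (T - h i) • Pi.single i (1:ℝ) := by
    funext j
    by_cases hj : j = i
    · subst hj; simp
    · simp [hj]
  simp only [this]; rfl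

/-- `p` is the volume polynomial of the chamber -/
def VP (u : ι → ((Fin d → ℝ) →ₗ[ℝ] ℝ)) (C : Set (ι → ℝ)) (p : MvPolynomial ι ℝ) : Prop :=
  p.IsHomogeneous d ∧ ∀ h ∈ C, vol u h = eval h p

lemma VP.eventually {u : ι → ((Fin d → ℝ) →ₗ[ℝ] ℝ)} {C : Set (ι → ℝ)} {p} (hp : VP u C p) (hC : Ch u C) (i : ι)
    {h : ι → ℝ} (hh : h ∈ C) : (fun T => eval (Function.update h i T) p) =ᶠ[nhds (h i)]
      fun T => vol u (Function.update h i T) := by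
  obtain ⟨ε, he, hb⟩ := update_mem_near hC.op hh i
  filter_upwards [Metric.ball_mem_nhds (h i) he] with T hT
  exact (hp.2 _ (hb T (by simpa [Real.dist_eq] using hT))).symm

lemma VP.pderiv_ne {u : ι → ((Fin (d+1) → ℝ) →ₗ[ℝ] ℝ)} {C : Set (ι → ℝ)} {p} (hp : VP u C p) (hC : Ch u C)
    (i : ι) (hi : u i ≠ 0) {q} (hq : VP (cu u i hi) (cl u i hi '' C) q) :
    pderiv i p = (kap (u i) hi : ℝ) • Rl (cl u i hi) q := by
  apply poly_eq_of_open hC.op hC.ne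
  intro h hh
  rw [smul_eval, eval_Rl]
  exact (hasDerivAt_update p h i).unique ((vol_partial hC i hi hq.2 hh).congr_of_eventuallyEq (hp.eventually hC i hh))

lemma VP.pderiv_zero {u : ι → ((Fin d → ℝ) →ₗ[ℝ] ℝ)} {C : Set (ι → ℝ)} {p} (hp : VP u C p) (hC : Ch u C)
    (i : ι) (hi : u i = 0) : pderiv i p = 0 := by
  rcases hC.dich with hE | hS
  · have : p = 0 := poly_eq_of_open hC.op hC.ne fun h hh => by
      rw [← hp.2 h hh]; simp [vol, hE h hh]
    simp [this]
  · apply poly_eq_of_open hC.op hC.ne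
    intro h hh
    rw [map_zero]
    exact (hasDerivAt_update p h i).unique ((vol_partial0 i hi (hS h hh)).congr_of_eventuallyEq (hp.eventually hC i hh))

/-- translation vector -/
def tau (u : ι → ((Fin d → ℝ) →ₗ[ℝ] ℝ)) (a : Fin d → ℝ) : ι → ℝ := fun i => u i a

lemma vol_translate (u : ι → ((Fin d → ℝ) →ₗ[ℝ] ℝ)) (h : ι → ℝ) (a : Fin d → ℝ) :
    vol u (h + tau u a) = vol u h := by
  have : Pol u (h + tau u a) = (fun x => x + (-a)) ⁻¹' Pol u h := by
    ext x
    simp only [Pol, Set.mem_setOf_eq, Set.mem_preimage, map_add, map_neg, Pi.add_apply, tau]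
    refine forall_congr' fun i => ?_
    constructor <;> intro <;> linarith
  rw [vol, this, measure_preimage_add_right, vol]

lemma VP.Dtau {u : ι → ((Fin d → ℝ) →ₗ[ℝ] ℝ)} {C : Set (ι → ℝ)} {p} (hp : VP u C p) (hC : Ch u C)
    (a : Fin d → ℝ) : Dv (tau u a) p = 0 := by
  apply poly_eq_of_open hC.op hC.ne
  intro h hh
  rw [map_zero]
  have h1 := hasDerivAt_eval h (tau u a) p 0
  rw [zero_smul, add_zero] at h1
  refine h1.unique ((hasDerivAt_const 0 (vol u h)).congr_of_eventuallyEq ?_)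
  have hc : Continuous fun s : ℝ => h + s • tau u a := by fun_prop
  filter_upwards [hc.continuousAt.preimage_mem_nhds (hC.op.mem_nhds (by simpa using hh))] with s hs
  change eval (h + s • tau u a) p = vol u h
  rw [← hp.2 _ hs]
  change vol u (h + s • tau u a) = vol u h
  have : s • tau u a = tau u (s • a) := by ext i; simp [tau]
  rw [this, vol_translate]

end vp
end AFW

namespace AFW
set_option linter.unusedSectionVars false
set_option linter.unusedSimpArgs false
set_option linter.unusedVariables false

section pos
open scoped Classical
open MvPolynomial
variable {ι : Type} [Fintype ι] {d : ℕ}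

/-- zero or strictly positive on lists from `C` -/
def Ps (C : Set (ι → ℝ)) (n : ℕ) (q : MvPolynomial ι ℝ) : Prop :=
  q = 0 ∨ ∀ c : List (ι → ℝ), c.length = n → (∀ x ∈ c, x ∈ C) → 0 < M c q

lemma Ps.nonneg {C : Set (ι → ℝ)} {n : ℕ} {q : MvPolynomial ι ℝ} (h : Ps C n q) {c : List (ι → ℝ)}
    (hc : c.length = n) (hx : ∀ x ∈ c, x ∈ C) : 0 ≤ M c q := by
  rcases h with rfl | h
  · rw [M_zero]
  · exact (h c hc hx).le

lemma Ps.eq_zero {C : Set (ι → ℝ)} {n : ℕ} {q : MvPolynomial ι ℝ} (h : Ps C n q) {c : List (ι → ℝ)}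
    (hc : c.length = n) (hx : ∀ x ∈ c, x ∈ C) (h0 : M c q = 0) : q = 0 := by
  rcases h with rfl | h
  · rfl
  · exact absurd h0 (h c hc hx).ne'

lemma Ps.facet {u : ι → ((Fin (d+1) → ℝ) →ₗ[ℝ] ℝ)} {C : Set (ι → ℝ)} (i : ι) (hi : u i ≠ 0) {n : ℕ} {q}
    (h : Ps (cl u i hi '' C) n q) : Ps C n ((kap (u i) hi : ℝ) • Rl (cl u i hi) q) := by
  rcases h with rfl | h
  · left; simp
  · right
    intro c hc hx
    rw [M_smul_right, M_Rl]
    refine mul_pos (by exact_mod_cast kap_pos (u i) hi) (h _ (by simpa using hc) ?_)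
    intro x hx'
    obtain ⟨y, hy, rfl⟩ := List.mem_map.1 hx'
    exact ⟨y, hx y hy, rfl⟩

lemma VP.empty {u : ι → ((Fin d → ℝ) →ₗ[ℝ] ℝ)} {C : Set (ι → ℝ)} {p} (hp : VP u C p) (hC : Ch u C)
    (hE : ∀ h ∈ C, Pol u h = ∅) : p = 0 :=
  poly_eq_of_open hC.op hC.ne fun h hh => by
      rw [← hp.2 h hh]; simp [vol, hE h hh]

lemma M_tau {u : ι → ((Fin d → ℝ) →ₗ[ℝ] ℝ)} {C : Set (ι → ℝ)} {p} (hp : VP u C p) (hC : Ch u C)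
    (a : Fin d → ℝ) (x : ι → ℝ) (c) : M (x :: c) p = M ((x - tau u a) :: c) p := by
  rw [M_sub, M_cons (tau u a), hp.Dtau hC, M_zero, sub_zero]

theorem VP.pos (d : ℕ) : ∀ {ι : Type} [Fintype ι] {u : ι → ((Fin d → ℝ) →ₗ[ℝ] ℝ)} {C : Set (ι → ℝ)}
    {p : MvPolynomial ι ℝ}, VP u C p → Ch u C → Ps C d p := by
  induction d with
  | zero =>
    intro ι _ u C p hp hC
    rcases hC.dich with hE | hS
    · left; exact hp.empty hC hE
    · right
      intro c hc hx
      rw [List.length_eq_zero_iff] at hc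
      subst hc
      obtain ⟨h, hh⟩ := hC.ne
      rw [M, DL_nil, ← hom_zero_eval hp.1 h, ← hp.2 h hh]
      exact (hS h hh).vol_pos hC.bs
  | succ d ih =>
    intro ι _ u C p hp hC
    rcases hC.dich with hE | hS
    · left; exact hp.empty hC hE
    · right
      intro c hc hx
      have hf : ∀ i, Ps C d (pderiv i p) := by
        intro i
        by_cases hi : u i = 0
        · left; exact hp.pderiv_zero hC i hi
        · obtain ⟨q, hq⟩ := exists_vp d _ _ (hC.contr i hi)
          rw [hp.pderiv_ne hC i hi hq]
          exact (ih hq (hC.contr i hi)).facet i hi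
      match c, hc with
      | x :: c, hc =>
        have hc' : c.length = d := by simpa using hc
        have hx' : ∀ y ∈ c, y ∈ C := fun y hy => hx y (List.mem_cons_of_mem _ hy)
        have hxC := hx x List.mem_cons_self
        obtain ⟨a, ha⟩ := hS x hxC
        rw [M_tau hp hC a, M_cons_sum]
        have hpos : ∀ i, 0 < (x - tau u a) i := fun i => by simpa [tau] using ha i
        have hnn : ∀ i, 0 ≤ (x - tau u a) i * M c (pderiv i p) := fun i =>
          mul_nonneg (hpos i).le ((hf i).nonneg hc' hx')
        refine lt_of_le_of_ne (Finset.sum_nonneg fun i _ => hnn i) ?_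
        intro h0
        have h1 := (Finset.sum_eq_zero_iff_of_nonneg (fun i _ => hnn i)).1 h0.symm
        have h2 : ∀ i, pderiv i p = 0 := fun i => (hf i).eq_zero hc' hx'
          ((mul_eq_zero.1 (h1 i (Finset.mem_univ _))).resolve_left (hpos i).ne')
        have h3 := euler hp.1 x
        rw [Dv_eq_sum] at h3
        simp only [h2, smul_zero, Finset.sum_const_zero, map_zero] at h3
        have h4 := (hS x hxC).vol_pos hC.bs
        have h5 := hp.2 x hxC
        rw [vol] at h5
        rw [← h5] at h3
        have : (0:ℝ) < ((d + 1 : ℕ) : ℝ) := by positivity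
        nlinarith [mul_pos this h4]

lemma VP.pos1 {u : ι → ((Fin (d+1) → ℝ) →ₗ[ℝ] ℝ)} {C : Set (ι → ℝ)} {p} (hp : VP u C p) (hC : Ch u C) (i : ι) :
    Ps C d (pderiv i p) := by
  by_cases hi : u i = 0
  · left; exact hp.pderiv_zero hC i hi
  · obtain ⟨q, hq⟩ := exists_vp d _ _ (hC.contr i hi)
    rw [hp.pderiv_ne hC i hi hq]
    exact (VP.pos d hq (hC.contr i hi)).facet i hi

lemma VP.pos2 {u : ι → ((Fin (d+2) → ℝ) →ₗ[ℝ] ℝ)} {C : Set (ι → ℝ)} {p} (hp : VP u C p) (hC : Ch u C) {i j : ι}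
    (hij : j ≠ i) : Ps C d (pderiv j (pderiv i p)) := by
  by_cases hi : u i = 0
  · left; rw [hp.pderiv_zero hC i hi, map_zero]
  · obtain ⟨q, hq⟩ := exists_vp (d+1) _ _ (hC.contr i hi)
    have hsg : cl u i hi (Pi.single j 1) = Pi.single ⟨j, hij⟩ 1 := by
      funext k
      rw [cl_apply]
      simp only [Pi.single_apply, Subtype.ext_iff]
      simp [hij.symm]
    have this : pderiv j (Rl (cl u i hi) q) = Rl (cl u i hi) (pderiv ⟨j, hij⟩ q) := by
      rw [pderiv_eq_Dv, Dv_Rl, hsg, pderiv_eq_Dv]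
    rw [hp.pderiv_ne hC i hi hq, Derivation.map_smul]
    rw [this]
    exact (VP.pos1 hq (hC.contr i hi) _).facet i hi

lemma VP.bm {u : ι → ((Fin d → ℝ) →ₗ[ℝ] ℝ)} {C : Set (ι → ℝ)} {p} (hp : VP u C p) (hC : Ch u C) {y : ι → ℝ}
    (hy : y ∈ C) (v : ι → ℝ) : eval y p * eval y (Dv v (Dv v p)) ≤ eval y (Dv v p) ^ 2 := by
  apply second_order
  have hc : Continuous fun s : ℝ => y + s • v := by fun_prop
  have hc' : Continuous fun s : ℝ => y + (-s) • v := by fun_prop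
  filter_upwards [hc.continuousAt.preimage_mem_nhds (hC.op.mem_nhds (by simpa using hy)),
    hc'.continuousAt.preimage_mem_nhds (hC.op.mem_nhds (by simpa using hy))] with s h1 h2
  have h1' : y + s • v ∈ C := h1
  have h2' : y + (-s) • v ∈ C := h2
  rw [← hp.2 _ h1', ← hp.2 _ h2', ← hp.2 _ hy]
  have := bm_mid (Pol u (y + s • v)) (Pol u (y + (-s) • v)) (Pol u y) (isClosed_Pol _ _).measurableSet
    (isClosed_Pol _ _).measurableSet (isClosed_Pol _ _).measurableSet (by
      intro a ha b hb i
      have h3 := ha i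
      have h4 := hb i
      simp only [Pi.add_apply, Pi.smul_apply, smul_eq_mul] at h3 h4
      rw [map_smul, map_add, smul_eq_mul]
      linarith)
  have h5 := ENNReal.toReal_mono (ENNReal.pow_ne_top (hC.bs.fin y)) this
  rw [ENNReal.toReal_mul, ENNReal.toReal_pow] at h5
  exact h5

lemma M_rep {n : ℕ} {q : MvPolynomial ι ℝ} (hq : q.IsHomogeneous n) (y : ι → ℝ) :
    M (List.replicate n y) q = n.factorial * eval y q := by
  have h := eval_DL_replicate y n (n := 0) (p := q) (by simpa using hq)
  rw [M, ← hom_zero_eval (DL_hom _ (by simpa using hq)) y]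
  simpa using h

lemma VP.bm_M {u : ι → ((Fin (d+2) → ℝ) →ₗ[ℝ] ℝ)} {C : Set (ι → ℝ)} {p} (hp : VP u C p) (hC : Ch u C) {y : ι → ℝ}
    (hy : y ∈ C) (v : ι → ℝ) (h0 : M (y :: v :: List.replicate d y) p = 0) :
    M (v :: v :: List.replicate d y) p ≤ 0 := by
  rcases VP.pos _ hp hC with rfl | hpos
  · rw [M_zero]
  have e1 : M (y :: v :: List.replicate d y) p = (d+1).factorial * eval y (Dv v p) := by
    rw [M_swap, M_cons, ← List.replicate_succ, M_rep (Dv_hom v hp.1)]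
  have e2 : M (v :: v :: List.replicate d y) p = d.factorial * eval y (Dv v (Dv v p)) := by
    rw [M_cons, M_cons, M_rep (Dv_hom v (Dv_hom v hp.1))]
  have e3 : M (List.replicate (d+2) y) p = (d+2).factorial * eval y p := M_rep hp.1 y
  have h3 := hpos (List.replicate (d+2) y) (by simp) (fun x hx => by rwa [List.eq_of_mem_replicate hx])
  rw [e3] at h3
  have h4 : 0 < eval y p := pos_of_mul_pos_right h3 (by positivity)
  have h5 : eval y (Dv v p) = 0 := by
    rw [h0] at e1
    exact (mul_eq_zero.1 e1.symm).resolve_left (by positivity)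
  have h6 := hp.bm hC hy v
  rw [h5] at h6
  rw [e2]
  refine mul_nonpos_of_nonneg_of_nonpos (by positivity) ?_
  nlinarith

end pos
end AFW

namespace AFW
set_option linter.unusedSectionVars false
set_option linter.unusedSimpArgs false
set_option linter.unusedVariables false

section la
open scoped Classical

lemma la_spec {E : Type*} [NormedAddCommGroup E] [InnerProductSpace ℝ E] [FiniteDimensional ℝ E]
    (T : E →ₗ[ℝ] E) (hT : T.IsSymmetric) (h1 : ∀ w, inner ℝ w (T w) ≤ inner ℝ (T w) (T w)) (w0 : E)
    (h2 : ∀ (l : ℝ) w, 1 ≤ l → T w = l • w → ∃ c : ℝ, w = c • w0) (w : E) (hw : inner ℝ w w0 = 0) :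
    inner ℝ w (T w) ≤ 0 := by
  set e := hT.eigenvectorBasis rfl
  set l := hT.eigenvalues rfl
  have he : ∀ i, T (e i) = (l i) • e i := fun i => by
    have := hT.apply_eigenvectorBasis rfl i
    exact this
  have key : ∀ i, l i ≤ 0 ∨ inner ℝ w (e i) = 0 := by
    intro i
    have hn : inner ℝ (e i) (e i) = (1:ℝ) := by
      rw [real_inner_self_eq_norm_sq]; simp
    have h3 := h1 (e i)
    rw [he i, inner_smul_left, inner_smul_right, hn] at h3
    simp at h3
    by_cases hl : l i ≤ 0
    · exact Or.inl hl
    · right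
      push Not at hl
      have : 1 ≤ l i := by nlinarith
      obtain ⟨c, hc⟩ := h2 (l i) (e i) this (he i)
      rw [hc, inner_smul_right, hw, mul_zero]
  have h4 : inner ℝ w (T w) = ∑ i, l i * inner ℝ w (e i) ^ 2 := by
    rw [← e.sum_inner_mul_inner w (T w)]
    refine Finset.sum_congr rfl fun i _ => ?_
    rw [← hT (e i) w, he i, inner_smul_left, real_inner_comm w (e i)]
    simp; ring
  rw [h4]
  refine Finset.sum_nonpos fun i _ => ?_
  rcases key i with h | h
  · exact mul_nonpos_of_nonpos_of_nonneg h (sq_nonneg _)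
  · simp [h]

variable {ι : Type} [Fintype ι]

lemma la_main (Q : ι → ι → ℝ) (hs : ∀ i j, Q i j = Q j i) (x b : ι → ℝ) (hx : ∀ i, 0 < x i)
    (hb : ∀ i, b i = ∑ j, Q i j * x j) (hb0 : ∀ i, 0 ≤ b i) (hbz : ∀ i, b i = 0 → ∀ j, Q i j = 0)
    (hQ : ∀ i j, i ≠ j → 0 ≤ Q i j)
    (hB : ∀ v : ι → ℝ, ∑ i, v i * ∑ j, Q i j * v j ≤ ∑ i, x i * ((∑ j, Q i j * v j) ^ 2 / b i))
    (hcon : ∀ t : ι → ℝ, (∀ i j, i ≠ j → 0 < Q i j → t i = t j) → ∃ m, ∀ i, 0 < b i → t i = m)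
    (v : ι → ℝ) (hv : ∑ i, v i * b i = 0) : ∑ i, v i * ∑ j, Q i j * v j ≤ 0 := by
  set s : ι → ℝ := fun i => √(x i / b i) with hsd
  have s2 : ∀ i, s i * s i = x i / b i := fun i => Real.mul_self_sqrt (div_nonneg (hx i).le (hb0 i))
  have spos : ∀ i, b i ≠ 0 → 0 < s i := fun i h => Real.sqrt_pos.2 (div_pos (hx i) (lt_of_le_of_ne (hb0 i) (Ne.symm h)))
  let A : Matrix ι ι ℝ := fun i j => s i * Q i j * s j
  let T : EuclideanSpace ℝ ι →ₗ[ℝ] EuclideanSpace ℝ ι := Matrix.toEuclideanLin A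
  have Tap : ∀ w i, T w i = s i * ∑ j, Q i j * (s j * w j) := by
    intro w i
    have : T w i = ∑ j, A i j * w j := by
      simp [T, Matrix.toLpLin_apply, Matrix.mulVec, dotProduct]
    rw [this, Finset.mul_sum]
    exact Finset.sum_congr rfl fun j _ => by simp only [A]; ring
  have inn : ∀ w z : EuclideanSpace ℝ ι, inner ℝ w z = ∑ i, w i * z i := by
    intro w z
    rw [PiLp.inner_apply]
    exact Finset.sum_congr rfl fun i _ => by simp [mul_comm]
  have wT : ∀ w z : EuclideanSpace ℝ ι, inner ℝ w (T z) = ∑ i, (s i * w i) * ∑ j, Q i j * (s j * z j) := by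
    intro w z
    rw [inn]
    exact Finset.sum_congr rfl fun i _ => by rw [Tap]; ring
  have hT : T.IsSymmetric := by
    intro w z
    rw [real_inner_comm, wT, wT]
    simp only [Finset.mul_sum]
    rw [Finset.sum_comm]
    refine Finset.sum_congr rfl fun i _ => Finset.sum_congr rfl fun j _ => ?_
    rw [hs j i]; ring
  have h1 : ∀ w, inner ℝ w (T w) ≤ inner ℝ (T w) (T w) := by
    intro w
    rw [wT, inn]
    refine (hB fun i => s i * w i).trans (le_of_eq ?_)
    refine Finset.sum_congr rfl fun i _ => ?_
    rw [Tap]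
    have := s2 i
    have e : x i * ((∑ j, Q i j * (s j * w j)) ^ 2 / b i) = (x i / b i) * (∑ j, Q i j * (s j * w j)) ^ 2 := by ring
    rw [e, ← this]; ring
  let w0 : EuclideanSpace ℝ ι := WithLp.toLp 2 fun i => if b i = 0 then 0 else x i / s i
  have hw0 : ∀ i, w0 i = if b i = 0 then 0 else x i / s i := fun i => rfl
  have h2 : ∀ (l : ℝ) w, 1 ≤ l → T w = l • w → ∃ c : ℝ, w = c • w0 := by
    intro l w hl hw
    have hwi : ∀ i, s i * ∑ j, Q i j * (s j * w j) = l * w i := by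
      intro i
      rw [← Tap, hw]; simp
    have woff : ∀ i, b i = 0 → w i = 0 := by
      intro i hi
      have := hwi i
      simp only [hbz i hi, zero_mul, Finset.sum_const_zero, mul_zero] at this
      have hl0 : l ≠ 0 := by linarith
      simpa [hl0] using this.symm
    set t : ι → ℝ := fun i => s i * w i / x i
    have tx : ∀ i, s i * w i = t i * x i := fun i => by simp only [t]; field_simp [(hx i).ne']
    have e1 : ∑ i, ∑ j, Q i j * x i * x j * (t i - t j) ^ 2 =
        2 * (∑ i, b i * x i * t i ^ 2) - 2 * ∑ i, (s i * w i) * ∑ j, Q i j * (s j * w j) := by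
      have a1 : ∑ i, b i * x i * t i ^ 2 = ∑ i, ∑ j, Q i j * x i * x j * t i ^ 2 := by
        refine Finset.sum_congr rfl fun i _ => ?_
        rw [hb i, Finset.sum_mul, Finset.sum_mul]
        exact Finset.sum_congr rfl fun j _ => by ring
      have a2 : ∑ i, ∑ j, Q i j * x i * x j * t i ^ 2 = ∑ i, ∑ j, Q i j * x i * x j * t j ^ 2 := by
        rw [Finset.sum_comm]
        exact Finset.sum_congr rfl fun i _ => Finset.sum_congr rfl fun j _ => by rw [hs j i]; ring
      have a3 : ∑ i, (s i * w i) * ∑ j, Q i j * (s j * w j) = ∑ i, ∑ j, Q i j * x i * x j * (t i * t j) := by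
        refine Finset.sum_congr rfl fun i _ => ?_
        rw [Finset.mul_sum]
        exact Finset.sum_congr rfl fun j _ => by rw [tx i, tx j]; ring
      rw [two_mul, a3]
      nth_rewrite 2 [a1]
      rw [a2, a1, Finset.mul_sum, ← Finset.sum_add_distrib, ← Finset.sum_sub_distrib]
      refine Finset.sum_congr rfl fun i _ => ?_
      rw [Finset.mul_sum, ← Finset.sum_add_distrib, ← Finset.sum_sub_distrib]
      exact Finset.sum_congr rfl fun j _ => by ring
    have e2 : ∑ i, b i * x i * t i ^ 2 = ∑ i, w i ^ 2 := by
      refine Finset.sum_congr rfl fun i _ => ?_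
      by_cases hi : b i = 0
      · simp [hi, woff i hi]
      · have h6 := s2 i
        simp only [t]
        have : b i * x i * (s i * w i / x i) ^ 2 = b i / x i * (s i * s i) * w i ^ 2 := by
          field_simp [(hx i).ne']
        rw [this, h6]
        have := (hx i).ne'
        field_simp
    have e3 : ∑ i, (s i * w i) * ∑ j, Q i j * (s j * w j) = l * ∑ i, w i ^ 2 := by
      rw [Finset.mul_sum]
      refine Finset.sum_congr rfl fun i _ => ?_
      have := hwi i
      calc _ = w i * (s i * ∑ j, Q i j * (s j * w j)) := by ring
        _ = _ := by rw [this]; ring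
    have hnn : ∀ i j, 0 ≤ Q i j * x i * x j * (t i - t j) ^ 2 := by
      intro i j
      by_cases hij : i = j
      · subst hij; simp
      · have := hQ i j hij
        have := hx i
        have := hx j
        positivity
    have h0 : ∑ i, ∑ j, Q i j * x i * x j * (t i - t j) ^ 2 = 0 := by
      refine le_antisymm ?_ (Finset.sum_nonneg fun i _ => Finset.sum_nonneg fun j _ => hnn i j)
      rw [e1, e2, e3]
      have : 0 ≤ ∑ i, w i ^ 2 := Finset.sum_nonneg fun i _ => sq_nonneg _
      nlinarith
    have h00 : ∀ i j, Q i j * x i * x j * (t i - t j) ^ 2 = 0 := by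
      intro i j
      have := (Finset.sum_eq_zero_iff_of_nonneg (fun i _ => Finset.sum_nonneg fun j _ => hnn i j)).1 h0 i (Finset.mem_univ _)
      exact (Finset.sum_eq_zero_iff_of_nonneg (fun j _ => hnn i j)).1 this j (Finset.mem_univ _)
    obtain ⟨m, hm⟩ := hcon t (by
      intro i j hij hq
      have := h00 i j
      have h7 : Q i j * x i * x j ≠ 0 := by
        have := hx i
        have := hx j
        positivity
      have := (mul_eq_zero.1 this).resolve_left h7
      have := pow_eq_zero_iff (two_ne_zero) |>.1 this
      linarith)
    refine ⟨m, ?_⟩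
    ext i
    simp only [PiLp.smul_apply, smul_eq_mul]
    rw [hw0]
    by_cases hi : b i = 0
    · simp [hi, woff i hi]
    · rw [if_neg hi, ← hm i (lt_of_le_of_ne (hb0 i) (Ne.symm hi))]
      have := (spos i hi).ne'
      have := (hx i).ne'
      simp only [t]
      field_simp
  let w : EuclideanSpace ℝ ι := WithLp.toLp 2 fun i => if b i = 0 then 0 else v i / s i
  have hw : ∀ i, w i = if b i = 0 then 0 else v i / s i := fun i => rfl
  have main := la_spec T hT h1 w0 h2 w (by
    rw [inn, ← hv]
    refine Finset.sum_congr rfl fun i _ => ?_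
    rw [hw, hw0]
    by_cases hi : b i = 0
    · simp [hi]
    · rw [if_neg hi, if_neg hi]
      have h8 := s2 i
      have h9 := (spos i hi).ne'
      have h10 := (hx i).ne'
      have : v i / s i * (x i / s i) = v i * x i / (s i * s i) := by field_simp
      rw [this, h8]
      field_simp)
  rw [wT] at main
  refine le_trans (le_of_eq ?_) main
  have sw : ∀ i, b i ≠ 0 → s i * w i = v i := by
    intro i hi
    rw [hw, if_neg hi]
    have := (spos i hi).ne'
    field_simp
  refine Finset.sum_congr rfl fun i _ => ?_
  by_cases hi : b i = 0
  · simp [hbz i hi]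
  · rw [sw i hi]
    congr 1
    refine Finset.sum_congr rfl fun j _ => ?_
    by_cases hj : b j = 0
    · rw [hs i j, hbz j hj]; simp
    · rw [sw j hj]

lemma la_con (Q : ι → ι → ℝ) (y b : ι → ℝ) (hs : ∀ i j, Q i j = Q j i) (hy : ∀ i, 0 < y i)
    (hb : ∀ i, b i = ∑ j, Q i j * y j) (hb0 : ∀ i, 0 ≤ b i) 
    (hneg : ∀ v : ι → ℝ, ∑ i, v i * b i = 0 → ∑ i, v i * ∑ j, Q i j * v j ≤ 0)
    (t : ι → ℝ) (ht : ∀ i j, i ≠ j → Q i j ≠ 0 → t i = t j) : ∃ m, ∀ i, 0 < b i → t i = m := by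
  have hyb : ∀ i, 0 ≤ y i * b i := fun i => mul_nonneg (hy i).le (hb0 i)
  by_cases hS : ∑ i, y i * b i = 0
  · refine ⟨0, fun i hi => ?_⟩
    have := (Finset.sum_eq_zero_iff_of_nonneg (fun i _ => hyb i)).1 hS i (Finset.mem_univ _)
    exact absurd this (mul_pos (hy i) hi).ne'
  set m := (∑ i, t i * (y i * b i)) / ∑ i, y i * b i with hm
  refine ⟨m, fun i hi => ?_⟩
  have h1 := hneg (fun i => (t i - m) * y i) (by
    have : ∑ i, (t i - m) * y i * b i = ∑ i, t i * (y i * b i) - m * ∑ i, y i * b i := by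
      rw [Finset.mul_sum, ← Finset.sum_sub_distrib]
      exact Finset.sum_congr rfl fun i _ => by ring
    rw [this, hm]; field_simp; ring)
  have h2 : ∑ i, (t i - m) * y i * ∑ j, Q i j * ((t j - m) * y j) = ∑ i, (t i - m) ^ 2 * (y i * b i) := by
    refine Finset.sum_congr rfl fun i _ => ?_
    rw [hb i, Finset.mul_sum, Finset.mul_sum, Finset.mul_sum]
    refine Finset.sum_congr rfl fun j _ => ?_
    by_cases hq : Q i j = 0
    · simp [hq]
    by_cases hij : i = j
    · subst hij; ring
    · rw [ht i j hij hq]; ring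
  rw [h2] at h1
  have hnn : ∀ i, 0 ≤ (t i - m) ^ 2 * (y i * b i) := fun i => mul_nonneg (sq_nonneg _) (hyb i)
  have h3 := (Finset.sum_eq_zero_iff_of_nonneg (fun i _ => hnn i)).1
    (le_antisymm h1 (Finset.sum_nonneg fun i _ => hnn i)) i (Finset.mem_univ _)
  have h4 := (mul_eq_zero.1 h3).resolve_right (mul_pos (hy i) hi).ne'
  have := pow_eq_zero_iff (two_ne_zero) |>.1 h4
  linarith

end la
end AFW

namespace AFW
set_option linter.unusedSectionVars false
set_option linter.unusedSimpArgs false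
set_option linter.unusedVariables false

section af
open scoped Classical
open MvPolynomial
variable {ι : Type} [Fintype ι] {d : ℕ}

/-- from the kernel form to the inequality -/
lemma af_ineq (p : MvPolynomial ι ℝ) (x v : ι → ℝ) (c : List (ι → ℝ)) (hxx : 0 < M (x :: x :: c) p)
    (H : ∀ v, M (x :: v :: c) p = 0 → M (v :: v :: c) p ≤ 0) :
    M (x :: x :: c) p * M (v :: v :: c) p ≤ M (x :: v :: c) p ^ 2 := by
  set a := M (x :: x :: c) p with ha
  set b := M (x :: v :: c) p with hb
  have e0 : M (v :: x :: c) p = b := M_swap _ _ _ _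
  have e1 : M (x :: (a • v - b • x) :: c) p = 0 := by
    rw [M_swap, M_sub, M_smul, M_smul, e0, ← ha]; ring
  have h := H _ e1
  have e2 : M ((a • v - b • x) :: (a • v - b • x) :: c) p = a * (a * M (v :: v :: c) p - b ^ 2) := by
    rw [M_sub, M_smul, M_smul, e1, M_swap, M_sub, M_smul, M_smul, M_swap x v, e0]
    ring
  rw [e2] at h
  nlinarith [nonpos_of_mul_nonpos_right h hxx]

lemma af_transfer (p : MvPolynomial ι ℝ) (e x : ι → ℝ) (c : List (ι → ℝ)) (hex : 0 < M (e :: x :: c) p)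
    (hxx : 0 ≤ M (x :: x :: c) p)
    (H : ∀ v, M (e :: v :: c) p = 0 → M (v :: v :: c) p ≤ 0) (v : ι → ℝ) (hv : M (x :: v :: c) p = 0) :
    M (v :: v :: c) p ≤ 0 := by
  set a := M (e :: x :: c) p with ha
  set b := M (e :: v :: c) p with hb
  have e3 : M (x :: e :: c) p = a := M_swap _ _ _ _
  have e4 : M (v :: e :: c) p = b := M_swap _ _ _ _
  have e5 : M (v :: x :: c) p = 0 := by rw [M_swap, hv]
  have e1 : M (e :: (b • x - a • v) :: c) p = 0 := by
    rw [M_swap, M_sub, M_smul, M_smul, e3, e4]; ring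
  have h := H _ e1
  have e2 : M ((b • x - a • v) :: (b • x - a • v) :: c) p =
      b ^ 2 * M (x :: x :: c) p + a ^ 2 * M (v :: v :: c) p := by
    rw [M_sub, M_smul, M_smul, M_swap x, M_swap v, M_sub, M_sub, M_smul, M_smul, M_smul, M_smul, hv, e5]; ring
  rw [e2] at h
  have h1 : a ^ 2 * M (v :: v :: c) p ≤ 0 := by
    have h2 := mul_nonneg (sq_nonneg b) hxx
    linarith
  exact nonpos_of_mul_nonpos_right h1 (pow_pos hex 2)

lemma M_two (p : MvPolynomial ι ℝ) (v w : ι → ℝ) (c) : M (v :: w :: c) p =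
    ∑ i, v i * ∑ j, M c (pderiv j (pderiv i p)) * w j := by
  rw [M_cons_sum]
  refine Finset.sum_congr rfl fun i _ => ?_
  rw [M_cons_sum]
  congr 1
  exact Finset.sum_congr rfl fun j _ => mul_comm _ _

lemma pderiv_comm' (p : MvPolynomial ι ℝ) (i j : ι) : pderiv i (pderiv j p) = pderiv j (pderiv i p) := by
  rw [pderiv_eq_Dv, pderiv_eq_Dv, pderiv_eq_Dv, pderiv_eq_Dv, Dv_comm]

lemma M_tau1 {u : ι → ((Fin d → ℝ) →ₗ[ℝ] ℝ)} {C : Set (ι → ℝ)} {p} (hp : VP u C p) (hC : Ch u C)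
    (a : Fin d → ℝ) (x : ι → ℝ) (c) (i : ι) : M (x :: c) (pderiv i p) = M ((x - tau u a) :: c) (pderiv i p) := by
  rw [M_sub, M_cons (tau u a), pderiv_eq_Dv, Dv_comm, hp.Dtau hC, map_zero, M_zero, sub_zero]

/-- abbreviation: kernel form of the Alexandrov-Fenchel inequality -/
theorem af_ker (d : ℕ) : ∀ {ι : Type} [Fintype ι] {u : ι → ((Fin (d+2) → ℝ) →ₗ[ℝ] ℝ)} {C : Set (ι → ℝ)}
    {p : MvPolynomial ι ℝ}, VP u C p → Ch u C → ∀ c : List (ι → ℝ), c.length = d → (∀ y ∈ c, y ∈ C) →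
    ∀ x ∈ C, ∀ v, M (x :: v :: c) p = 0 → M (v :: v :: c) p ≤ 0 := by
  induction d with
  | zero =>
    intro ι _ u C p hp hC c hc _ x hx v h0
    rw [List.length_eq_zero_iff] at hc
    subst hc
    exact hp.bm_M hC hx v h0
  | succ d ih =>
    intro ι _ u C p hp hC c hc hcC x hx
    rcases VP.pos _ hp hC with rfl | hpos
    · intro v _; rw [M_zero]
    rcases hC.dich with hE | hS
    · intro v _; rw [hp.empty hC hE, M_zero]
    match c, hc with
    | e :: c', hc =>
    have hc' : c'.length = d := by simpa using hc
    have hx' : ∀ y ∈ c', y ∈ C := fun y hy => hcC y (List.mem_cons_of_mem _ hy)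
    have heC := hcC e List.mem_cons_self
    have hec : ∀ y ∈ e :: c', y ∈ C := hcC
    have l1 : (e :: c').length = d + 1 := hc
    refine af_transfer p e x (e :: c') (hpos _ (by simp [hc']) ?_) (hpos _ (by simp [hc']) ?_).le ?_
    · intro y hy
      simp only [List.mem_cons] at hy
      rcases hy with rfl | rfl | rfl | hy
      · exact heC
      · exact hx
      · exact heC
      · exact hx' y hy
    · intro y hy
      simp only [List.mem_cons] at hy
      rcases hy with rfl | rfl | rfl | hy
      · exact hx
      · exact hx
      · exact heC
      · exact hx' y hy
    have l2 : (e :: e :: c').length = d + 2 := by simp [hc']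
    have m2 : ∀ y ∈ e :: e :: c', y ∈ C := by
      intro y hy
      simp only [List.mem_cons] at hy
      rcases hy with rfl | rfl | hy
      · exact heC
      · exact heC
      · exact hx' y hy
    have hsym : ∀ (c : List (ι → ℝ)) i j, M c (pderiv j (pderiv i p)) = M c (pderiv i (pderiv j p)) := by
      intro c i j; rw [pderiv_comm']
    obtain ⟨a, ha⟩ := hS e heC
    intro v hv
    rw [M_two]
    refine la_main (fun i j => M (e :: c') (pderiv j (pderiv i p))) (hsym _) (e - tau u a)
      (fun i => M (e :: e :: c') (pderiv i p)) (fun i => by simpa [tau] using ha i) ?_ ?_ ?_ ?_ ?_ ?_ v ?_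
    · intro i
      try dsimp only
      rw [M_tau1 hp hC a, M_cons_sum]
      exact Finset.sum_congr rfl fun j _ => mul_comm _ _
    · intro i
      exact (hp.pos1 hC i).nonneg l2 m2
    · intro i h0 j
      have := (hp.pos1 hC i).eq_zero l2 m2 h0
      try dsimp only
      rw [this, map_zero, M_zero]
    · intro i j hij
      exact (hp.pos2 hC hij.symm).nonneg l1 hec
    · intro w
      have q1 : ∑ i, w i * ∑ j, M (e :: c') (pderiv j (pderiv i p)) * w j =
          ∑ i, (e - tau u a) i * M (w :: w :: c') (pderiv i p) := by
        rw [← M_two, ← M_cons_sum, ← M_tau hp hC a]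
        apply M_perm
        exact (List.Perm.cons w (List.Perm.swap _ _ _)).trans (List.Perm.swap _ _ _)
      rw [q1]
      refine Finset.sum_le_sum fun i _ => ?_
      have hpos_i : 0 < (e - tau u a) i := by simpa [tau] using ha i
      refine mul_le_mul_of_nonneg_left ?_ hpos_i.le
      have q2 : ∑ j, M (e :: c') (pderiv j (pderiv i p)) * w j = M (e :: w :: c') (pderiv i p) := by
        rw [M_swap, M_cons_sum w]
        exact Finset.sum_congr rfl fun j _ => mul_comm _ _
      rw [q2]
      rcases eq_or_lt_of_le ((hp.pos1 hC i).nonneg l2 m2) with h0 | hb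
      · rw [(hp.pos1 hC i).eq_zero l2 m2 h0.symm]
        simp [M_zero]
      · rw [le_div_iff₀ hb, mul_comm]
        have hi : u i ≠ 0 := by
          intro hi
          rw [hp.pderiv_zero hC i hi, M_zero] at hb
          exact lt_irrefl _ hb
        obtain ⟨q, hq⟩ := exists_vp (d+2) _ _ (hC.contr i hi)
        have hk : (0:ℝ) < kap (u i) hi := by exact_mod_cast kap_pos (u i) hi
        rw [hp.pderiv_ne hC i hi hq] at hb ⊢
        simp only [M_smul_right, M_Rl, List.map_cons] at hb ⊢
        have hb' := pos_of_mul_pos_right hb hk.le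
        have IH := af_ineq q (cl u i hi e) (cl u i hi w) (c'.map (cl u i hi)) hb'
          (ih hq (hC.contr i hi) _ (by simpa using hc') (by
            intro y hy
            obtain ⟨z, hz, rfl⟩ := List.mem_map.1 hy
            exact ⟨z, hx' z hz, rfl⟩) _ ⟨e, heC, rfl⟩)
        rw [mul_pow]
        nlinarith [mul_le_mul_of_nonneg_left IH (sq_nonneg (kap (u i) hi : ℝ))]
    · intro t ht
      have l3 : (List.replicate (d+1) e).length = d + 1 := by simp
      have m3 : ∀ y ∈ List.replicate (d+1) e, y ∈ C := fun y hy => by rwa [List.eq_of_mem_replicate hy]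
      have l4 : (e :: List.replicate (d+1) e).length = d + 2 := by simp
      have m4 : ∀ y ∈ e :: List.replicate (d+1) e, y ∈ C := fun y hy => by
        rw [← List.replicate_succ] at hy; rwa [List.eq_of_mem_replicate hy]
      obtain ⟨m, hm⟩ := la_con (fun i j => M (List.replicate (d+1) e) (pderiv j (pderiv i p))) (e - tau u a)
        (fun i => M (e :: List.replicate (d+1) e) (pderiv i p)) (hsym _) (fun i => by simpa [tau] using ha i)
        (by
          intro i
          try dsimp only
          rw [M_tau1 hp hC a, M_cons_sum]
          exact Finset.sum_congr rfl fun j _ => mul_comm _ _)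
        (fun i => (hp.pos1 hC i).nonneg l4 m4)
        (by
          intro w hw
          rw [← M_two]
          apply hp.bm_M hC heC
          rw [M_swap, M_cons_sum]
          exact hw) t
        (by
          intro i j hij h0
          refine ht i j hij ?_
          refine lt_of_le_of_ne ((hp.pos2 hC hij.symm).nonneg l1 hec) ?_
          intro h
          apply h0
          try dsimp only
          rw [(hp.pos2 hC hij.symm).eq_zero l1 hec h.symm, M_zero])
      refine ⟨m, fun i hi => hm i ?_⟩
      refine lt_of_le_of_ne ((hp.pos1 hC i).nonneg l4 m4) ?_
      intro h
      try dsimp only at hi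
      rw [(hp.pos1 hC i).eq_zero l4 m4 h.symm, M_zero] at hi
      exact lt_irrefl _ hi
    · rw [← M_cons_sum, M_swap]; exact hv

theorem af {u : ι → ((Fin (d+2) → ℝ) →ₗ[ℝ] ℝ)} {C : Set (ι → ℝ)}
    {p : MvPolynomial ι ℝ} (hp : VP u C p) (hC : Ch u C) (c : List (ι → ℝ)) (hc : c.length = d) (hcC : ∀ y ∈ c, y ∈ C)
    {x : ι → ℝ} (hx : x ∈ C) (v) : M (x :: x :: c) p * M (v :: v :: c) p ≤ M (x :: v :: c) p ^ 2 := by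
  rcases VP.pos _ hp hC with rfl | hpos
  · simp [M_zero]
  · refine af_ineq p x v c (hpos _ (by simp [hc]) ?_) (af_ker d hp hC c hc hcC x hx)
    intro y hy
    simp only [List.mem_cons] at hy
    rcases hy with rfl | rfl | hy
    · exact hx
    · exact hx
    · exact hcC y hy

end af
end AFW

namespace AFW
set_option linter.unusedSectionVars false
set_option linter.unusedSimpArgs false
set_option linter.unusedVariables false

section chain
open scoped Classical
open MvPolynomial
variable {ι : Type} [Fintype ι] {d : ℕ}

/-- admissible coefficient sequences -/
def Cls (D : ℕ) (m : ℕ → ℝ) : Prop :=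
  (∀ i, 0 ≤ m i) ∧ (∀ i, D < i → m i = 0) ∧ ∀ k, k + 1 ≤ D → m (k + 1) * m 0 ^ k ≤ m 1 ^ (k + 1)

/-- value of the form -/
def val (D : ℕ) (m : ℕ → ℝ) (s t : ℝ) : ℝ := ∑ i ∈ Finset.range (D + 1), D.choose i * m i * s ^ i * t ^ (D - i)

lemma chain_ineq (D : ℕ) (m : ℕ → ℝ) (hp : ∀ i ≤ D, 0 < m i)
    (hl : ∀ i, i + 2 ≤ D → m (i + 2) * m i ≤ m (i + 1) ^ 2) (k : ℕ) (hk : k + 1 ≤ D) :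
    m (k + 1) * m 0 ^ k ≤ m 1 ^ (k + 1) := by
  have h1 : ∀ i, i + 1 ≤ D → m (i + 1) * m 0 ≤ m i * m 1 := by
    intro i
    induction i with
    | zero => intro _; rw [zero_add, mul_comm]
    | succ i ih =>
      intro hi
      have a1 := ih (by omega)
      have a2 := hl i (by omega)
      have p0 := hp 0 (by omega)
      have pi := hp i (by omega)
      have pi1 := hp (i+1) (by omega)
      have : m i * (m (i + 1 + 1) * m 0) ≤ m i * (m (i + 1) * m 1) := by
        have b1 := mul_le_mul_of_nonneg_right a2 p0.le
        have b2 := mul_le_mul_of_nonneg_left a1 pi1.le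
        nlinarith
      exact le_of_mul_le_mul_left this pi
  induction k with
  | zero => simp
  | succ k ih =>
    have a1 := ih (by omega)
    have a2 := h1 (k + 1) hk
    have p0 := hp 0 (by omega)
    have p1 := hp 1 (by omega)
    calc m (k + 1 + 1) * m 0 ^ (k + 1) = (m (k + 1 + 1) * m 0) * m 0 ^ k := by ring
      _ ≤ (m (k + 1) * m 1) * m 0 ^ k := mul_le_mul_of_nonneg_right a2 (by positivity)
      _ = (m (k + 1) * m 0 ^ k) * m 1 := by ring
      _ ≤ m 1 ^ (k + 1) * m 1 := mul_le_mul_of_nonneg_right a1 p1.le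
      _ = _ := by ring

lemma hom_eval_smul {n : ℕ} {p : MvPolynomial ι ℝ} (hp : p.IsHomogeneous n) (s : ℝ) (z : ι → ℝ) :
    eval (s • z) p = s ^ n * eval z p := by
  have h1 := M_rep hp z
  have h2 := M_rep hp (s • z)
  have h3 : ∀ (k : ℕ) (q : MvPolynomial ι ℝ), M (List.replicate k (s • z)) q = s ^ k * M (List.replicate k z) q := by
    intro k
    induction k with
    | zero => intro q; simp
    | succ k ih =>
      intro q
      rw [List.replicate_succ, List.replicate_succ, M_smul, M_cons, ih, M_cons]; ring
  rw [h3, h1] at h2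
  have : (n.factorial : ℝ) ≠ 0 := by positivity
  have h4 : (n.factorial : ℝ) * eval (s • z) p = n.factorial * (s ^ n * eval z p) := by linarith
  exact mul_left_cancel₀ this h4

theorem chamber {u : ι → ((Fin (d+2) → ℝ) →ₗ[ℝ] ℝ)} {C : Set (ι → ℝ)} (hC : Ch u C) {x y : ι → ℝ}
    (hx : x ∈ C) (hy : y ∈ C) : ∃ m, Cls (d+2) m ∧ ∀ s t : ℝ, 0 < s → 0 < t →
      vol u (s • x + t • y) = val (d+2) m s t := by
  obtain ⟨p, hp'⟩ := exists_vp (d+2) u C hC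
  have hp : VP u C p := hp'
  set W : ℕ → ℝ := fun i => M (List.replicate i x ++ List.replicate (d + 2 - i) y) p with hW
  set F : ℝ := ((d+2).factorial : ℝ) with hF
  have F0 : 0 < F := by simp only [F]; positivity
  refine ⟨fun i => if i ≤ d + 2 then W i / F else 0, ?_, ?_⟩
  · have mem : ∀ a b, ∀ z ∈ List.replicate a x ++ List.replicate b y, z ∈ C := by
      intro a b z hz
      rw [List.mem_append] at hz
      rcases hz with hz | hz
      · rwa [List.eq_of_mem_replicate hz]
      · rwa [List.eq_of_mem_replicate hz]
    have Wl : ∀ i, i + 2 ≤ d + 2 → W (i + 2) * W i ≤ W (i + 1) ^ 2 := by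
      intro i hi
      obtain ⟨b, rfl⟩ : ∃ b, d = i + b := ⟨d - i, by omega⟩
      have := af hp hC (List.replicate i x ++ List.replicate b y) (by simp) (mem _ _) hx y
      have e2 : W (i + 2) = M (x :: x :: (List.replicate i x ++ List.replicate b y)) p := by
        simp only [W]
        rw [show i + b + 2 - (i + 2) = b by omega]
        simp [List.replicate_succ]
      have e1 : W (i + 1) = M (x :: y :: (List.replicate i x ++ List.replicate b y)) p := by
        simp only [W]
        rw [show i + b + 2 - (i + 1) = b + 1 by omega]
        apply M_perm
        rw [List.replicate_succ, List.replicate_succ, List.cons_append]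
        exact List.Perm.cons _ List.perm_middle
      have e0 : W i = M (y :: y :: (List.replicate i x ++ List.replicate b y)) p := by
        simp only [W]
        rw [show i + b + 2 - i = b + 2 by omega]
        apply M_perm
        rw [List.replicate_succ, List.replicate_succ]
        exact List.perm_middle.trans (List.Perm.cons _ List.perm_middle)
      rw [e2, e1, e0]; exact this
    rcases VP.pos _ hp hC with h0 | hpos
    · have : ∀ i, W i = 0 := fun i => by simp only [W]; rw [h0, M_zero]
      simp only [this, zero_div, ite_self]
      refine ⟨fun i => le_rfl, fun _ _ => rfl, fun k hk => ?_⟩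
      simp
    · have Wp : ∀ i ≤ d + 2, 0 < W i := fun i hi => hpos _ (by simp; omega) (mem _ _)
      refine ⟨fun i => ?_, fun i hi => if_neg (by omega), ?_⟩
      · dsimp only
        split_ifs with h
        · exact (div_pos (Wp i h) F0).le
        · exact le_rfl
      · refine chain_ineq (d+2) (fun i => if i ≤ d + 2 then W i / F else 0) ?_ ?_
        · intro i hi
          simp only [if_pos hi]; exact div_pos (Wp i hi) F0
        · intro i hi
          have i1 : i + 1 ≤ d + 2 := by omega
          have i0 : i ≤ d + 2 := by omega
          simp only [if_pos hi, if_pos i1, if_pos i0]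
          rw [div_mul_div_comm, div_pow, ← sq]
          exact div_le_div_of_nonneg_right (Wl i hi) (by positivity)
  · intro s t hs ht
    have h1 : vol u (s • x + t • y) = eval (s • x + t • y) p := by
      have hst : 0 < s + t := by linarith
      have e : s • x + t • y = (s + t) • ((s / (s+t)) • x + (t / (s+t)) • y) := by
        rw [smul_add, smul_smul, smul_smul, mul_div_cancel₀ _ hst.ne', mul_div_cancel₀ _ hst.ne']
      rw [e, vol_smul _ _ hst, hom_eval_smul hp.1, hp.2]
      exact hC.cv hx hy (by positivity) (by positivity) (by field_simp)
    have h2 := eval_binom hp.1 x y s t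
    rw [← h1] at h2
    have h3 : vol u (s • x + t • y) = (F * vol u (s • x + t • y)) / F := by field_simp
    rw [h3, hF, h2, val, Finset.sum_div]
    refine Finset.sum_congr rfl fun i hi => ?_
    have : i ≤ d + 2 := by simpa [Nat.lt_succ_iff] using hi
    rw [if_pos this]
    simp only [W]
    ring

lemma val_cont (D : ℕ) (s t : ℝ) : Continuous fun m : ℕ → ℝ => val D m s t := by
  unfold val; fun_prop

lemma Cls.bound {D : ℕ} {m : ℕ → ℝ} (hm : Cls D m) (i : ℕ) : m i ≤ val D m 1 1 := by
  have hnn : ∀ i, 0 ≤ (D.choose i : ℝ) * m i * 1 ^ i * 1 ^ (D - i) := fun i => by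
    have := hm.1 i; positivity
  by_cases hi : i ≤ D
  · have := Finset.single_le_sum (f := fun i => (D.choose i : ℝ) * m i * 1 ^ i * 1 ^ (D - i)) (fun i _ => hnn i)
      (Finset.mem_range.2 (Nat.lt_succ_of_le hi))
    refine le_trans ?_ this
    have h1 : (1:ℝ) ≤ D.choose i := by exact_mod_cast Nat.choose_pos hi
    simp only [one_pow, mul_one]
    nlinarith [hm.1 i]
  · rw [hm.2.1 i (by omega)]
    exact Finset.sum_nonneg fun i _ => hnn i

lemma Cls.closed (D : ℕ) : IsClosed {m | Cls D m} := by
  have : {m | Cls D m} = (⋂ i, {m : ℕ → ℝ | 0 ≤ m i}) ∩ ((⋂ i, ⋂ (_ : D < i), {m : ℕ → ℝ | m i = 0}) ∩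
      ⋂ k, ⋂ (_ : k + 1 ≤ D), {m : ℕ → ℝ | m (k + 1) * m 0 ^ k ≤ m 1 ^ (k + 1)}) := by
    ext m
    simp [Cls]
  rw [this]
  refine (isClosed_iInter fun i => isClosed_le (by fun_prop) (by fun_prop)).inter
    ((isClosed_iInter fun i => isClosed_iInter fun _ => isClosed_eq (by fun_prop) (by fun_prop)).inter
    (isClosed_iInter fun i => isClosed_iInter fun _ => isClosed_le (by fun_prop) (by fun_prop)))

/-- limits of admissible forms -/
lemma limit_cls (D : ℕ) (φ : ℝ → ℝ → ℝ) (m : ℕ → ℕ → ℝ) (hm : ∀ n, Cls D (m n))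
    (hl : ∀ s t : ℝ, 0 < s → 0 < t → Filter.Tendsto (fun n => val D (m n) s t) Filter.atTop (nhds (φ s t))) :
    ∃ m', Cls D m' ∧ ∀ s t : ℝ, 0 < s → 0 < t → φ s t = val D m' s t := by
  obtain ⟨B, hB⟩ := (hl 1 1 one_pos one_pos).bddAbove_range
  have hB' : ∀ n i, m n i ∈ Set.Icc 0 B := fun n i =>
    ⟨(hm n).1 i, ((hm n).bound i).trans (hB ⟨n, rfl⟩)⟩
  have hc : IsCompact (Set.pi Set.univ fun _ : ℕ => Set.Icc (0:ℝ) B) := isCompact_univ_pi fun _ => isCompact_Icc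
  obtain ⟨m', _, f, hf, hlim⟩ := hc.tendsto_subseq (x := m) (fun n => fun i _ => hB' n i)
  refine ⟨m', (Cls.closed D).mem_of_tendsto hlim (Filter.Eventually.of_forall fun n => hm _), fun s t hs ht => ?_⟩
  exact tendsto_nhds_unique ((hl s t hs ht).comp hf.tendsto_atTop) (((val_cont D s t).tendsto m').comp hlim)

end chain
end AFW

namespace AFW
set_option linter.unusedSectionVars false
set_option linter.unusedSimpArgs false
set_option linter.unusedVariables false

section hrep
open scoped Classical

/-- finitely generated cone -/
def coneL {E : Type} [AddCommGroup E] [Module ℝ E] : List E → Set E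
  | [] => {0}
  | v :: l => {z | ∃ t : ℝ, 0 ≤ t ∧ z - t • v ∈ coneL l}

/-- polyhedral cone -/
def PC {E : Type} [AddCommGroup E] [Module ℝ E] (S : Set E) : Prop :=
  ∃ (κ : Type) (_ : Fintype κ) (f : κ → (E →ₗ[ℝ] ℝ)), S = {x | ∀ i, f i x ≤ 0}

lemma PC.add_ray {E : Type} [AddCommGroup E] [Module ℝ E] {S : Set E} (hS : PC S) (v : E) :
    PC {z | ∃ t : ℝ, 0 ≤ t ∧ z - t • v ∈ S} := by
  obtain ⟨κ, _, f, rfl⟩ := hS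
  refine ⟨κ ⊕ (κ × κ), inferInstance, Sum.elim (fun i => if f i v ≤ 0 then f i else 0)
    (fun ij => if 0 < f ij.1 v ∧ f ij.2 v < 0 then (f ij.1 v) • f ij.2 - (f ij.2 v) • f ij.1 else 0), ?_⟩
  ext z
  constructor
  · rintro ⟨t, ht, hz⟩
    have hz' : ∀ i, f i z ≤ t * f i v := fun i => by
      have := hz i
      simp only [map_sub, map_smul, smul_eq_mul] at this
      linarith
    rintro (i | ⟨i, j⟩)
    · simp only [Sum.elim_inl]
      split_ifs with h
      · have := hz' i
        nlinarith
      · simp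
    · simp only [Sum.elim_inr]
      split_ifs with h
      · simp only [LinearMap.sub_apply, LinearMap.smul_apply, smul_eq_mul]
        nlinarith [hz' i, hz' j, mul_le_mul_of_nonneg_left (hz' j) h.1.le,
          mul_le_mul_of_nonneg_left (hz' i) (neg_nonneg.2 h.2.le)]
      · simp
  · intro H
    let g : Option κ → ℝ := fun o => match o with
      | none => 0
      | some i => if 0 < f i v then f i z / f i v else 0
    refine ⟨Finset.univ.sup' Finset.univ_nonempty g, ?_, ?_⟩
    · exact Finset.le_sup' g (Finset.mem_univ none)
    · intro i
      simp only [map_sub, map_smul, smul_eq_mul, sub_nonpos]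
      rcases lt_trichotomy (f i v) 0 with h | h | h
      · have h1 : Finset.univ.sup' Finset.univ_nonempty g ≤ f i z / f i v := by
          apply Finset.sup'_le
          rintro (_ | j) _
          · have := H (Sum.inl i)
            simp only [Sum.elim_inl, if_pos h.le] at this
            exact div_nonneg_of_nonpos this h.le
          · simp only [g]
            split_ifs with hj
            · have := H (Sum.inr (j, i))
              simp only [Sum.elim_inr, if_pos (And.intro hj h), LinearMap.sub_apply, LinearMap.smul_apply, smul_eq_mul] at this
              rw [div_le_iff₀ hj, div_mul_eq_mul_div, le_div_iff_of_neg h]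
              linarith
            · have := H (Sum.inl i)
              simp only [Sum.elim_inl, if_pos h.le] at this
              exact div_nonneg_of_nonpos this h.le
        rw [le_div_iff_of_neg h] at h1
        exact h1
      · have := H (Sum.inl i)
        simp only [Sum.elim_inl, if_pos h.le] at this
        rw [h, mul_zero]; exact this
      · have h1 := Finset.le_sup' g (Finset.mem_univ (some i))
        simp only [g, if_pos h] at h1
        rw [div_le_iff₀ h] at h1
        exact h1

lemma PC_coneL {E : Type} [AddCommGroup E] [Module ℝ E] (h0 : PC ({0} : Set E)) (l : List E) : PC (coneL l) := by
  induction l with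
  | nil => exact h0
  | cons v l ih => exact ih.add_ray v

lemma PC_zero (d : ℕ) : PC ({0} : Set ((Fin d → ℝ) × ℝ)) := by
  refine ⟨(Fin d ⊕ Unit) × Bool, inferInstance, fun ib =>
    (if ib.2 then (1:ℝ) else -1) • (Sum.elim (fun i => (LinearMap.proj i).comp (LinearMap.fst ℝ (Fin d → ℝ) ℝ))
      (fun _ => LinearMap.snd ℝ (Fin d → ℝ) ℝ) ib.1), ?_⟩
  ext ⟨x, r⟩
  constructor
  · intro h ib
    have h0 : (x, r) = (0 : (Fin d → ℝ) × ℝ) := h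
    rw [h0, map_zero]
  · intro H
    have h1 : ∀ i, x i = 0 := by
      intro i
      have a1 := H (Sum.inl i, true)
      have a2 := H (Sum.inl i, false)
      simp at a1 a2
      linarith
    have h2 : r = 0 := by
      have a1 := H (Sum.inr (), true)
      have a2 := H (Sum.inr (), false)
      simp at a1 a2
      linarith
    simp [h2]
    ext i; simp [h1]

lemma zero_mem_coneL {E : Type} [AddCommGroup E] [Module ℝ E] (l : List E) : (0 : E) ∈ coneL l := by
  induction l with
  | nil => rfl
  | cons v l ih => exact ⟨0, le_rfl, by simpa using ih⟩

lemma mem_coneL {E : Type} [AddCommGroup E] [Module ℝ E] (l : List E) : ∀ v ∈ l, v ∈ coneL l := by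
  induction l with
  | nil => simp
  | cons w l ih =>
    intro v hv
    rcases List.mem_cons.1 hv with rfl | hv
    · exact ⟨1, zero_le_one, by simpa using zero_mem_coneL l⟩
    · exact ⟨0, le_rfl, by simpa using ih v hv⟩

lemma coneL_conv {d : ℕ} {K : Set (Fin d → ℝ)} (hK : Convex ℝ K) (hne : K.Nonempty) (l : List (Fin d → ℝ))
    (hl : ∀ v ∈ l, v ∈ K) : ∀ (x : Fin d → ℝ) (r : ℝ), (x, r) ∈ coneL (l.map fun v => (v, (1:ℝ))) →
      0 ≤ r ∧ ∃ k ∈ K, x = r • k := by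
  induction l with
  | nil =>
    intro x r h
    have : (x, r) = 0 := h
    obtain ⟨k, hk⟩ := hne
    have h1 : x = 0 := congrArg Prod.fst this
    have h2 : r = 0 := congrArg Prod.snd this
    exact ⟨h2.ge, k, hk, by simp [h1, h2]⟩
  | cons v l ih =>
    rintro x r ⟨t, ht, h⟩
    have h' : (x - t • v, r - t) ∈ coneL (l.map fun v => (v, (1:ℝ))) := by simpa using h
    obtain ⟨h1, k, hk, h2⟩ := ih (fun w hw => hl w (List.mem_cons_of_mem _ hw)) _ _ h'
    have hr : 0 ≤ r := by linarith
    refine ⟨hr, ?_⟩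
    rcases eq_or_lt_of_le hr with h0 | h0
    · have t0 : t = 0 := by linarith
      subst t0
      refine ⟨k, hk, by simpa using h2⟩
    · refine ⟨(t / r) • v + ((r - t) / r) • k, hK (hl v List.mem_cons_self) hk (by positivity) (by positivity) (by field_simp; ring), ?_⟩
      rw [smul_add, smul_smul, smul_smul, mul_div_cancel₀ _ h0.ne', mul_div_cancel₀ _ h0.ne', ← h2]
      simp

/-- H-representation of polytopes -/
theorem hrep {d : ℕ} {F : Set (Fin d → ℝ)} (hF : F.Finite) (hne : F.Nonempty) :
    ∃ (κ : Type) (_ : Fintype κ) (u : κ → ((Fin d → ℝ) →ₗ[ℝ] ℝ)) (h : κ → ℝ), (∀ i, u i ≠ 0) ∧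
      convexHull ℝ F = Pol u h := by
  set l := hF.toFinset.toList
  have hl : ∀ v, v ∈ l ↔ v ∈ F := by intro v; simp [l]
  obtain ⟨κ, _, f, hf⟩ := PC_coneL (PC_zero d) (l.map fun v => (v, (1:ℝ)))
  have hdec : ∀ i (x : Fin d → ℝ), f i (x, 1) = f i (x, 0) + f i (0, 1) := by
    intro i x; rw [← map_add]; simp
  have e1 : convexHull ℝ F = {x | ∀ i, f i (x, 0) ≤ - f i (0, 1)} := by
    apply Set.Subset.antisymm
    · apply convexHull_min
      · intro v hv i
        have : (v, (1:ℝ)) ∈ coneL (l.map fun v => (v, (1:ℝ))) := mem_coneL _ _ (List.mem_map.2 ⟨v, (hl v).2 hv, rfl⟩)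
        rw [hf] at this
        have := this i
        rw [hdec] at this
        linarith
      · have : {x : Fin d → ℝ | ∀ i, f i (x, 0) ≤ - f i (0, 1)} = Pol (fun i => (f i).comp (LinearMap.inl ℝ _ _)) (fun i => - f i (0, 1)) := by
          ext x; simp [Pol]
        rw [this]
        intro x hx y hy s t hs ht hst i
        have a1 := hx i
        have a2 := hy i
        rw [map_add, map_smul, map_smul, smul_eq_mul, smul_eq_mul]
        have b1 := mul_le_mul_of_nonneg_left a1 hs
        have b2 := mul_le_mul_of_nonneg_left a2 ht
        calc _ ≤ s * (- f i (0, 1)) + t * (- f i (0, 1)) := add_le_add b1 b2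
          _ = (s + t) * (- f i (0, 1)) := by ring
          _ = _ := by rw [hst, one_mul]
    · intro x hx
      have : (x, (1:ℝ)) ∈ coneL (l.map fun v => (v, (1:ℝ))) := by
        rw [hf]
        intro i
        rw [hdec]
        have := hx i
        linarith
      obtain ⟨_, k, hk, hxk⟩ := coneL_conv (convex_convexHull ℝ F) (hne.mono (subset_convexHull ℝ F)) l
        (fun v hv => subset_convexHull ℝ F ((hl v).1 hv)) x 1 this
      rw [hxk, one_smul]; exact hk
  refine ⟨{i // (f i).comp (LinearMap.inl ℝ (Fin d → ℝ) ℝ) ≠ 0}, inferInstance,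
    fun i => (f i).comp (LinearMap.inl ℝ _ _), fun i => - f i (0, 1), fun i => i.2, ?_⟩
  rw [e1]
  apply Set.Subset.antisymm
  · intro x hx i
    exact hx i
  · intro x hx i
    by_cases hi : (f i).comp (LinearMap.inl ℝ (Fin d → ℝ) ℝ) = 0
    · obtain ⟨y, hy⟩ := hne
      have hy' : y ∈ {x | ∀ i, f i (x, 0) ≤ - f i (0, 1)} := e1 ▸ subset_convexHull ℝ F hy
      have a := hy' i
      have a1 : f i (y, 0) = 0 := by simpa using LinearMap.congr_fun hi y
      have a2 : f i (x, 0) = 0 := by simpa using LinearMap.congr_fun hi x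
      rw [a1] at a; rw [a2]; exact a
    · exact hx ⟨i, hi⟩

/-- cancellation -/
lemma cancel {d : ℕ} {Y Z : Set (Fin d → ℝ)} (hY : IsClosed Y) (hYc : Convex ℝ Y) (hZ : IsCompact Z) (hZn : Z.Nonempty)
    (z : Fin d → ℝ) (h : ∀ w ∈ Z, z + w ∈ Y + Z) : z ∈ Y := by
  by_contra hz
  obtain ⟨f, c, h1, h2⟩ := geometric_hahn_banach_closed_point hYc hY hz
  obtain ⟨w, hw, hmax⟩ := hZ.exists_isMaxOn hZn f.continuous.continuousOn
  obtain ⟨y, hy, w', hw', e⟩ := h w hw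
  have e' := congrArg f e
  simp only [map_add] at e'
  have := h1 y hy
  have := hmax hw'
  simp only [Set.mem_setOf_eq] at this
  linarith

end hrep
end AFW

namespace AFW
set_option linter.unusedSectionVars false
set_option linter.unusedSimpArgs false
set_option linter.unusedVariables false

section poly2
open scoped Classical
open Filter Topology
variable {ι : Type} [Fintype ι] {d : ℕ}

lemma hyper_null (f : (Fin d → ℝ) →ₗ[ℝ] ℝ) (hf : f ≠ 0) (c : ℝ) :
    volume {x | f x = c} = 0 := by
  rcases Set.eq_empty_or_nonempty {x | f x = c} with he | ⟨x0, hx0⟩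
  · rw [he]; simp
  · have h1 : {x | f x = c} = (fun x => -x0 + x) ⁻¹' (LinearMap.ker f : Set (Fin d → ℝ)) := by
      ext x
      have hx0' : f x0 = c := hx0
      simp only [Set.mem_ofPred_eq, Set.mem_preimage, SetLike.mem_coe, LinearMap.mem_ker, map_add, map_neg, hx0']
      constructor <;> intro h <;> linarith
    rw [h1, measure_preimage_add]
    exact Measure.addHaar_submodule _ _ (fun h => hf (LinearMap.ker_eq_top.1 h))

lemma vol_tendsto {u : ι → ((Fin d → ℝ) →ₗ[ℝ] ℝ)} (hu : Bs u) (hne : ∀ i, u i ≠ 0)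
    {hn : ℕ → ι → ℝ} {h : ι → ℝ} (ht : Tendsto hn atTop (𝓝 h)) :
    Tendsto (fun n => vol u (hn n)) atTop (𝓝 (vol u h)) := by
  unfold vol
  refine (ENNReal.tendsto_toReal (hu.fin h)).comp ?_
  rw [tendsto_pi_nhds] at ht
  refine tendsto_measure_of_ae_tendsto_indicator atTop (isClosed_Pol u h).measurableSet
    (fun n => (isClosed_Pol u _).measurableSet) (B := Pol u (fun i => h i + 1))
    (isClosed_Pol u _).measurableSet (hu.fin _) ?_ ?_
  · have : ∀ᶠ n in atTop, ∀ i, hn n i < h i + 1 :=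
      eventually_all.2 fun i => (ht i).eventually_lt_const (by linarith)
    filter_upwards [this] with n hn' x hx i
    exact (hx i).trans (hn' i).le
  · have : ∀ᵐ x, ∀ i, u i x ≠ h i := by
      rw [ae_all_iff]
      intro i
      have := hyper_null (u i) (hne i) (h i)
      rw [ae_iff]; simpa using this
    filter_upwards [this] with x hx
    by_cases hxP : x ∈ Pol u h
    · have : ∀ᶠ n in atTop, ∀ i, u i x < hn n i :=
        eventually_all.2 fun i => (ht i).eventually_const_lt (lt_of_le_of_ne (hxP i) (hx i))
      filter_upwards [this] with n h1
      exact ⟨fun _ => hxP, fun _ i => (h1 i).le⟩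
    · have : ∃ i, h i < u i x := by
        by_contra hc; push Not at hc; exact hxP hc
      obtain ⟨i, hi⟩ := this
      filter_upwards [(ht i).eventually_lt_const hi] with n h1
      exact ⟨fun h2 => absurd (h2 i) (not_le.2 h1), fun h2 => absurd h2 hxP⟩

lemma Bs_of_bdd {u : ι → ((Fin d → ℝ) →ₗ[ℝ] ℝ)} {h : ι → ℝ} (hne : (Pol u h).Nonempty)
    (hb : IsCompact (Pol u h)) : Bs u := by
  intro x hx
  by_contra hx0
  obtain ⟨p, hp⟩ := hne
  obtain ⟨R, hR⟩ := hb.isBounded.exists_norm_le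
  have hn : 0 < ‖x‖ := norm_pos_iff.2 hx0
  have hRp : 0 ≤ R := (norm_nonneg p).trans (hR p hp)
  set N : ℝ := (R + ‖p‖ + 1) / ‖x‖ with hN
  have hN0 : 0 ≤ N := by positivity
  have hm : p + N • x ∈ Pol u h := by
    intro i
    rw [map_add, map_smul, smul_eq_mul]
    have := hp i
    nlinarith [hx i, mul_nonneg hN0 (neg_nonneg.2 (hx i))]
  have h1 := hR _ hm
  have h2 : ‖N • x‖ ≤ ‖p + N • x‖ + ‖p‖ := by
    have := norm_sub_le (p + N • x) p
    simpa using this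
  rw [norm_smul, Real.norm_of_nonneg hN0, hN, div_mul_cancel₀ _ hn.ne'] at h2
  linarith

lemma supp {u : ι → ((Fin d → ℝ) →ₗ[ℝ] ℝ)} {h : ι → ℝ} {K L : Set (Fin d → ℝ)}
    (hK : IsCompact K) (hKc : Convex ℝ K) (hKn : K.Nonempty)
    (hL : IsCompact L) (hLc : Convex ℝ L) (hLn : L.Nonempty) (hP : K + L = Pol u h) :
    ∃ a b : ι → ℝ, K ⊆ Pol u a ∧ L ⊆ Pol u b ∧
      ∀ s t : ℝ, 0 < s → 0 < t → Pol u (s • a + t • b) = s • K + t • L := by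
  have h1 : ∀ i, ∃ k ∈ K, ∀ x ∈ K, u i x ≤ u i k := fun i =>
    hK.exists_isMaxOn hKn (lin_cont (u i)).continuousOn
  have h2 : ∀ i, ∃ k ∈ L, ∀ x ∈ L, u i x ≤ u i k := fun i =>
    hL.exists_isMaxOn hLn (lin_cont (u i)).continuousOn
  choose k hk hkm using h1
  choose l hl hlm using h2
  set a : ι → ℝ := fun i => u i (k i) with ha
  set b : ι → ℝ := fun i => u i (l i) with hb
  have hKa : K ⊆ Pol u a := fun x hx i => hkm i x hx
  have hLb : L ⊆ Pol u b := fun x hx i => hlm i x hx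
  have hsub : ∀ s t : ℝ, 0 < s → 0 < t → s • K + t • L ⊆ Pol u (s • a + t • b) := by
    rintro s t hs ht _ ⟨_, ⟨x, hx, rfl⟩, _, ⟨y, hy, rfl⟩, rfl⟩ i
    simp only [map_add, map_smul, smul_eq_mul, Pi.add_apply, Pi.smul_apply]
    have := hKa hx i
    have := hLb hy i
    gcongr
  have hP' : Pol u (a + b) = K + L := by
    refine Set.Subset.antisymm ?_ ?_
    · rw [hP]
      intro x hx i
      refine (hx i).trans ?_
      have : k i + l i ∈ Pol u h := hP ▸ Set.add_mem_add (hk i) (hl i)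
      simpa [ha, hb] using this i
    · have := hsub 1 1 one_pos one_pos
      simpa using this
  refine ⟨a, b, hKa, hLb, fun s t hs ht => Set.Subset.antisymm ?_ (hsub s t hs ht)⟩
  intro z hz
  refine cancel (Y := s • K + t • L) (Z := t • K + s • L)
    ((hK.smul s).add (hL.smul t)).isClosed ((hKc.smul s).add (hLc.smul t))
    ((hK.smul t).add (hL.smul s)) ((hKn.smul_set).add hLn.smul_set) z ?_
  intro w hw
  have hw' := hsub t s ht hs hw
  have h3 : z + w ∈ Pol u ((s + t) • (a + b)) := by
    intro i
    have h4 := hz i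
    have h5 := hw' i
    simp only [map_add, map_smul, smul_eq_mul, Pi.add_apply, Pi.smul_apply] at h4 h5 ⊢
    linarith
  rw [Pol_smul u _ (by positivity), hP', smul_add, hKc.add_smul hs.le ht.le, add_comm s t,
    hLc.add_smul ht.le hs.le] at h3
  convert h3 using 1
  exact add_add_add_comm _ _ _ _

lemma gen (u : ι → ((Fin d → ℝ) →ₗ[ℝ] ℝ)) : ∃ η : ι → ℝ, ∀ J, Dep u J →
    ∃ g : ι → ℝ, (∀ j, g j ≠ 0 → j ∈ J) ∧ ∑ j, g j • u j = 0 ∧ ∑ j, g j * η j ≠ 0 := by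
  have h0 : ∀ J : {J // Dep u J}, Dep u J.1 := fun J => J.2
  choose g hg0 hgJ hgs using h0
  let φ : {J // Dep u J} → ((ι → ℝ) →ₗ[ℝ] ℝ) := fun J => ∑ j, g J j • LinearMap.proj j
  have hφ : ∀ J η, φ J η = ∑ j, g J j * η j := fun J η => by simp [φ]
  by_contra hc
  push Not at hc
  have hU : (⋃ J, (LinearMap.ker (φ J) : Set (ι → ℝ))) = Set.univ := by
    rw [Set.eq_univ_iff_forall]
    intro η
    obtain ⟨J, hJ, h1⟩ := hc η
    refine Set.mem_iUnion.2 ⟨⟨J, hJ⟩, ?_⟩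
    have := h1 (g ⟨J, hJ⟩) (hgJ ⟨J, hJ⟩) (hgs ⟨J, hJ⟩)
    simpa [hφ] using this
  obtain ⟨J, hJ⟩ := Subspace.exists_eq_top_of_iUnion_eq_univ hU
  apply hg0 J
  ext i
  have h2 : φ J (Pi.single i 1) = 0 := by
    have : Pi.single i (1:ℝ) ∈ LinearMap.ker (φ J) := hJ ▸ Submodule.mem_top
    simpa using this
  rw [hφ] at h2
  simpa [Pi.single_apply] using h2

lemma exists_delta {u : ι → ((Fin d → ℝ) →ₗ[ℝ] ℝ)} (hu : Bs u) {K L : Set (Fin d → ℝ)} {a b : ι → ℝ}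
    (hKa : K ⊆ Pol u a) (hLb : L ⊆ Pol u b)
    (hP : ∀ s t : ℝ, 0 < s → 0 < t → Pol u (s • a + t • b) = s • K + t • L)
    {η : ι → ℝ} (hη : ∀ J, Dep u J →
      ∃ g : ι → ℝ, (∀ j, g j ≠ 0 → j ∈ J) ∧ ∑ j, g j • u j = 0 ∧ ∑ j, g j * η j ≠ 0)
    {σ : ℝ} (hσ : 0 < σ) {ε : ℝ} (hε : 0 < ε) :
    ∃ δ : ℝ, 0 < δ ∧ δ < ε ∧ ∃ C, Ch u C ∧ (a + σ • b) + δ • η ∈ C ∧ (σ • a + b) + δ • η ∈ C := by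
  set x := a + σ • b
  set y := σ • a + b
  have hseg : ∀ p ∈ segment ℝ x y, ∃ s t : ℝ, 0 < s ∧ 0 < t ∧ p = s • a + t • b := by
    rintro p ⟨α, β, hα, hβ, hs, rfl⟩
    refine ⟨α + β * σ, α * σ + β, ?_, ?_, ?_⟩
    · rcases hα.eq_or_lt with h | h
      · have : β = 1 := by linarith
        subst this; nlinarith
      · positivity
    · rcases hβ.eq_or_lt with h | h
      · have : α = 1 := by linarith
        subst this; nlinarith
      · positivity
    · simp only [x, y]; module
  have hcomp : IsCompact (segment ℝ x y) := by
    rw [← convexHull_pair]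
    exact (Set.toFinite _).isCompact_convexHull ℝ
  have key : ∀ J, Dep u J → ∀ᶠ δ in 𝓝[>] (0:ℝ), ∀ p ∈ segment ℝ x y, p + δ • η ∉ Fa u J := by
    intro J hJ
    obtain ⟨g, hgJ, hgs, hgη⟩ := hη J hJ
    by_cases hA : ∃ s t : ℝ, 0 < s ∧ 0 < t ∧ s • a + t • b ∈ Fa u J
    · obtain ⟨s, t, hs, ht, z, hz, hzJ⟩ := hA
      rw [hP s t hs ht] at hz
      obtain ⟨_, ⟨k, hk, rfl⟩, _, ⟨l, hl, rfl⟩, rfl⟩ := hz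
      have hz1 : ∀ j ∈ J, u j k = a j ∧ u j l = b j := by
        intro j hj
        have h1 := hzJ j hj
        simp only [map_add, map_smul, smul_eq_mul, Pi.add_apply, Pi.smul_apply] at h1
        have h2 := hKa hk j
        have h3 := hLb hl j
        constructor <;> nlinarith
      have hsum : ∀ z, ∑ j, g j * u j z = 0 := fun z => by
        have := congrArg (fun f : (Fin d → ℝ) →ₗ[ℝ] ℝ => f z) hgs
        simpa using this
      have hsumJ : ∀ (c : ι → ℝ) z, (∀ j ∈ J, u j z = c j) → ∑ j, g j * c j = 0 := by
        intro c z hc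
        rw [← hsum z]
        refine Finset.sum_congr rfl fun j _ => ?_
        by_cases hj : g j = 0
        · simp [hj]
        · rw [hc j (hgJ j hj)]
      have ea := hsumJ a k fun j hj => (hz1 j hj).1
      have eb := hsumJ b l fun j hj => (hz1 j hj).2
      filter_upwards [self_mem_nhdsWithin] with δ hδ p hp ⟨w, hw, hwJ⟩
      obtain ⟨s', t', -, -, rfl⟩ := hseg p hp
      have ec := hsumJ _ w hwJ
      have : ∑ j, g j * (s' • a + t' • b + δ • η) j
          = s' * ∑ j, g j * a j + t' * ∑ j, g j * b j + δ * ∑ j, g j * η j := by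
        simp only [Finset.mul_sum, ← Finset.sum_add_distrib]
        refine Finset.sum_congr rfl fun j _ => ?_
        simp; ring
      rw [this, ea, eb] at ec
      have hδ' : (0:ℝ) < δ := hδ
      have : δ * ∑ j, g j * η j = 0 := by linarith
      exact hgη ((mul_eq_zero.1 this).resolve_left hδ'.ne')
    · push Not at hA
      obtain ⟨ρ, hρ, hth⟩ := hcomp.exists_thickening_subset_open (isClosed_Fa hu J).isOpen_compl
        (fun p hp => by
          obtain ⟨s, t, hs, ht, rfl⟩ := hseg p hp
          exact hA s t hs ht)
      have hc : Tendsto (fun δ : ℝ => ‖δ • η‖) (𝓝[>] 0) (𝓝 0) := by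
        have : Continuous fun δ : ℝ => ‖δ • η‖ := by fun_prop
        have h2 := this.tendsto 0
        simp only [zero_smul, norm_zero] at h2
        exact h2.mono_left nhdsWithin_le_nhds
      filter_upwards [hc.eventually_lt_const hρ] with δ hδ p hp
      refine hth (mem_thickening_iff.2 ⟨p, hp, ?_⟩)
      simpa [dist_eq_norm] using hδ
  have key2 : ∀ᶠ δ in 𝓝[>] (0:ℝ), ∀ J, Dep u J → ∀ p ∈ segment ℝ x y, p + δ • η ∉ Fa u J := by
    rw [eventually_all]
    intro J
    by_cases hJ : Dep u J
    · filter_upwards [key J hJ] with δ h _ using h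
    · exact Eventually.of_forall fun δ h => absurd h hJ
  have hlt : ∀ᶠ δ in 𝓝[>] (0:ℝ), δ < ε :=
    (eventually_lt_nhds hε).filter_mono nhdsWithin_le_nhds
  obtain ⟨δ, ⟨h1, h2⟩, h3⟩ := ((key2.and hlt).and (self_mem_nhdsWithin : Set.Ioi (0:ℝ) ∈ 𝓝[>] 0)).exists
  have hx' : segment ℝ (x + δ • η) (y + δ • η) ⊆ {h | Nd u h} := by
    rintro _ ⟨α, β, hα, hβ, hs, rfl⟩
    rw [Set.mem_ofPred_eq, Nd_iff]
    intro J hJ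
    have := h1 J hJ (α • x + β • y) ⟨α, β, hα, hβ, hs, rfl⟩
    have e : α • (x + δ • η) + β • (y + δ • η) = α • x + β • y + δ • η := by
      have : α = 1 - β := by linarith
      subst this; module
    rwa [e]
  have hcomp' : IsCompact (segment ℝ (x + δ • η) (y + δ • η)) := by
    rw [← convexHull_pair]
    exact (Set.toFinite _).isCompact_convexHull ℝ
  obtain ⟨ρ, hρ, hth⟩ := hcomp'.exists_thickening_subset_open (isOpen_Nd hu) hx'
  refine ⟨δ, h3, h2, thickening ρ (segment ℝ (x + δ • η) (y + δ • η)), ⟨hu, isOpen_thickening, ?_, ?_, ?_⟩, ?_, ?_⟩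
  · exact (convex_segment _ _).thickening ρ
  · exact ⟨_, self_subset_thickening hρ _ (left_mem_segment ℝ _ _)⟩
  · exact fun h hh => hth hh
  · exact self_subset_thickening hρ _ (left_mem_segment ℝ _ _)
  · exact self_subset_thickening hρ _ (right_mem_segment ℝ _ _)

theorem polytope_case {F G : Set (Fin (d+2) → ℝ)} (hF : F.Finite) (hFn : F.Nonempty)
    (hG : G.Finite) (hGn : G.Nonempty) :
    ∃ m, Cls (d+2) m ∧ ∀ s t : ℝ, 0 < s → 0 < t →
      (volume (s • convexHull ℝ F + t • convexHull ℝ G)).toReal = val (d+2) m s t := by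
  obtain ⟨κ, _, u, h, hu0, hP⟩ := hrep (hF.add hG) (hFn.add hGn)
  rw [convexHull_add] at hP
  have hK := hF.isCompact_convexHull ℝ
  have hL := hG.isCompact_convexHull ℝ
  have hu : Bs u := Bs_of_bdd (h := h) (hP ▸ (hFn.convexHull.add hGn.convexHull)) (hP ▸ hK.add hL)
  obtain ⟨a, b, hKa, hLb, hPst⟩ := supp hK (convex_convexHull ℝ F) hFn.convexHull hL
    (convex_convexHull ℝ G) hGn.convexHull hP
  obtain ⟨η, hη⟩ := gen u
  have hn : ∀ n : ℕ, ∃ δ : ℝ, 0 < δ ∧ δ < 1 / ((n:ℝ) + 1) ∧ ∃ C, Ch u C ∧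
      (a + (1 / ((n:ℝ) + 1)) • b) + δ • η ∈ C ∧ ((1 / ((n:ℝ) + 1)) • a + b) + δ • η ∈ C := fun n =>
    exists_delta hu hKa hLb hPst hη (by positivity) (by positivity)
  choose δ hδ0 hδ C hC hx hy using hn
  choose m hm hv using fun n => chamber (hC n) (hx n) (hy n)
  have ht1 : Tendsto (fun n : ℕ => 1 / ((n:ℝ) + 1)) atTop (𝓝 0) := tendsto_one_div_add_atTop_nhds_zero_nat
  have ht2 : Tendsto δ atTop (𝓝 0) := squeeze_zero (fun n => (hδ0 n).le) (fun n => (hδ n).le) ht1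
  have hl : ∀ s t : ℝ, 0 < s → 0 < t →
      Tendsto (fun n => val (d+2) (m n) s t) atTop (𝓝 (vol u (s • a + t • b))) := by
    intro s t hs ht
    simp_rw [← hv _ s t hs ht]
    apply vol_tendsto hu hu0
    have h1 : Tendsto (fun n : ℕ => s • (a + (1 / ((n:ℝ) + 1)) • b + δ n • η)
        + t • ((1 / ((n:ℝ) + 1)) • a + b + δ n • η)) atTop
        (𝓝 (s • (a + (0:ℝ) • b + (0:ℝ) • η) + t • ((0:ℝ) • a + b + (0:ℝ) • η))) := by
      refine Tendsto.add (Tendsto.const_smul ?_ s) (Tendsto.const_smul ?_ t)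
      · exact (tendsto_const_nhds.add (ht1.smul_const b)).add (ht2.smul_const η)
      · exact ((ht1.smul_const a).add tendsto_const_nhds).add (ht2.smul_const η)
    simpa using h1
  obtain ⟨m', hm', hv'⟩ := limit_cls (d+2) (fun s t => vol u (s • a + t • b)) m hm hl
  refine ⟨m', hm', fun s t hs ht => ?_⟩
  rw [← hv' s t hs ht, vol, hPst s t hs ht]

end poly2
end AFW

namespace AFW
set_option linter.unusedSectionVars false
set_option linter.unusedSimpArgs false
set_option linter.unusedVariables false

section bodies
open scoped Classical
open Filter Topology
variable {d : ℕ}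

lemma exists_approx {K : Set (Fin d → ℝ)} (hKc : Convex ℝ K) (hKn : K.Nonempty) :
    ∃ F : ℕ → Set (Fin d → ℝ), (∀ n, (F n).Finite) ∧ (∀ n, (F n).Nonempty) ∧ Monotone F ∧
      (∀ n, convexHull ℝ (F n) ⊆ K) ∧ K ⊆ closure (⋃ n, convexHull ℝ (F n)) := by
  have : Nonempty K := hKn.to_subtype
  let x : ℕ → K := TopologicalSpace.denseSeq K
  refine ⟨fun n => (fun i => (x i : Fin d → ℝ)) '' (Set.Iic n), fun n => (Set.finite_Iic n).image _,
    fun n => ⟨_, 0, by simp, rfl⟩, ?_, ?_, ?_⟩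
  · intro m n h
    exact Set.image_mono (Set.Iic_subset_Iic.2 h)
  · intro n
    refine convexHull_min ?_ hKc
    rintro _ ⟨i, -, rfl⟩
    exact (x i).2
  · intro k hk
    have h1 : (⟨k, hk⟩ : K) ∈ closure (Set.range x) := TopologicalSpace.denseRange_denseSeq K _
    have h2 : k ∈ closure ((fun z : K => (z : Fin d → ℝ)) '' Set.range x) :=
      image_closure_subset_closure_image continuous_subtype_val ⟨⟨k, hk⟩, h1, rfl⟩
    refine closure_mono ?_ h2
    rintro _ ⟨_, ⟨i, rfl⟩, rfl⟩
    exact Set.mem_iUnion.2 ⟨i, subset_convexHull ℝ _ ⟨i, by simp, rfl⟩⟩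

theorem body_case {K L : Set (Fin (d+2) → ℝ)} (hK : IsCompact K) (hKc : Convex ℝ K) (hKn : K.Nonempty)
    (hL : IsCompact L) (hLc : Convex ℝ L) (hLn : L.Nonempty) :
    ∃ m, Cls (d+2) m ∧ ∀ s t : ℝ, 0 < s → 0 < t →
      (volume (s • K + t • L)).toReal = val (d+2) m s t := by
  obtain ⟨F, hFf, hFn, hFm, hFK, hKF⟩ := exists_approx hKc hKn
  obtain ⟨G, hGf, hGn, hGm, hGL, hLG⟩ := exists_approx hLc hLn
  choose m hm hv using fun n => polytope_case (hFf n) (hFn n) (hGf n) (hGn n)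
  have hl : ∀ s t : ℝ, 0 < s → 0 < t →
      Tendsto (fun n => val (d+2) (m n) s t) atTop (𝓝 (volume (s • K + t • L)).toReal) := by
    intro s t hs ht
    simp_rw [← hv _ s t hs ht]
    have hfin : volume (s • K + t • L) ≠ ⊤ := ((hK.smul s).add (hL.smul t)).measure_lt_top.ne
    refine (ENNReal.tendsto_toReal hfin).comp ?_
    set S : ℕ → Set (Fin (d+2) → ℝ) := fun n => s • convexHull ℝ (F n) + t • convexHull ℝ (G n) with hS
    have hSm : Monotone S := fun i j h =>
      Set.add_subset_add (Set.smul_set_mono (convexHull_mono (hFm h)))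
        (Set.smul_set_mono (convexHull_mono (hGm h)))
    have hSc : ∀ n, Convex ℝ (S n) := fun n => ((convex_convexHull ℝ _).smul s).add ((convex_convexHull ℝ _).smul t)
    have hUc : Convex ℝ (⋃ n, S n) := hSm.directed_le.convex_iUnion fun n => hSc n
    have hSK : ∀ n, S n ⊆ s • K + t • L := fun n =>
      Set.add_subset_add (Set.smul_set_mono (hFK n)) (Set.smul_set_mono (hGL n))
    have hKU : s • K + t • L ⊆ closure (⋃ n, S n) := by
      rintro _ ⟨_, ⟨k, hk, rfl⟩, _, ⟨l, hl, rfl⟩, rfl⟩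
      refine map_mem_closure₂ (f := fun k l => s • k + t • l) (by fun_prop) (hKF hk) (hLG hl) ?_
      intro a ha b hb
      obtain ⟨i, hi⟩ := Set.mem_iUnion.1 ha
      obtain ⟨j, hj⟩ := Set.mem_iUnion.1 hb
      refine Set.mem_iUnion.2 ⟨max i j, Set.add_mem_add (Set.smul_mem_smul_set ?_) (Set.smul_mem_smul_set ?_)⟩
      · exact convexHull_mono (hFm (le_max_left _ _)) hi
      · exact convexHull_mono (hGm (le_max_right _ _)) hj
    have hvol : volume (s • K + t • L) = volume (⋃ n, S n) := by
      refine le_antisymm ?_ (measure_mono (Set.iUnion_subset hSK))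
      calc volume (s • K + t • L) ≤ volume (closure (⋃ n, S n)) := measure_mono hKU
        _ ≤ volume ((⋃ n, S n) ∪ frontier (⋃ n, S n)) := by
            rw [← closure_eq_self_union_frontier]
        _ ≤ volume (⋃ n, S n) + volume (frontier (⋃ n, S n)) := measure_union_le _ _
        _ = volume (⋃ n, S n) := by rw [hUc.addHaar_frontier volume, add_zero]
    rw [hvol]
    exact tendsto_measure_iUnion_atTop hSm
  obtain ⟨m', hm', hv'⟩ := limit_cls (d+2) (fun s t => (volume (s • K + t • L)).toReal) m hm hl
  exact ⟨m', hm', hv'⟩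

end bodies
end AFW

namespace AFW
set_option linter.unusedSectionVars false
set_option linter.unusedSimpArgs false
set_option linter.unusedVariables false

section duality
open Filter Topology
variable {d : ℕ}

lemma mem_rDual {r : ℝ} {A : Set (EuclideanSpace ℝ (Fin d))} {x} :
    x ∈ rDual r A ↔ ∀ a ∈ A, dist x a ≤ r := by
  simp [rDual]

lemma mem_rHull {r : ℝ} {A : Set (EuclideanSpace ℝ (Fin d))} {x} :
    x ∈ rHull r A ↔ ∀ p ∈ rDual r A, dist x p ≤ r := by
  simp only [rHull, Set.mem_iInter, mem_closedBall, mem_rDual, Set.mem_ofPred_eq]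
  constructor
  · intro h p hp
    exact h p fun a ha => by rw [mem_closedBall, dist_comm]; exact hp a ha
  · intro h p hp
    exact h p fun a ha => by rw [dist_comm]; exact hp ha

lemma rDual_convex (r : ℝ) (A : Set (EuclideanSpace ℝ (Fin d))) : Convex ℝ (rDual r A) :=
  convex_iInter₂ fun p _ => convex_closedBall p r

lemma rHull_convex (r : ℝ) (A : Set (EuclideanSpace ℝ (Fin d))) : Convex ℝ (rHull r A) :=
  convex_iInter₂ fun p _ => convex_closedBall p r

lemma rDual_compact (r : ℝ) {A : Set (EuclideanSpace ℝ (Fin d))} (hA : A.Nonempty) :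
    IsCompact (rDual r A) := by
  obtain ⟨a, ha⟩ := hA
  exact (isCompact_closedBall a r).of_isClosed_subset
    (isClosed_biInter fun p _ => isClosed_closedBall) (fun x hx => mem_rDual.1 hx a ha)

lemma rHull_compact (r : ℝ) {A : Set (EuclideanSpace ℝ (Fin d))} (hK : (rDual r A).Nonempty) :
    IsCompact (rHull r A) := by
  obtain ⟨p, hp⟩ := hK
  exact (isCompact_closedBall p r).of_isClosed_subset
    (isClosed_biInter fun p _ => isClosed_closedBall) (fun x hx => mem_rHull.1 hx p hp)

lemma subset_rHull (r : ℝ) (A : Set (EuclideanSpace ℝ (Fin d))) : A ⊆ rHull r A :=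
  fun a ha => mem_rHull.2 fun p hp => by rw [dist_comm]; exact mem_rDual.1 hp a ha

lemma rDual_nonempty {r : ℝ} {A : Set (EuclideanSpace ℝ (Fin d))} (hA : A.Nonempty) (hAc : IsCompact A)
    (hcr : circumradius A ≤ r) : (rDual r A).Nonempty := by
  have hne : {r : ℝ | 0 < r ∧ ∃ p, A ⊆ closedBall p r}.Nonempty := by
    obtain ⟨R, hR⟩ := hAc.isBounded.subset_closedBall (0 : EuclideanSpace ℝ (Fin d))
    exact ⟨max R 1, by positivity, 0, hR.trans (closedBall_subset_closedBall (le_max_left _ _))⟩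
  have h1 : ∀ n : ℕ, (rDual (r + 1 / ((n:ℝ) + 1)) A).Nonempty := by
    intro n
    have hlt : sInf {r : ℝ | 0 < r ∧ ∃ p, A ⊆ closedBall p r} < r + 1 / ((n:ℝ) + 1) :=
      lt_of_le_of_lt hcr (by have : (0:ℝ) < 1 / ((n:ℝ) + 1) := by positivity
                             linarith)
    obtain ⟨ρ, ⟨hρ, p, hp⟩, hlt⟩ := exists_lt_of_csInf_lt hne hlt
    exact ⟨p, mem_rDual.2 fun a ha => by
      rw [dist_comm]; exact (mem_closedBall.1 (hp ha)).trans hlt.le⟩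
  obtain ⟨x, hx⟩ := IsCompact.nonempty_iInter_of_sequence_nonempty_isCompact_isClosed
    (fun n : ℕ => rDual (r + 1 / ((n:ℝ) + 1)) A) (by
      intro n x hx
      refine mem_rDual.2 fun a ha => (mem_rDual.1 hx a ha).trans ?_
      gcongr
      push_cast; linarith) h1 (rDual_compact _ hA) (fun n => (rDual_compact _ hA).isClosed)
  refine ⟨x, mem_rDual.2 fun a ha => ?_⟩
  have h2 : Tendsto (fun n : ℕ => r + 1 / ((n:ℝ) + 1)) atTop (𝓝 (r + 0)) :=
    tendsto_const_nhds.add tendsto_one_div_add_atTop_nhds_zero_nat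
  rw [add_zero] at h2
  exact ge_of_tendsto' h2 fun n => mem_rDual.1 (Set.mem_iInter.1 hx n) a ha

lemma extremal {r : ℝ} (hr : 0 < r) {A : Set (EuclideanSpace ℝ (Fin d))} (hA : A.Nonempty)
    (hK : (rDual r A).Nonempty) (v : EuclideanSpace ℝ (Fin d)) (hv : ‖v‖ = 1) :
    ∃ y ∈ rHull r A, y + r • v ∈ rDual r A := by
  have hHn : (rHull r A).Nonempty := hA.mono (subset_rHull r A)
  obtain ⟨y, hy, hmin⟩ := (rHull_compact r hK).exists_isMinOn hHn
    (f := fun x => inner ℝ v x) (by fun_prop)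
  refine ⟨y, hy, mem_rDual.2 fun a ha => ?_⟩
  by_contra hcon
  push Not at hcon
  set q := a - y with hq
  have h1 : 2 * r * inner ℝ v q < ‖q‖ ^ 2 := by
    have e : dist (y + r • v) a = ‖q - r • v‖ := by
      rw [dist_comm, dist_eq_norm, hq]; congr 1; abel
    rw [e] at hcon
    have h2 : r ^ 2 < ‖q - r • v‖ ^ 2 := by gcongr
    rw [norm_sub_sq_real, inner_smul_right, norm_smul, hv, real_inner_comm] at h2
    rw [Real.norm_of_nonneg hr.le] at h2
    linarith
  have hq0 : 0 < ‖q‖ ^ 2 := by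
    by_contra hc
    have h3 : ‖q‖ ^ 2 = 0 := le_antisymm (not_lt.1 hc) (by positivity)
    have h4 : q = 0 := by simpa using h3
    rw [h4] at h1; simp at h1
  obtain ⟨m, hm1, hm2⟩ : ∃ m, max (inner ℝ v q) 0 < m ∧ m < ‖q‖ ^ 2 / (2 * r) := by
    apply exists_between
    apply max_lt
    · rw [lt_div_iff₀ (by positivity)]; linarith
    · positivity
  rw [lt_div_iff₀ (by positivity)] at hm2
  obtain ⟨hm3, hm0⟩ := max_lt_iff.1 hm1
  set M := ‖q - m • v‖ ^ 2 with hM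
  have hM0 : 0 ≤ M := by positivity
  set g := ‖q‖ ^ 2 - 2 * m * r with hg
  have hg0 : 0 < g := by rw [hg]; linarith
  set ε := min 1 (g / (M + 1)) with hε
  have hε0 : 0 < ε := lt_min one_pos (by positivity)
  have hε1 : ε ≤ 1 := min_le_left _ _
  have hε2 : ε * M ≤ g := by
    have : ε ≤ g / (M + 1) := min_le_right _ _
    rw [le_div_iff₀ (by positivity)] at this
    nlinarith
  have hx : y + ε • (q - m • v) ∈ rHull r A := by
    refine mem_rHull.2 fun p hp => ?_
    set z := y - p with hz
    have hz1 : ‖z‖ ≤ r := by rw [hz, ← dist_eq_norm]; exact mem_rHull.1 hy p hp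
    have hz2 : ‖z + q‖ ≤ r := by
      have : z + q = a - p := by rw [hz, hq]; abel
      rw [this, ← dist_eq_norm, dist_comm]; exact mem_rDual.1 hp a ha
    have e : dist (y + ε • (q - m • v)) p = ‖z + ε • (q - m • v)‖ := by
      rw [dist_eq_norm, hz]; congr 1; abel
    rw [e]
    have h5 : ‖z + q‖ ^ 2 ≤ r ^ 2 := by gcongr
    have h6 : ‖z‖ ^ 2 ≤ r ^ 2 := by gcongr
    rw [norm_add_sq_real] at h5
    have h7 : -r ≤ inner ℝ z v := by
      have := abs_real_inner_le_norm z v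
      rw [hv, mul_one] at this
      linarith [(abs_le.1 this).1]
    have h8 : ‖z + ε • (q - m • v)‖ ^ 2 ≤ r ^ 2 := by
      rw [norm_add_sq_real, inner_smul_right, inner_sub_right, inner_smul_right, norm_smul,
        Real.norm_of_nonneg hε0.le, mul_pow, ← hM]
      have h9 : ε * (2 * inner ℝ z q) ≤ ε * (r ^ 2 - ‖z‖ ^ 2 - ‖q‖ ^ 2) := by gcongr; linarith
      have h10 : ε * m * (-r) ≤ ε * m * inner ℝ z v := by gcongr
      have h11 : ε * (ε * M) ≤ ε * g := by gcongr
      have h12 : (1 - ε) * ‖z‖ ^ 2 ≤ (1 - ε) * r ^ 2 := by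
        have : 0 ≤ 1 - ε := by linarith
        gcongr
      rw [hg] at h11
      nlinarith
    exact (pow_le_pow_iff_left₀ (norm_nonneg _) hr.le two_ne_zero).1 h8
  have h13 : inner ℝ v y ≤ inner ℝ v (y + ε • (q - m • v)) := hmin hx
  rw [inner_add_right, inner_smul_right, inner_sub_right, inner_smul_right, real_inner_self_eq_norm_sq, hv] at h13
  nlinarith

lemma dual_sub (hd : 1 ≤ d) {r : ℝ} (hr : 0 < r) {A : Set (EuclideanSpace ℝ (Fin d))} (hA : A.Nonempty)
    (hK : (rDual r A).Nonempty) :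
    rDual r A + (-rHull r A) = closedBall (0 : EuclideanSpace ℝ (Fin d)) r := by
  apply Set.Subset.antisymm
  · rintro _ ⟨p, hp, x, hx, rfl⟩
    have := mem_rHull.1 (Set.mem_neg.1 hx) p hp
    rw [mem_closedBall_zero_iff]
    rwa [dist_comm, dist_eq_norm, sub_neg_eq_add] at this
  · intro w hw
    rw [mem_closedBall_zero_iff] at hw
    have hcv : Convex ℝ (rDual r A + (-rHull r A)) := (rDual_convex r A).add (rHull_convex r A).neg
    have hs : ∀ v : EuclideanSpace ℝ (Fin d), ‖v‖ = 1 → r • v ∈ rDual r A + (-rHull r A) := by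
      intro v hv
      obtain ⟨y, hy, hyv⟩ := extremal hr hA hK v hv
      exact ⟨_, hyv, -y, by simpa using hy, by simp⟩
    obtain ⟨v, hv, hwv⟩ : ∃ v : EuclideanSpace ℝ (Fin d), ‖v‖ = 1 ∧ w = ‖w‖ • v := by
      by_cases hw0 : w = 0
      · exact ⟨EuclideanSpace.single ⟨0, hd⟩ 1, by simp, by simp [hw0]⟩
      · have : ‖w‖ ≠ 0 := norm_ne_zero_iff.2 hw0
        refine ⟨‖w‖⁻¹ • w, by rw [norm_smul]; simp [this], ?_⟩
        rw [smul_smul, mul_inv_cancel₀ this, one_smul]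
    have h1 := hs v hv
    have h2 := hs (-v) (by simpa using hv)
    have h3 := hcv h1 h2 (a := (1 + ‖w‖ / r) / 2) (b := (1 - ‖w‖ / r) / 2) (by positivity)
      (by have : ‖w‖ / r ≤ 1 := by rw [div_le_one hr]; exact hw
          linarith) (by ring)
    convert h3 using 1
    rw [smul_neg, smul_neg, smul_smul, smul_smul, ← sub_eq_add_neg, ← sub_smul]
    have : (1 + ‖w‖ / r) / 2 * r - (1 - ‖w‖ / r) / 2 * r = ‖w‖ := by field_simp; ring
    rw [this]; exact hwv

end duality
end AFW

namespace AFW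
set_option linter.unusedSectionVars false
set_option linter.unusedSimpArgs false
set_option linter.unusedVariables false

section final
open Filter Topology
variable {d : ℕ}

/-- the identification of Euclidean space with coordinate space -/
noncomputable abbrev eE (d : ℕ) : EuclideanSpace ℝ (Fin d) ≃L[ℝ] (Fin d → ℝ) := EuclideanSpace.equiv (Fin d) ℝ

lemma vol_eE (S : Set (EuclideanSpace ℝ (Fin d))) : volume (eE d '' S) = volume S := by
  have h := EuclideanSpace.volume_preserving_symm_measurableEquiv_toLp (Fin d)
  rw [← h.measure_preimage_equiv]
  congr 1
  ext x
  constructor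
  · rintro ⟨y, hy, hxy⟩
    have : x = y := ((eE d).injective hxy).symm
    rwa [this]
  · intro hx
    exact ⟨x, hx, rfl⟩

lemma eE_comb (K L : Set (EuclideanSpace ℝ (Fin d))) (s t : ℝ) :
    eE d '' (s • K + t • L) = s • (eE d '' K) + t • (eE d '' L) := by
  rw [Set.image_add, image_smul_set, image_smul_set]

theorem euclid_case {K L : Set (EuclideanSpace ℝ (Fin (d+2)))} (hK : IsCompact K) (hKc : Convex ℝ K)
    (hKn : K.Nonempty) (hL : IsCompact L) (hLc : Convex ℝ L) (hLn : L.Nonempty) :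
    ∃ m, Cls (d+2) m ∧ ∀ s t : ℝ, 0 < s → 0 < t →
      (volume (s • K + t • L)).toReal = val (d+2) m s t := by
  obtain ⟨m, hm, hv⟩ := body_case (hK.image (eE (d+2)).continuous)
    (hKc.is_linear_image (f := eE (d+2)) ⟨map_add _, map_smul _⟩) (hKn.image _)
    (hL.image (eE (d+2)).continuous) (hLc.is_linear_image (f := eE (d+2)) ⟨map_add _, map_smul _⟩)
    (hLn.image _)
  refine ⟨m, hm, fun s t hs ht => ?_⟩
  rw [← hv s t hs ht, ← eE_comb, vol_eE]

lemma bm_euclid {A B S : Set (EuclideanSpace ℝ (Fin d))} (hA : IsCompact A) (hB : IsCompact B)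
    (hS : IsCompact S) (h : ∀ x ∈ A, ∀ y ∈ B, (1 / 2 : ℝ) • (x + y) ∈ S) :
    volume A * volume B ≤ volume S ^ 2 := by
  rw [← vol_eE A, ← vol_eE B, ← vol_eE S]
  refine bm_mid _ _ _ (hA.image (eE d).continuous).measurableSet (hB.image (eE d).continuous).measurableSet
    (hS.image (eE d).continuous).measurableSet ?_
  rintro _ ⟨x, hx, rfl⟩ _ ⟨y, hy, rfl⟩
  exact ⟨_, h x hx y hy, by rw [map_smul, map_add]⟩

lemma iv_eq {D k : ℕ} (hk : k ≤ D) (A : Set (EuclideanSpace ℝ (Fin D))) (m : ℕ → ℝ)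
    (h : ∀ j : ℕ, (volume (A + closedBall (0 : EuclideanSpace ℝ (Fin D)) (j : ℝ))).toReal = val D m 1 j) :
    intrinsicVolume D k A = D.choose k * m k / ballVolume (D - k) := by
  unfold intrinsicVolume
  congr 1
  set P : Polynomial ℝ := ∑ i ∈ Finset.range (D+1), Polynomial.monomial (D - i) (D.choose i * m i) with hP
  have h1 : P = Lagrange.interpolate (Finset.range (D + 1)) (fun j => (j : ℝ))
      (fun j => (volume (A + closedBall (0 : EuclideanSpace ℝ (Fin D)) (j : ℝ))).toReal) := by
    apply Lagrange.eq_interpolate_of_eval_eq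
    · exact fun a _ b _ hab => Nat.cast_injective hab
    · rw [Finset.card_range, Polynomial.degree_lt_iff_coeff_zero]
      intro n hn
      rw [hP, Polynomial.finsetSum_coeff]
      refine Finset.sum_eq_zero fun i _ => ?_
      rw [Polynomial.coeff_monomial, if_neg (by omega)]
    · intro j _
      rw [h j, hP, Polynomial.eval_finsetSum]
      simp [val]
  rw [← h1, hP, Polynomial.finsetSum_coeff]
  rw [Finset.sum_eq_single k]
  · rw [Polynomial.coeff_monomial, if_pos rfl]
  · intro i hi hik
    rw [Finset.mem_range] at hi
    rw [Polynomial.coeff_monomial, if_neg (by omega)]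
  · intro hk'; simp at hk'; omega

lemma vol_ball {D : ℕ} {ρ : ℝ} (hρ : 0 ≤ ρ) :
    (volume (closedBall (0 : EuclideanSpace ℝ (Fin D)) ρ)).toReal = ρ ^ D * ballVolume D := by
  unfold ballVolume
  rw [Measure.addHaar_closedBall' _ _ hρ, ENNReal.toReal_mul, finrank_euclideanSpace_fin,
    ENNReal.toReal_ofReal (by positivity)]

lemma ballVolume_pos (D : ℕ) : 0 < ballVolume D :=
  ENNReal.toReal_pos (measure_closedBall_pos volume _ one_pos).ne' measure_closedBall_lt_top.ne

lemma smul_unit {D : ℕ} {t : ℝ} (ht : 0 ≤ t) :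
    t • closedBall (0 : EuclideanSpace ℝ (Fin D)) 1 = closedBall 0 t := by
  rw [_root_.smul_closedBall _ _ zero_le_one, smul_zero, mul_one, Real.norm_of_nonneg ht]

theorem steiner {K : Set (EuclideanSpace ℝ (Fin (d+2)))} (hK : IsCompact K) (hKc : Convex ℝ K)
    (hKn : K.Nonempty) :
    ∃ m, Cls (d+2) m ∧ m 0 = ballVolume (d+2) ∧
      (∀ s : ℝ, 0 < s → (volume (s • K + closedBall 0 1)).toReal = val (d+2) m s 1) ∧
      ∀ t : ℝ, 0 ≤ t → (volume (K + closedBall 0 t)).toReal = val (d+2) m 1 t := by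
  obtain ⟨m, hm, hv⟩ := euclid_case hK hKc hKn
    (isCompact_closedBall (0 : EuclideanSpace ℝ (Fin (d+2))) 1) (convex_closedBall _ _) (by simp)
  have hv1 : ∀ s : ℝ, 0 < s → (volume (s • K + closedBall 0 1)).toReal = val (d+2) m s 1 := by
    intro s hs
    have := hv s 1 hs one_pos
    rwa [one_smul] at this
  have hv2 : ∀ t : ℝ, 0 < t → (volume (K + closedBall 0 t)).toReal = val (d+2) m 1 t := by
    intro t ht
    have := hv 1 t one_pos ht
    rwa [one_smul, smul_unit ht.le] at this
  refine ⟨m, hm, ?_, hv1, ?_⟩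
  ·
    have hc : Continuous fun s : ℝ => val (d+2) m s 1 := by unfold val; fun_prop
    have h0 : val (d+2) m 0 1 = m 0 := by
      unfold val
      rw [Finset.sum_eq_single 0]
      · simp
      · intro i _ hi; simp [hi]
      · simp
    have h1 : Tendsto (fun s : ℝ => val (d+2) m s 1) (𝓝[>] 0) (𝓝 (m 0)) := by
      rw [← h0]; exact (hc.tendsto 0).mono_left nhdsWithin_le_nhds
    obtain ⟨R, hR⟩ := hK.isBounded.exists_norm_le
    obtain ⟨k0, hk0⟩ := hKn
    have hR0 : 0 ≤ R := (norm_nonneg _).trans (hR k0 hk0)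
    have hc2 : Tendsto (fun s : ℝ => (1 + s * R) ^ (d+2) * ballVolume (d+2)) (𝓝[>] 0)
        (𝓝 (ballVolume (d+2))) := by
      have : Continuous fun s : ℝ => (1 + s * R) ^ (d+2) * ballVolume (d+2) := by fun_prop
      have h2 := this.tendsto 0
      simp only [zero_mul, add_zero, one_pow, one_mul] at h2
      exact h2.mono_left nhdsWithin_le_nhds
    refine tendsto_nhds_unique h1 (tendsto_of_tendsto_of_tendsto_of_le_of_le' tendsto_const_nhds hc2 ?_ ?_)
    · filter_upwards [self_mem_nhdsWithin] with s hs
      have hs' : (0:ℝ) < s := hs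
      rw [← hv1 s hs', ballVolume]
      have hfin : volume (s • K + closedBall (0 : EuclideanSpace ℝ (Fin (d+2))) 1) ≠ ⊤ :=
        ((hK.smul s).add (isCompact_closedBall _ _)).measure_lt_top.ne
      refine ENNReal.toReal_mono hfin ?_
      have e : volume (closedBall (0 : EuclideanSpace ℝ (Fin (d+2))) 1) = volume ((s • k0) +ᵥ closedBall (0 : EuclideanSpace ℝ (Fin (d+2))) 1) := by
        rw [measure_vadd]
      rw [e]
      refine measure_mono ?_
      rintro _ ⟨b, hb, rfl⟩
      exact Set.add_mem_add (Set.smul_mem_smul_set hk0) hb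
    · filter_upwards [self_mem_nhdsWithin] with s hs
      have hs' : (0:ℝ) < s := hs
      rw [← hv1 s hs', ← vol_ball (by positivity)]
      refine ENNReal.toReal_mono measure_closedBall_lt_top.ne (measure_mono ?_)
      rintro _ ⟨_, ⟨k, hk, rfl⟩, b, hb, rfl⟩
      rw [mem_closedBall_zero_iff] at hb ⊢
      calc ‖s • k + b‖ ≤ ‖s • k‖ + ‖b‖ := norm_add_le _ _
        _ ≤ s * R + 1 := by
            rw [norm_smul, Real.norm_of_nonneg hs'.le]
            have := hR k hk
            gcongr
        _ = 1 + s * R := by ring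
  · intro t ht
    rcases ht.eq_or_lt with h | h
    · rw [← h]
      have hc : Continuous fun t : ℝ => val (d+2) m 1 t := by unfold val; fun_prop
      have h1 : Tendsto (fun t : ℝ => val (d+2) m 1 t) (𝓝[>] 0) (𝓝 (val (d+2) m 1 0)) :=
        (hc.tendsto 0).mono_left nhdsWithin_le_nhds
      have h2 : Tendsto (fun t : ℝ => (volume (cthickening t K)).toReal) (𝓝[>] 0) (𝓝 (volume K).toReal) :=
        (ENNReal.tendsto_toReal hK.measure_lt_top.ne).comp
          ((tendsto_measure_cthickening_of_isCompact hK).mono_left nhdsWithin_le_nhds)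
      have e0 : K + closedBall 0 0 = K := by
        rw [closedBall_zero, Set.add_singleton]; simp
      rw [e0]
      refine tendsto_nhds_unique (h2.congr' ?_) h1
      filter_upwards [self_mem_nhdsWithin] with t ht
      have ht' : (0:ℝ) < t := ht
      rw [← hv2 t ht', hK.add_closedBall_zero ht'.le]
    · exact hv2 t h

lemma slope_le {D : ℕ} {r c : ℝ} (h : ∀ ε : ℝ, 0 < ε → 1 + ε * c ≤ (1 + ε * r / 2) ^ (2 * D)) :
    c ≤ D * r := by
  have h1 : HasDerivAt (fun ε : ℝ => (1 + ε * r / 2) ^ (2 * D)) (D * r) 0 := by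
    have h2 : HasDerivAt (fun ε : ℝ => 1 + ε * r / 2) (r / 2) 0 := by
      have := (((hasDerivAt_id (0:ℝ)).mul_const r).div_const 2).const_add 1
      simpa using this
    have h3 := h2.pow (2 * D)
    have e : (D:ℝ) * r = ((2 * D : ℕ) : ℝ) * (1 + 0 * r / 2) ^ (2 * D - 1) * (r / 2) := by
      simp
      ring
    rw [e]
    exact h3
  rw [hasDerivAt_iff_tendsto_slope] at h1
  have h2 := h1.mono_left (nhdsWithin_mono (0:ℝ) (fun x (hx : x ∈ Set.Ioi (0:ℝ)) => ne_of_gt hx))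
  refine ge_of_tendsto h2 ?_
  filter_upwards [self_mem_nhdsWithin] with ε hε
  have hε' : (0:ℝ) < ε := hε
  rw [slope_def_field, le_div_iff₀ (by linarith)]
  have := h ε hε'
  simp only [zero_mul, zero_div, add_zero, one_pow]
  linarith

lemma val_ge {D : ℕ} (hD : 1 ≤ D) {m : ℕ → ℝ} (hm : ∀ i, 0 ≤ m i) {s : ℝ} (hs : 0 ≤ s) :
    m 0 + s * (D * m 1) ≤ val D m s 1 := by
  unfold val
  have h1 : ∑ i ∈ Finset.range 2, (D.choose i : ℝ) * m i * s ^ i * 1 ^ (D - i)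
      ≤ ∑ i ∈ Finset.range (D+1), (D.choose i : ℝ) * m i * s ^ i * 1 ^ (D - i) := by
    refine Finset.sum_le_sum_of_subset_of_nonneg (Finset.range_mono (by omega)) fun i _ _ => ?_
    have := hm i
    positivity
  refine le_trans (le_of_eq ?_) h1
  simp [Finset.sum_range_succ]
  ring

lemma first_order {K H : Set (EuclideanSpace ℝ (Fin (d+2)))} (hK : IsCompact K) (hH : IsCompact H)
    {r : ℝ} (hr : 0 < r) (hKH : K + (-H) = closedBall 0 r) {m m' : ℕ → ℝ}
    (hm : Cls (d+2) m) (hm0 : m 0 = ballVolume (d+2))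
    (hv : ∀ s : ℝ, 0 < s → (volume (s • K + closedBall 0 1)).toReal = val (d+2) m s 1)
    (hm' : Cls (d+2) m') (hm0' : m' 0 = ballVolume (d+2))
    (hv' : ∀ s : ℝ, 0 < s → (volume (s • H + closedBall 0 1)).toReal = val (d+2) m' s 1) :
    m 1 + m' 1 ≤ r * ballVolume (d+2) := by
  set κ := ballVolume (d+2) with hκ
  have hκ0 : 0 < κ := ballVolume_pos _
  have hD : (0:ℝ) < ((d+2 : ℕ) : ℝ) := by positivity
  have key : ((d+2 : ℕ) : ℝ) * (m 1 + m' 1) / κ ≤ ((d+2 : ℕ) : ℝ) * r := by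
    apply slope_le
    intro ε hε
    set B := closedBall (0 : EuclideanSpace ℝ (Fin (d+2))) 1 with hB
    have hBc : IsCompact B := isCompact_closedBall _ _
    have hbm := bm_euclid (A := ε • K + B) (B := ε • (-H) + B) (S := closedBall 0 (1 + ε * r / 2))
      ((hK.smul ε).add hBc) ((hH.neg.smul ε).add hBc) (isCompact_closedBall _ _) (by
        rintro _ ⟨_, ⟨k, hk, rfl⟩, b, hb, rfl⟩ _ ⟨_, ⟨l, hl, rfl⟩, b', hb', rfl⟩
        have hkl : k + l ∈ closedBall (0 : EuclideanSpace ℝ (Fin (d+2))) r := hKH ▸ Set.add_mem_add hk hl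
        rw [hB, mem_closedBall_zero_iff] at hb hb'
        rw [mem_closedBall_zero_iff] at hkl ⊢
        have e : (1 / 2 : ℝ) • (ε • k + b + (ε • l + b')) = (ε / 2) • (k + l) + ((1/2 : ℝ) • b + (1/2:ℝ) • b') := by
          module
        show ‖(1 / 2 : ℝ) • (ε • k + b + (ε • l + b'))‖ ≤ _
        rw [e]
        calc _ ≤ ‖(ε / 2) • (k + l)‖ + (‖(1/2 : ℝ) • b‖ + ‖(1/2:ℝ) • b'‖) :=
              (norm_add_le _ _).trans (by gcongr; exact norm_add_le _ _)
          _ = ε / 2 * ‖k + l‖ + (1 / 2 * ‖b‖ + 1 / 2 * ‖b'‖) := by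
              rw [norm_smul, norm_smul, norm_smul, Real.norm_of_nonneg (by positivity : 0 ≤ ε / 2),
                Real.norm_of_nonneg (by norm_num : (0:ℝ) ≤ 1/2)]
          _ ≤ ε / 2 * r + (1 / 2 * 1 + 1 / 2 * 1) := by gcongr
          _ = 1 + ε * r / 2 := by ring)
    have hneg : volume (ε • (-H) + B) = volume (ε • H + B) := by
      rw [← Measure.measure_neg volume (ε • H + B)]
      congr 1
      rw [neg_add, ← Set.smul_set_neg]
      congr 1
      rw [hB]; simp
    rw [hneg] at hbm
    have hbm2 := ENNReal.toReal_mono (ENNReal.pow_ne_top measure_closedBall_lt_top.ne) hbm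
    rw [ENNReal.toReal_mul, ENNReal.toReal_pow, hv ε hε, hv' ε hε, vol_ball (by positivity), ← hκ] at hbm2
    have g1 := val_ge (D := d+2) (by omega) hm.1 hε.le
    have g2 := val_ge (D := d+2) (by omega) hm'.1 hε.le
    have p1 := hm.1 1
    have p2 := hm'.1 1
    rw [hm0] at g1
    rw [hm0'] at g2
    have g3 : (κ + ε * (((d+2:ℕ):ℝ) * m 1)) * (κ + ε * (((d+2:ℕ):ℝ) * m' 1)) ≤
        val (d+2) m ε 1 * val (d+2) m' ε 1 := by
      refine mul_le_mul g1 g2 (by positivity) (le_trans (by positivity) g1)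
    have g4 := g3.trans hbm2
    set X := ((d+2:ℕ):ℝ) with hX
    have g5 : κ ^ 2 * (1 + ε * (X * (m 1 + m' 1) / κ)) ≤
        (κ + ε * (X * m 1)) * (κ + ε * (X * m' 1)) := by
      have e : κ ^ 2 * (1 + ε * (X * (m 1 + m' 1) / κ)) = κ ^ 2 + ε * κ * (X * (m 1 + m' 1)) := by
        field_simp
      rw [e]
      have : 0 ≤ (ε * (X * m 1)) * (ε * (X * m' 1)) := by positivity
      nlinarith
    have g6 := g5.trans g4
    rw [mul_pow, ← pow_mul, mul_comm (d+2) 2, mul_comm _ (κ^2)] at g6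
    exact le_of_mul_le_mul_left g6 (by positivity)
  rw [div_le_iff₀ hκ0, mul_assoc] at key
  exact le_of_mul_le_mul_left key hD

lemma root_ineq {k : ℕ} (hk : 1 ≤ k) {a b x y c κ r : ℝ} (ha : 0 ≤ a) (hb : 0 ≤ b) (hx : 0 ≤ x) (hy : 0 ≤ y)
    (hc : 0 ≤ c) (hκ : 0 < κ) (hr : 0 ≤ r) (h1 : a * κ ^ (k-1) ≤ x ^ k) (h2 : b * κ ^ (k-1) ≤ y ^ k)
    (h : x + y ≤ r * κ) :
    (c * a) ^ ((1:ℝ) / k) + (c * b) ^ ((1:ℝ) / k) ≤ (c * (r ^ k * κ)) ^ ((1:ℝ) / k) := by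
  have hk0 : k ≠ 0 := by omega
  set e := (c / κ ^ (k-1)) ^ ((1:ℝ) / k) with he
  have he0 : 0 ≤ e := by positivity
  have key : ∀ z : ℝ, 0 ≤ z → (c / κ ^ (k-1) * z ^ k) ^ ((1:ℝ) / k) = e * z := by
    intro z hz
    rw [Real.mul_rpow (by positivity) (by positivity), one_div, Real.pow_rpow_inv_natCast hz hk0, he, one_div]
  have g : ∀ a z : ℝ, 0 ≤ a → 0 ≤ z → a * κ ^ (k-1) ≤ z ^ k → (c * a) ^ ((1:ℝ) / k) ≤ e * z := by
    intro a z ha hz hh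
    rw [← key z hz]
    refine Real.rpow_le_rpow (by positivity) ?_ (by positivity)
    rw [div_mul_eq_mul_div, le_div_iff₀ (by positivity), mul_assoc]
    gcongr
  have e3 : c * (r ^ k * κ) = c / κ ^ (k-1) * (r * κ) ^ k := by
    obtain ⟨j, rfl⟩ : ∃ j, k = j + 1 := ⟨k - 1, by omega⟩
    simp only [Nat.add_sub_cancel]
    field_simp
    ring
  rw [e3, key _ (by positivity)]
  calc _ ≤ e * x + e * y := add_le_add (g a x ha hx h1) (g b y hb hy h2)
    _ = e * (x + y) := by ring
    _ ≤ _ := by gcongr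

end final
end AFW

theorem stmt_2 {d : ℕ} (hd : 2 ≤ d) (k : ℕ) (hk : 1 ≤ k) (hkd : k ≤ d) (r : ℝ) (hr : 0 < r)
    (A : Set (EuclideanSpace ℝ (Fin d))) (hA : A.Nonempty) (hAc : IsCompact A)
    (hcr0 : 0 < circumradius A) (hcr : circumradius A ≤ r) :
    intrinsicVolume d k (rDual r A) ^ ((1 : ℝ) / k)
      + intrinsicVolume d k (rHull r A) ^ ((1 : ℝ) / k)
      ≤ intrinsicVolume d k (closedBall (0 : EuclideanSpace ℝ (Fin d)) r) ^ ((1 : ℝ) / k) := by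
  obtain ⟨d, rfl⟩ : ∃ e, d = e + 2 := ⟨d - 2, by omega⟩
  have hKn := AFW.rDual_nonempty hA hAc hcr
  have hK := AFW.rDual_compact r hA
  have hH := AFW.rHull_compact r hKn
  have hHn : (rHull r A).Nonempty := hA.mono (AFW.subset_rHull r A)
  obtain ⟨m, hm, hm0, hv, ht⟩ := AFW.steiner hK (AFW.rDual_convex r A) hKn
  obtain ⟨m', hm', hm0', hv', ht'⟩ := AFW.steiner hH (AFW.rHull_convex r A) hHn
  have hlin := AFW.first_order hK hH hr (AFW.dual_sub (by omega) hr hA hKn) hm hm0 hv hm' hm0' hv'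
  have hκ := AFW.ballVolume_pos (d+2)
  have hω := AFW.ballVolume_pos (d+2-k)
  rw [AFW.iv_eq hkd _ m (fun j => ht j (Nat.cast_nonneg j)),
    AFW.iv_eq hkd _ m' (fun j => ht' j (Nat.cast_nonneg j)),
    AFW.iv_eq hkd _ (fun i => r ^ i * ballVolume (d+2)) (fun j => by
      rw [closedBall_add_closedBall hr.le (Nat.cast_nonneg j), add_zero, AFW.vol_ball (by positivity),
        add_pow, Finset.sum_mul, AFW.val]
      refine Finset.sum_congr rfl fun i _ => ?_
      ring)]
  simp only [mul_div_right_comm]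
  have c1 := hm.2.2 (k-1) (by omega)
  have c2 := hm'.2.2 (k-1) (by omega)
  rw [Nat.sub_add_cancel hk, hm0] at c1
  rw [Nat.sub_add_cancel hk, hm0'] at c2
  exact AFW.root_ineq hk (hm.1 k) (hm'.1 k) (hm.1 1) (hm'.1 1) (by positivity) hκ hr.le c1 c2 hlin
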